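/- arXiv:2411.02298 — 2 statements merged into one kernel-verified Lean document; each statement's English description precedes it below -/
import Mathlib

section
/- There exist universal constants c* ∈ (0,1), C ≥ 1, and c > 0 such that the following holds. Fix any dimension d ≥ 1, number of components k ≥ 2, any α, ε ∈ (0, c*], and any δ ≤ (αε/d)^C. Then any (ε, δ)-differentially private algorithm which, for every mixture D of at most k Gaussians in ℝ^d, given n i.i.d. samples from D outputs with probability at least 2/3 a probability distribution D̃ on ℝ^d with TV(D̃, D) ≤ α, must satisfy n ≥ c · ( kd²/α² + kd²/(αε) + k·log(1/δ)/(αε) ) / log^C(2 + kd/(αεδ)). -/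
open MeasureTheory ProbabilityTheory Matrix Real
open scoped ENNReal

noncomputable section

instance matMS {d : ℕ} : MeasurableSpace (Matrix (Fin d) (Fin d) ℝ) := MeasurableSpace.pi

/-- The Gaussian measure `N(μ, Σ)` on `ℝ^d`, defined via its density w.r.t. Lebesgue measure. -/
def gauss (d : ℕ) (μ : Fin d → ℝ) (S : Matrix (Fin d) (Fin d) ℝ) : Measure (Fin d → ℝ) :=
  volume.withDensity fun x =>
    ENNReal.ofReal ((Real.sqrt ((2 * Real.pi) ^ d * S.det))⁻¹ *
      Real.exp (-(1/2) * ((x - μ) ⬝ᵥ (S⁻¹ *ᵥ (x - μ)))))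

/-- Total variation distance between two measures. -/
def TV {E : Type*} [MeasurableSpace E] (P Q : Measure E) : ℝ :=
  ⨆ A : {s : Set E // MeasurableSet s}, |(P A.1).toReal - (Q A.1).toReal|

/-- Two datasets are adjacent if they differ in at most one entry. -/
def Adjacent {n : ℕ} {E : Type*} (X X' : Fin n → E) : Prop :=
  ∃ i : Fin n, ∀ j : Fin n, j ≠ i → X j = X' j

/-- `(ε, δ)`-differential privacy of a Markov kernel from datasets to outputs. -/
def IsDP {n : ℕ} {E Ω : Type*} [MeasurableSpace E] [MeasurableSpace Ω]
    (K : Kernel (Fin n → E) Ω) (ε δ : ℝ) : Prop :=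
  ∀ X X' : Fin n → E, Adjacent X X' → ∀ O : Set Ω, MeasurableSet O →
    K X' O ≤ ENNReal.ofReal (Real.exp ε) * K X O + ENNReal.ofReal δ

/-- The Gaussian mixture with weights `w`, means `μs`, covariances `Ss`. -/
def mixture (d k : ℕ) (w : Fin k → ℝ) (μs : Fin k → (Fin d → ℝ))
    (Ss : Fin k → Matrix (Fin d) (Fin d) ℝ) : Measure (Fin d → ℝ) :=
  Measure.sum fun i => ENNReal.ofReal (w i) • gauss d (μs i) (Ss i)

/-- Valid GMM parameters: nonnegative weights summing to 1, positive definite covariances. -/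
def IsMixtureParams {d k : ℕ} (w : Fin k → ℝ) (Ss : Fin k → Matrix (Fin d) (Fin d) ℝ) : Prop :=
  (∀ i, 0 ≤ w i) ∧ (∑ i, w i = 1) ∧ ∀ i, (Ss i).PosDef


/-! ### Generic facts on product measures -/

/-- Resampling one coordinate of a product probability measure. -/
theorem mp_update {ι : Type*} [Fintype ι] [DecidableEq ι] {X : ι → Type*}
    [∀ i, MeasurableSpace (X i)] (μ : ∀ i, Measure (X i)) [∀ i, IsProbabilityMeasure (μ i)]
    (j : ι) :
    MeasurePreserving (fun z : (∀ i, X i) × X j => Function.update z.1 j z.2)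
      ((Measure.pi μ).prod (μ j)) (Measure.pi μ) := by
  have hm : Measurable (fun z : (∀ i, X i) × X j => Function.update z.1 j z.2) := by
    rw [measurable_pi_iff]
    intro i
    by_cases h : i = j
    · subst h
      simpa using measurable_snd
    · simp only [Function.update_of_ne h]
      fun_prop
  refine ⟨hm, ?_⟩
  symm
  refine Measure.pi_eq fun s hs => ?_
  rw [Measure.map_apply hm (MeasurableSet.univ_pi hs)]
  have : (fun z : (∀ i, X i) × X j => Function.update z.1 j z.2) ⁻¹' (Set.univ.pi s)
      = (Set.univ.pi (Function.update s j Set.univ)) ×ˢ s j := by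
    ext z
    simp only [Set.mem_preimage, Set.mem_univ_pi, Set.mem_prod]
    constructor
    · intro h
      refine ⟨fun i => ?_, by simpa using h j⟩
      by_cases hi : i = j
      · subst hi; simp
      · have := h i
        rw [Function.update_of_ne hi] at this ⊢
        exact this
    · rintro ⟨h1, h2⟩ i
      by_cases hi : i = j
      · subst hi; simpa using h2
      · have := h1 i
        rw [Function.update_of_ne hi] at this ⊢
        exact this
  rw [this, Measure.prod_prod, Measure.pi_pi]
  rw [← Finset.mul_prod_erase Finset.univ _ (Finset.mem_univ j),
    ← Finset.mul_prod_erase Finset.univ (fun i => μ i (s i)) (Finset.mem_univ j)]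
  simp only [Function.update_self, measure_univ, one_mul]
  rw [mul_comm]
  congr 1
  refine Finset.prod_congr rfl fun i hi => ?_
  rw [Function.update_of_ne (Finset.ne_of_mem_erase hi)]

theorem integral_pi_update {ι : Type*} [Fintype ι] [DecidableEq ι] {X : ι → Type*}
    [∀ i, MeasurableSpace (X i)] (μ : ∀ i, Measure (X i)) [∀ i, IsProbabilityMeasure (μ i)]
    (j : ι) {f : (∀ i, X i) → ℝ} (hf : Integrable f (Measure.pi μ)) :
    ∫ x, f x ∂(Measure.pi μ) = ∫ x, ∫ t, f (Function.update x j t) ∂(μ j) ∂(Measure.pi μ) := by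
  have h := mp_update μ j
  have h2 : Integrable (fun z : (∀ i, X i) × X j => f (Function.update z.1 j z.2))
      ((Measure.pi μ).prod (μ j)) := h.integrable_comp_of_integrable hf
  rw [← integral_prod _ h2]
  rw [← h.map_eq] at hf
  conv_lhs => rw [← h.map_eq]
  rw [integral_map h.measurable.aemeasurable hf.1]

/-- A factor depending on one coordinate only splits off. -/
theorem integral_pi_split {ι : Type*} [Fintype ι] [DecidableEq ι] {X : ι → Type*}
    [∀ i, MeasurableSpace (X i)] (μ : ∀ i, Measure (X i)) [∀ i, IsProbabilityMeasure (μ i)]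
    (j : ι) {g : (∀ i, X i) → ℝ} {h : X j → ℝ}
    (hf : Integrable (fun x => h (x j) * g x) (Measure.pi μ))
    (hg : ∀ x t, g (Function.update x j t) = g x) :
    ∫ x, h (x j) * g x ∂(Measure.pi μ) = (∫ t, h t ∂(μ j)) * ∫ x, g x ∂(Measure.pi μ) := by
  rw [integral_pi_update μ j hf]
  simp only [Function.update_self, hg, integral_mul_const]
  rw [integral_const_mul]

theorem pi_withDensity_real {ι : Type*} [Fintype ι] {X : ι → Type*}
    [∀ i, MeasurableSpace (X i)] (μ : ∀ i, Measure (X i)) [∀ i, SigmaFinite (μ i)]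
    (f : ∀ i, X i → ℝ) (hf0 : ∀ i x, 0 ≤ f i x) (hf : ∀ i, Integrable (f i) (μ i)) :
    Measure.pi (fun i => (μ i).withDensity (fun x => ENNReal.ofReal (f i x)))
      = (Measure.pi μ).withDensity (fun x => ENNReal.ofReal (∏ i, f i (x i))) := by
  have : ∀ i, SigmaFinite ((μ i).withDensity (fun x => ENNReal.ofReal (f i x))) := fun i => by
    have := isFiniteMeasure_withDensity_ofReal (hf i).2
    infer_instance
  refine Measure.pi_eq fun s hs => ?_
  rw [withDensity_apply _ (MeasurableSet.univ_pi hs), Measure.restrict_pi_pi]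
  have hf' : ∀ i, Integrable (f i) ((μ i).restrict (s i)) := fun i => (hf i).restrict
  have hprod : Integrable (fun x : ∀ i, X i => ∏ i, f i (x i))
      (Measure.pi fun i => (μ i).restrict (s i)) := Integrable.fintype_prod_dep hf'
  rw [← ofReal_integral_eq_lintegral_ofReal hprod
    (Filter.Eventually.of_forall fun x => Finset.prod_nonneg fun i _ => hf0 i _)]
  rw [integral_fintype_prod_eq_prod,
    ENNReal.ofReal_prod_of_nonneg (fun i _ => integral_nonneg (hf0 i))]
  refine Finset.prod_congr rfl fun i _ => ?_
  rw [withDensity_apply _ (hs i), ofReal_integral_eq_lintegral_ofReal (hf' i)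
    (Filter.Eventually.of_forall (hf0 i))]

/-! ### Total variation -/

theorem TV_bdd {E : Type*} [MeasurableSpace E] (P Q : Measure E) [IsProbabilityMeasure P]
    [IsProbabilityMeasure Q] :
    BddAbove (Set.range fun A : {s : Set E // MeasurableSet s} =>
      |(P A.1).toReal - (Q A.1).toReal|) := by
  refine ⟨1, ?_⟩
  rintro _ ⟨A, rfl⟩
  have h1 : (P A.1).toReal ≤ 1 := measureReal_le_one
  have h2 : (Q A.1).toReal ≤ 1 := measureReal_le_one
  have h3 : 0 ≤ (P A.1).toReal := ENNReal.toReal_nonneg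
  have h4 : 0 ≤ (Q A.1).toReal := ENNReal.toReal_nonneg
  simp only
  rw [abs_le]; constructor <;> linarith

theorem le_TV {E : Type*} [MeasurableSpace E] (P Q : Measure E) [IsProbabilityMeasure P]
    [IsProbabilityMeasure Q] {A : Set E} (hA : MeasurableSet A) :
    |(P A).toReal - (Q A).toReal| ≤ TV P Q :=
  le_ciSup (TV_bdd P Q) (⟨A, hA⟩ : {s : Set E // MeasurableSet s})

theorem TV_le {E : Type*} [MeasurableSpace E] (P Q : Measure E) {r : ℝ}
    (h : ∀ A : Set E, MeasurableSet A → |(P A).toReal - (Q A).toReal| ≤ r) : TV P Q ≤ r := by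
  have : Nonempty {s : Set E // MeasurableSet s} := ⟨⟨∅, MeasurableSet.empty⟩⟩
  exact ciSup_le fun A => h A.1 A.2

theorem exists_TV_half {E : Type*} [MeasurableSpace E] (P Q : Measure E) [IsProbabilityMeasure P]
    [IsProbabilityMeasure Q] :
    ∃ A : Set E, MeasurableSet A ∧ TV P Q ≤ 2 * |(P A).toReal - (Q A).toReal| := by
  by_contra! h
  have h1 : TV P Q ≤ TV P Q / 2 := TV_le P Q fun A hA => by
    have := h A hA
    linarith
  have h2 := h ∅ MeasurableSet.empty
  simp at h2
  linarith

theorem layer01 {E : Type*} [MeasurableSpace E] (ν : Measure E)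
    [IsProbabilityMeasure ν] {h : E → ℝ} (hm : Measurable h)
    (h0 : ∀ x, 0 ≤ h x) (h1 : ∀ x, h x ≤ 1) :
    ∫ x, h x ∂ν = ∫ t in Set.Ioc (0:ℝ) 1, ν.real {a | t < h a} := by
  have hintg : Integrable h ν :=
    Integrable.of_bound hm.aestronglyMeasurable 1
      (Filter.Eventually.of_forall fun x => by
        rw [Real.norm_eq_abs, abs_of_nonneg (h0 x)]; exact h1 x)
  rw [Integrable.integral_eq_integral_meas_lt hintg (Filter.Eventually.of_forall h0)]
  refine setIntegral_eq_of_subset_of_forall_sdiff_eq_zero measurableSet_Ioi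
    (fun x hx => hx.1) ?_
  rintro t ⟨ht, ht'⟩
  have : {a | t < h a} = ∅ := by
    ext a
    simp only [Set.mem_ofPred_eq, Set.mem_empty_iff_false, iff_false, not_lt]
    by_contra hlt
    push Not at hlt
    exact ht' ⟨ht, hlt.le.trans (h1 a)⟩
  rw [this]; simp

theorem layer01_int {E : Type*} [MeasurableSpace E] (ν : Measure E)
    [IsProbabilityMeasure ν] (h : E → ℝ) :
    Integrable (fun t : ℝ => ν.real {a | t < h a}) (volume.restrict (Set.Ioc (0:ℝ) 1)) := by
  have hanti : Antitone (fun t : ℝ => ν.real {a | t < h a}) := fun s t hst =>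
    measureReal_mono (fun a ha => lt_of_le_of_lt hst ha)
  exact Integrable.of_bound hanti.measurable.aestronglyMeasurable 1
    (Filter.Eventually.of_forall fun t => by
      rw [Real.norm_eq_abs, abs_of_nonneg measureReal_nonneg]; exact measureReal_le_one)

/-- A `[0,1]`-valued test function is controlled by the total variation distance. -/
theorem integral_sub_le_TV {E : Type*} [MeasurableSpace E] (P Q : Measure E)
    [IsProbabilityMeasure P] [IsProbabilityMeasure Q] {h : E → ℝ} (hm : Measurable h)
    (h0 : ∀ x, 0 ≤ h x) (h1 : ∀ x, h x ≤ 1) :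
    ∫ x, h x ∂P - ∫ x, h x ∂Q ≤ TV P Q := by
  rw [layer01 P hm h0 h1, layer01 Q hm h0 h1, ← integral_sub (layer01_int P h) (layer01_int Q h)]
  calc _ ≤ ∫ t in Set.Ioc (0:ℝ) 1, TV P Q := by
        refine integral_mono ((layer01_int P h).sub (layer01_int Q h)) (integrable_const _)
          fun t => ?_
        exact (le_abs_self _).trans (le_TV P Q (measurableSet_lt measurable_const hm))
    _ = TV P Q := by simp

/-- Approximate differential privacy for bounded test functions. -/
theorem dp_integral {Ω : Type*} [MeasurableSpace Ω] (κ κ' : Measure Ω)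
    [IsProbabilityMeasure κ] [IsProbabilityMeasure κ'] {ε δ : ℝ} (hδ : 0 ≤ δ)
    (hdp : ∀ O : Set Ω, MeasurableSet O →
      κ' O ≤ ENNReal.ofReal (Real.exp ε) * κ O + ENNReal.ofReal δ)
    {h : Ω → ℝ} {H : ℝ} (hm : Measurable h) (h0 : ∀ x, 0 ≤ h x) (h1 : ∀ x, h x ≤ H) :
    ∫ x, h x ∂κ' ≤ Real.exp ε * ∫ x, h x ∂κ + δ * H := by
  have hreal : ∀ O : Set Ω, MeasurableSet O → κ'.real O ≤ Real.exp ε * κ.real O + δ := by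
    intro O hO
    have := ENNReal.toReal_mono (by finiteness) (hdp O hO)
    rw [ENNReal.toReal_add (by finiteness) (by finiteness), ENNReal.toReal_mul,
      ENNReal.toReal_ofReal (Real.exp_pos ε).le, ENNReal.toReal_ofReal hδ] at this
    exact this
  have hΩ : Nonempty Ω := by
    by_contra hne
    rw [not_nonempty_iff] at hne
    have := measure_univ (μ := κ)
    rw [Set.univ_eq_empty_iff.2 hne] at this
    simp at this
  obtain ⟨x0⟩ := hΩ
  have hH : 0 ≤ H := (h0 x0).trans (h1 x0)
  rcases hH.eq_or_lt with hH0 | hHpos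
  · have : ∀ x, h x = 0 := fun x => le_antisymm ((h1 x).trans hH0.ge) (h0 x)
    simp [this, ← hH0]
  · have a0 : ∀ x, 0 ≤ h x / H := fun x => div_nonneg (h0 x) hH
    have a1 : ∀ x, h x / H ≤ 1 := fun x => (div_le_one hHpos).2 (h1 x)
    have am : Measurable fun x => h x / H := hm.div_const H
    have key : ∫ x, h x / H ∂κ' ≤ Real.exp ε * ∫ x, h x / H ∂κ + δ := by
      rw [layer01 κ' am a0 a1, layer01 κ am a0 a1]
      calc _ ≤ ∫ t in Set.Ioc (0:ℝ) 1, (Real.exp ε * κ.real {a | t < h a / H} + δ) := by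
            refine integral_mono (layer01_int κ' _)
              (((layer01_int κ _).const_mul _).add (integrable_const _)) fun t => ?_
            exact hreal _ (measurableSet_lt measurable_const am)
        _ = _ := by
            rw [integral_add ((layer01_int κ _).const_mul _) (integrable_const _),
              integral_const_mul]
            simp
    rw [integral_div, integral_div] at key
    have := mul_le_mul_of_nonneg_right key hH
    field_simp at this
    linarith

/-- Signed version of `dp_integral`. -/
theorem dp_integral_signed {Ω : Type*} [MeasurableSpace Ω] (κ κ' : Measure Ω)
    [IsProbabilityMeasure κ] [IsProbabilityMeasure κ'] {ε δ : ℝ} (hε : 0 ≤ ε) (hδ : 0 ≤ δ)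
    (hdp : ∀ O : Set Ω, MeasurableSet O →
      κ' O ≤ ENNReal.ofReal (Real.exp ε) * κ O + ENNReal.ofReal δ)
    (hdp' : ∀ O : Set Ω, MeasurableSet O →
      κ O ≤ ENNReal.ofReal (Real.exp ε) * κ' O + ENNReal.ofReal δ)
    {g : Ω → ℝ} {H : ℝ} (hm : Measurable g) (h1 : ∀ x, |g x| ≤ H) :
    ∫ x, g x ∂κ' ≤ (Real.exp ε + Real.exp (-ε)) / 2 * ∫ x, g x ∂κ
      + (Real.exp ε - Real.exp (-ε)) / 2 * ∫ x, |g x| ∂κ + 2 * δ * H := by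
  have hintg : ∀ (ν : Measure Ω) [IsProbabilityMeasure ν], Integrable g ν := fun ν _ =>
    Integrable.of_bound hm.aestronglyMeasurable H (Filter.Eventually.of_forall h1)
  have hp := dp_integral κ κ' hδ hdp (h := fun x => (|g x| + g x) / 2) (H := H)
    ((hm.abs.add hm).div_const 2)
    (fun x => by have := neg_abs_le (g x); linarith)
    (fun x => by have := le_abs_self (g x); have := h1 x; linarith)
  have hn := dp_integral κ' κ hδ hdp' (h := fun x => (|g x| - g x) / 2) (H := H)
    ((hm.abs.sub hm).div_const 2)
    (fun x => by have := le_abs_self (g x); linarith)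
    (fun x => by have := neg_abs_le (g x); have := h1 x; linarith)
  rw [integral_div, integral_div, integral_add (hintg κ').abs (hintg κ'),
    integral_add (hintg κ).abs (hintg κ)] at hp
  rw [integral_div, integral_div, integral_sub (hintg κ').abs (hintg κ'),
    integral_sub (hintg κ).abs (hintg κ)] at hn
  have hH : 0 ≤ δ * H := by
    have hΩ : Nonempty Ω := by
      by_contra hne
      rw [not_nonempty_iff] at hne
      have := measure_univ (μ := κ)
      rw [Set.univ_eq_empty_iff.2 hne] at this
      simp at this
    obtain ⟨x0⟩ := hΩ
    exact mul_nonneg hδ ((abs_nonneg _).trans (h1 x0))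
  have hexp : Real.exp (-ε) ≤ 1 := Real.exp_le_one_iff.2 (by linarith)
  have hprod : Real.exp (-ε) * Real.exp ε = 1 := by rw [← Real.exp_add]; simp
  have hn2 := mul_le_mul_of_nonneg_left hn (Real.exp_pos (-ε)).le
  have e1 : Real.exp (-ε) * (Real.exp ε * ((∫ x, |g x| ∂κ' - ∫ x, g x ∂κ') / 2) + δ * H)
      = (∫ x, |g x| ∂κ' - ∫ x, g x ∂κ') / 2 + Real.exp (-ε) * (δ * H) := by
    rw [mul_add, ← mul_assoc, hprod, one_mul]
  rw [e1] at hn2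
  have e2 : Real.exp (-ε) * (δ * H) ≤ δ * H := by nlinarith
  nlinarith

theorem integral_sub_le_two_TV {E : Type*} [MeasurableSpace E] (P Q : Measure E)
    [IsProbabilityMeasure P] [IsProbabilityMeasure Q] {h : E → ℝ} (hm : Measurable h)
    (h1 : ∀ x, |h x| ≤ 1) :
    ∫ x, h x ∂P - ∫ x, h x ∂Q ≤ 2 * TV P Q := by
  have hintg : ∀ (ν : Measure E) [IsProbabilityMeasure ν], Integrable h ν := fun ν _ =>
    Integrable.of_bound hm.aestronglyMeasurable 1 (Filter.Eventually.of_forall h1)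
  have := integral_sub_le_TV P Q (h := fun x => (1 + h x) / 2) (by fun_prop)
    (fun x => by have := abs_le.1 (h1 x); linarith) (fun x => by have := abs_le.1 (h1 x); linarith)
  have e : ∀ (ν : Measure E) [IsProbabilityMeasure ν],
      ∫ x, (1 + h x) / 2 ∂ν = (1 + ∫ x, h x ∂ν) / 2 := by
    intro ν _
    rw [integral_div, integral_add (integrable_const _) (hintg ν)]
    simp
  rw [e P, e Q] at this
  linarith

/-! ### The abstract fingerprinting / van Trees argument -/

/-- Uniform probability measure on `[-1,1]`. -/
def unif : Measure ℝ := (2 : ℝ≥0∞)⁻¹ • volume.restrict (Set.Icc (-1 : ℝ) 1)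

instance unif_prob : IsProbabilityMeasure unif := by
  constructor
  simp only [unif, Measure.smul_apply, Measure.restrict_apply MeasurableSet.univ, Set.univ_inter,
    Real.volume_Icc, smul_eq_mul]
  norm_num
  exact ENNReal.inv_mul_cancel (by norm_num) (by norm_num)

theorem integral_unif (f : ℝ → ℝ) : ∫ u, f u ∂unif = (1 / 2) * ∫ u in (-1 : ℝ)..1, f u := by
  rw [unif, integral_smul_measure, intervalIntegral.integral_of_le (by norm_num),
    integral_Icc_eq_integral_Ioc]
  simp

theorem unif_ae : ∀ᵐ u ∂unif, |u| ≤ 1 := by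
  have h : ∀ᵐ u ∂(volume.restrict (Set.Icc (-1 : ℝ) 1)), |u| ≤ 1 := by
    refine (ae_restrict_iff' measurableSet_Icc).2 (Filter.Eventually.of_forall fun u hu => ?_)
    exact abs_le.2 hu
  exact Measure.ae_smul_measure h _

/-- Uniform prior on the cube. -/
def prior (P : Type*) [Fintype P] : Measure (P → ℝ) := Measure.pi fun _ => unif

instance prior_prob (P : Type*) [Fintype P] : IsProbabilityMeasure (prior P) := by
  unfold prior; infer_instance

theorem prior_ae (P : Type*) [Fintype P] : ∀ᵐ t ∂(prior P), ∀ p, |t p| ≤ 1 := by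
  rw [ae_all_iff]
  intro p
  exact (measurePreserving_eval (fun _ : P => unif) p).quasiMeasurePreserving.ae unif_ae

/-- The measure with density `m t`. -/
def dens {E P : Type*} [MeasurableSpace E] (lam : Measure E) (m : (P → ℝ) → E → ℝ)
    (t : P → ℝ) : Measure E := lam.withDensity fun x => ENNReal.ofReal (m t x)

structure IsFam {E P : Type*} [MeasurableSpace E] [Fintype P] [DecidableEq P] (lam : Measure E)
    (m : (P → ℝ) → E → ℝ) (s : P → (P → ℝ) → E → ℝ) (V B1 B2 : ℝ) : Prop where
  m_meas : Measurable (fun z : (P → ℝ) × E => m z.1 z.2)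
  s_meas : ∀ p, Measurable (fun z : (P → ℝ) × E => s p z.1 z.2)
  m_pos : ∀ t x, 0 < m t x
  m_int : ∀ t, Integrable (m t) lam
  m_one : ∀ t, ∫ x, m t x ∂lam = 1
  deriv : ∀ p t x u, HasDerivAt (fun u => m (Function.update t p u) x)
    (s p (Function.update t p u) x * m (Function.update t p u) x) u
  s_cont : ∀ p t x, Continuous fun u => s p (Function.update t p u) x
  s_memLp : ∀ p t, MemLp (s p t) 2 (dens lam m t)
  s_zero : ∀ p t, ∫ x, s p t x ∂(dens lam m t) = 0
  s_var : ∀ p t, ∫ x, (s p t x) ^ 2 ∂(dens lam m t) ≤ V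
  s_l1 : ∀ t (c : P → ℝ), (∀ p, |c p| ≤ 1) → ∫ x, |∑ p, c p * s p t x| ∂(dens lam m t) ≤ B1
  s_abs : ∀ t, ∑ p, ∫ x, |s p t x| ∂(dens lam m t) ≤ B2

namespace IsFam

variable {E P : Type*} [MeasurableSpace E] [Fintype P] [DecidableEq P] {lam : Measure E}
  {m : (P → ℝ) → E → ℝ} {s : P → (P → ℝ) → E → ℝ} {V B1 B2 : ℝ}

theorem m_meas' (h : IsFam lam m s V B1 B2) (t : P → ℝ) : Measurable (m t) :=
  h.m_meas.comp (measurable_const.prodMk measurable_id)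

theorem s_meas' (h : IsFam lam m s V B1 B2) (p : P) (t : P → ℝ) : Measurable (s p t) :=
  (h.s_meas p).comp (measurable_const.prodMk measurable_id)

theorem prob (h : IsFam lam m s V B1 B2) (t : P → ℝ) : IsProbabilityMeasure (dens lam m t) := by
  constructor
  rw [dens, withDensity_apply _ MeasurableSet.univ, Measure.restrict_univ,
    ← ofReal_integral_eq_lintegral_ofReal (h.m_int t)
      (Filter.Eventually.of_forall fun x => (h.m_pos t x).le), h.m_one t]
  simp

theorem s_int (h : IsFam lam m s V B1 B2) (p : P) (t : P → ℝ) :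
    Integrable (s p t) (dens lam m t) := by
  have := h.prob t
  exact (h.s_memLp p t).integrable (by norm_num)

theorem pi_dens [SigmaFinite lam] (h : IsFam lam m s V B1 B2) (n : ℕ) (t : P → ℝ) :
    Measure.pi (fun _ : Fin n => dens lam m t)
      = (Measure.pi fun _ : Fin n => lam).withDensity
          (fun x => ENNReal.ofReal (∏ l, m t (x l))) := by
  unfold dens
  exact pi_withDensity_real (fun _ : Fin n => lam) (fun _ => m t)
    (fun _ x => (h.m_pos t x).le) (fun _ => h.m_int t)

theorem prod_meas (h : IsFam lam m s V B1 B2) (n : ℕ) :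
    Measurable (fun z : (P → ℝ) × (Fin n → E) => ∏ l, m z.1 (z.2 l)) := by
  refine Finset.measurable_prod _ fun l _ => ?_
  exact h.m_meas.comp (measurable_fst.prodMk ((measurable_pi_apply l).comp measurable_snd))

theorem prod_meas' (h : IsFam lam m s V B1 B2) (n : ℕ) (t : P → ℝ) :
    Measurable (fun x : (Fin n → E) => ∏ l, m t (x l)) :=
  (h.prod_meas n).comp (measurable_const.prodMk measurable_id)

theorem sum_meas (h : IsFam lam m s V B1 B2) (n : ℕ) (p : P) :
    Measurable (fun z : (P → ℝ) × (Fin n → E) => ∑ l, s p z.1 (z.2 l)) := by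
  refine Finset.measurable_sum _ fun l _ => ?_
  exact (h.s_meas p).comp (measurable_fst.prodMk ((measurable_pi_apply l).comp measurable_snd))

theorem prod_nonneg (h : IsFam lam m s V B1 B2) {n : ℕ} (t : P → ℝ) (x : Fin n → E) :
    0 ≤ ∏ l, m t (x l) := Finset.prod_nonneg fun l _ => (h.m_pos t _).le

theorem integral_pi_dens [SigmaFinite lam] (h : IsFam lam m s V B1 B2) (n : ℕ) (t : P → ℝ)
    (f : (Fin n → E) → ℝ) :
    ∫ x, f x ∂(Measure.pi (fun _ : Fin n => dens lam m t))
      = ∫ x, (∏ l, m t (x l)) * f x ∂(Measure.pi fun _ : Fin n => lam) := by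
  rw [h.pi_dens, integral_withDensity_eq_integral_toReal_smul
    ((h.prod_meas' n t).ennreal_ofReal) (Filter.Eventually.of_forall fun x => by simp)]
  simp only [smul_eq_mul]
  refine integral_congr_ae (Filter.Eventually.of_forall fun x => ?_)
  simp only
  rw [ENNReal.toReal_ofReal (h.prod_nonneg t x)]

theorem integrable_pi_dens [SigmaFinite lam] (h : IsFam lam m s V B1 B2) (n : ℕ) (t : P → ℝ)
    (f : (Fin n → E) → ℝ) :
    Integrable f (Measure.pi (fun _ : Fin n => dens lam m t))
      ↔ Integrable (fun x => (∏ l, m t (x l)) * f x) (Measure.pi fun _ : Fin n => lam) := by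
  rw [h.pi_dens, integrable_withDensity_iff_integrable_smul'
    ((h.prod_meas' n t).ennreal_ofReal) (Filter.Eventually.of_forall fun x => by simp)]
  simp only [smul_eq_mul]
  refine integrable_congr (Filter.Eventually.of_forall fun x => ?_)
  simp only
  rw [ENNReal.toReal_ofReal (h.prod_nonneg t x)]

theorem s_eval_int (h : IsFam lam m s V B1 B2) {n : ℕ} (p : P) (t : P → ℝ) (l : Fin n) :
    Integrable (fun x : Fin n → E => s p t (x l))
      (Measure.pi (fun _ : Fin n => dens lam m t)) := by
  have := h.prob t
  exact integrable_comp_eval (μ := fun _ : Fin n => dens lam m t) (h.s_int p t)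

theorem s_abs_one (h : IsFam lam m s V B1 B2) (p : P) (t : P → ℝ) :
    ∫ x, |s p t x| ∂(dens lam m t) ≤ B2 :=
  (Finset.single_le_sum (f := fun p => ∫ x, |s p t x| ∂(dens lam m t))
    (fun _ _ => integral_nonneg fun _ => abs_nonneg _) (Finset.mem_univ p)).trans (h.s_abs t)

theorem sum_abs_le (h : IsFam lam m s V B1 B2) {n : ℕ} (p : P) (t : P → ℝ) :
    ∫ x, |∑ l, s p t (x l)| ∂(Measure.pi (fun _ : Fin n => dens lam m t)) ≤ n * B2 := by
  have := h.prob t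
  calc _ ≤ ∫ x, ∑ l, |s p t (x l)| ∂(Measure.pi (fun _ : Fin n => dens lam m t)) := by
        refine integral_mono ((integrable_finsetSum _ fun l _ => h.s_eval_int p t l).abs)
          (integrable_finsetSum _ fun l _ => (h.s_eval_int p t l).abs) fun x => ?_
        exact Finset.abs_sum_le_sum_abs _ _
    _ = ∑ l : Fin n, ∫ x, |s p t (x l)| ∂(Measure.pi (fun _ : Fin n => dens lam m t)) :=
        integral_finsetSum _ fun l _ => (h.s_eval_int p t l).abs
    _ ≤ ∑ l : Fin n, B2 := by
        refine Finset.sum_le_sum fun l _ => ?_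
        rw [integral_comp_eval (μ := fun _ : Fin n => dens lam m t) (i := l)
          (f := fun y => |s p t y|) (h.s_meas' p t).abs.aestronglyMeasurable]
        exact h.s_abs_one p t
    _ = n * B2 := by simp

/-- Integration by parts in one parameter, pointwise in the data. -/
theorem by_parts (h : IsFam lam m s V B1 B2) {n : ℕ} (p : P) (t : P → ℝ) (x : Fin n → E) :
    ∫ u, 2 * u * ∏ l, m (Function.update t p u) (x l) ∂unif
      = ∫ u, (1 - u ^ 2) * ((∑ l, s p (Function.update t p u) (x l)) *
          ∏ l, m (Function.update t p u) (x l)) ∂unif := by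
  have hd : ∀ u, HasDerivAt (fun u => ∏ l, m (Function.update t p u) (x l))
      ((∑ l, s p (Function.update t p u) (x l)) * ∏ l, m (Function.update t p u) (x l)) u := by
    intro u
    have := HasDerivAt.fun_finsetProd (u := (Finset.univ : Finset (Fin n)))
      (f := fun l u => m (Function.update t p u) (x l))
      (f' := fun l => s p (Function.update t p u) (x l) * m (Function.update t p u) (x l))
      (x := u) (fun l _ => h.deriv p t (x l) u)
    refine this.congr_deriv ?_
    rw [Finset.sum_mul]
    refine Finset.sum_congr rfl fun l _ => ?_
    rw [← Finset.mul_prod_erase Finset.univ (fun l => m (Function.update t p u) (x l))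
      (Finset.mem_univ l)]
    rw [smul_eq_mul]
    ring
  have hw : ∀ u : ℝ, HasDerivAt (fun u : ℝ => 1 - u ^ 2) (-(2 * u)) u := by
    intro u
    have := ((hasDerivAt_id u).pow 2).const_sub 1
    simpa using this
  have hc : Continuous (fun u => (∑ l, s p (Function.update t p u) (x l)) *
      ∏ l, m (Function.update t p u) (x l)) := by
    refine Continuous.mul (continuous_finsetSum _ fun l _ => h.s_cont p t (x l)) ?_
    exact continuous_iff_continuousAt.2 fun u => (hd u).continuousAt
  rw [integral_unif, integral_unif]
  congr 1
  rw [intervalIntegral.integral_mul_deriv_eq_deriv_mul (fun u _ => hw u) (fun u _ => hd u)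
    ((by fun_prop : Continuous fun u : ℝ => -(2 * u)).intervalIntegrable _ _)
    (hc.intervalIntegrable _ _)]
  simp [← intervalIntegral.integral_neg]

theorem main_identity [SigmaFinite lam] (h : IsFam lam m s V B1 B2) {n : ℕ} (p : P)
    {F : (Fin n → E) → ℝ} (hF : Measurable F) (hF1 : ∀ x, |F x| ≤ 1) :
    ∫ t, 2 * t p * ∫ x, F x ∂(Measure.pi (fun _ : Fin n => dens lam m t)) ∂(prior P)
      = ∫ t, (1 - t p ^ 2) * ∫ x, F x * ∑ l, s p t (x l)
          ∂(Measure.pi (fun _ : Fin n => dens lam m t)) ∂(prior P) := by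
  set L := Measure.pi fun _ : Fin n => lam
  have hprob := h.prob
  -- integrability on the product space
  have hG1 : Integrable (fun z : (P → ℝ) × (Fin n → E) => ∏ l, m z.1 (z.2 l))
      ((prior P).prod L) := by
    rw [integrable_prod_iff (h.prod_meas n).aestronglyMeasurable]
    have e : ∀ t, Integrable (fun x : Fin n → E => ∏ l, m t (x l)) L := fun t => by
      have := (h.integrable_pi_dens n t (fun _ => 1)).1 (integrable_const _)
      simpa using this
    refine ⟨Filter.Eventually.of_forall e, ?_⟩
    have : ∀ t, ∫ x : Fin n → E, ‖∏ l, m t (x l)‖ ∂L = 1 := fun t => by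
      have h2 := h.integral_pi_dens n t (fun _ => 1)
      simp only [integral_const, probReal_univ, smul_eq_mul, mul_one] at h2
      rw [h2]
      refine integral_congr_ae (Filter.Eventually.of_forall fun x => ?_)
      simp only
      rw [Real.norm_eq_abs, abs_of_nonneg (h.prod_nonneg t x)]
    simp only [this]
    exact integrable_const _
  have hH1 : Integrable (fun z : (P → ℝ) × (Fin n → E) =>
      (∏ l, m z.1 (z.2 l)) * ∑ l, s p z.1 (z.2 l)) ((prior P).prod L) := by
    have hm : AEStronglyMeasurable (fun z : (P → ℝ) × (Fin n → E) =>
      (∏ l, m z.1 (z.2 l)) * ∑ l, s p z.1 (z.2 l)) ((prior P).prod L) :=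
      ((h.prod_meas n).mul (h.sum_meas n p)).aestronglyMeasurable
    rw [integrable_prod_iff hm]
    refine ⟨Filter.Eventually.of_forall fun t => ?_, ?_⟩
    · exact (h.integrable_pi_dens n t _).1 (integrable_finsetSum _ fun l _ => h.s_eval_int p t l)
    · refine Integrable.of_bound hm.norm.integral_prod_right' (n * B2)
        (Filter.Eventually.of_forall fun t => ?_)
      simp only
      rw [Real.norm_eq_abs, abs_of_nonneg (integral_nonneg fun _ => norm_nonneg _)]
      refine le_trans (le_of_eq ?_) (h.sum_abs_le (n := n) p t)
      rw [h.integral_pi_dens]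
      refine integral_congr_ae (Filter.Eventually.of_forall fun x => ?_)
      simp only
      rw [Real.norm_eq_abs, abs_mul, abs_of_nonneg (h.prod_nonneg t x)]
  have hae : ∀ᵐ z ∂((prior P).prod L), |z.1 p| ≤ 1 := by
    have := (prior_ae P).mono fun t ht => ht p
    exact Measure.quasiMeasurePreserving_fst.ae this
  have hG : Integrable (fun z : (P → ℝ) × (Fin n → E) =>
      2 * z.1 p * (∏ l, m z.1 (z.2 l)) * F z.2) ((prior P).prod L) := by
    refine Integrable.mono (hG1.const_mul 2) ?_ ?_
    · have := h.prod_meas n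
      exact Measurable.aestronglyMeasurable (by fun_prop)
    · filter_upwards [hae] with z hz
      simp only [norm_mul, Real.norm_eq_abs]
      have h1 := hF1 z.2
      calc |2| * |z.1 p| * |∏ l, m z.1 (z.2 l)| * |F z.2|
          ≤ |2| * 1 * |∏ l, m z.1 (z.2 l)| * 1 := by gcongr
        _ = _ := by ring
  have hH : Integrable (fun z : (P → ℝ) × (Fin n → E) =>
      (1 - z.1 p ^ 2) * ((∏ l, m z.1 (z.2 l)) * ∑ l, s p z.1 (z.2 l)) * F z.2)
      ((prior P).prod L) := by
    refine Integrable.mono hH1 ?_ ?_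
    · have := h.prod_meas n
      have := h.sum_meas n p
      exact Measurable.aestronglyMeasurable (by fun_prop)
    · filter_upwards [hae] with z hz
      rw [norm_mul, norm_mul, Real.norm_eq_abs, Real.norm_eq_abs (F z.2)]
      have h1 := hF1 z.2
      have h2 : |1 - z.1 p ^ 2| ≤ 1 := by
        have := (sq_le_one_iff_abs_le_one (z.1 p)).2 hz
        rw [abs_le]; constructor <;> nlinarith [sq_nonneg (z.1 p)]
      calc _ ≤ 1 * ‖(∏ l, m z.1 (z.2 l)) * ∑ l, s p z.1 (z.2 l)‖ * 1 := by gcongr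
        _ = _ := by ring
  have e1 : ∀ t : P → ℝ, 2 * t p * ∫ x, F x ∂(Measure.pi (fun _ : Fin n => dens lam m t))
      = ∫ x, 2 * t p * (∏ l, m t (x l)) * F x ∂L := fun t => by
    rw [h.integral_pi_dens, ← integral_const_mul]
    simp only [mul_assoc]
    rfl
  have e2 : ∀ t : P → ℝ, (1 - t p ^ 2) * ∫ x, F x * ∑ l, s p t (x l)
          ∂(Measure.pi (fun _ : Fin n => dens lam m t))
      = ∫ x, (1 - t p ^ 2) * ((∏ l, m t (x l)) * ∑ l, s p t (x l)) * F x ∂L := fun t => by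
    rw [h.integral_pi_dens, ← integral_const_mul]
    refine integral_congr_ae (Filter.Eventually.of_forall fun x => ?_)
    simp only
    ring
  simp only [e1, e2]
  refine (integral_integral_swap hG).trans (Eq.trans ?_ (integral_integral_swap hH).symm)
  refine integral_congr_ae ?_
  filter_upwards [hG.prod_left_ae, hH.prod_left_ae] with x hx1 hx2
  rw [prior, integral_pi_update (fun _ : P => unif) p hx1,
    integral_pi_update (fun _ : P => unif) p hx2]
  refine integral_congr_ae (Filter.Eventually.of_forall fun t => ?_)
  simp only [Function.update_self]
  rw [integral_mul_const, integral_mul_const, h.by_parts p t x]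
  congr 1
  refine integral_congr_ae (Filter.Eventually.of_forall fun u => ?_)
  simp only
  ring

/-- The statistical (non-private) bound. -/
theorem stat_bound (h : IsFam lam m s V B1 B2) {n : ℕ} (p : P) (t : P → ℝ)
    {F : (Fin n → E) → ℝ} (hF : Measurable F) (hF1 : ∀ x, |F x| ≤ 1) :
    |∫ x, F x * ∑ l, s p t (x l) ∂(Measure.pi (fun _ : Fin n => dens lam m t))|
      ≤ Real.sqrt (n * V) := by
  have := h.prob t
  set μ := Measure.pi (fun _ : Fin n => dens lam m t)
  set S : (Fin n → E) → ℝ := fun x => ∑ l, s p t (x l)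
  have hS2 : MemLp S 2 μ := by
    refine memLp_finsetSum _ fun l _ => ?_
    exact (h.s_memLp p t).comp_measurePreserving (measurePreserving_eval _ l)
  have hSint : Integrable S μ := hS2.integrable (by norm_num)
  have hS0 : ∫ x, S x ∂μ = 0 := by
    rw [integral_finsetSum _ fun l _ => h.s_eval_int p t l]
    refine Finset.sum_eq_zero fun l _ => ?_
    rw [integral_comp_eval (μ := fun _ : Fin n => dens lam m t) (i := l)
          (f := fun y => s p t y) (h.s_meas' p t).aestronglyMeasurable, h.s_zero]
  have hvar : ∫ x, S x ^ 2 ∂μ ≤ n * V := by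
    have h1 := variance_sum_pi (μ := fun _ : Fin n => dens lam m t) (X := fun _ => s p t)
      (fun _ => h.s_memLp p t)
    have h2 : (∑ l : Fin n, fun x : Fin n → E => s p t (x l)) = S := by
      ext x; simp [S]
    rw [h2, variance_of_integral_eq_zero hSint.1.aemeasurable hS0] at h1
    rw [h1]
    calc _ ≤ ∑ l : Fin n, V := Finset.sum_le_sum fun l _ => by
          rw [variance_of_integral_eq_zero (h.s_meas' p t).aemeasurable (h.s_zero p t)]
          exact h.s_var p t
      _ = _ := by simp
  have habs : (∫ x, |S x| ∂μ) ^ 2 ≤ ∫ x, S x ^ 2 ∂μ := by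
    have h1 := variance_nonneg (fun x => |S x|) μ
    have h2 : MemLp (fun x => |S x|) 2 μ := hS2.abs
    rw [variance_eq_sub h2] at h1
    have h3 : ∫ x, ((fun x => |S x|) ^ 2) x ∂μ = ∫ x, S x ^ 2 ∂μ := by simp
    linarith
  have hle : |∫ x, F x * S x ∂μ| ≤ ∫ x, |S x| ∂μ := by
    refine (abs_integral_le_integral_abs).trans ?_
    refine integral_mono_of_nonneg (Filter.Eventually.of_forall fun x => abs_nonneg _) hSint.abs
      (Filter.Eventually.of_forall fun x => ?_)
    simp only [abs_mul]
    calc |F x| * |S x| ≤ 1 * |S x| := by gcongr; exact hF1 x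
      _ = |S x| := one_mul _
  refine hle.trans (Real.le_sqrt_of_sq_le (habs.trans hvar))

end IsFam

namespace IsFam

variable {E P : Type*} [MeasurableSpace E] [Fintype P] [DecidableEq P] {lam : Measure E}
  {m : (P → ℝ) → E → ℝ} {s : P → (P → ℝ) → E → ℝ} {V B1 B2 : ℝ}

/-- The privacy bound, one sample at a time. -/
theorem dp_bound_one (h : IsFam lam m s V B1 B2) {n : ℕ} (t : P → ℝ)
    {Ω : Type*} [MeasurableSpace Ω] (K : Kernel (Fin n → E) Ω) [IsMarkovKernel K]
    {ε δ : ℝ} (hε : 0 ≤ ε) (hδ : 0 ≤ δ) (hdp : IsDP K ε δ)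
    {φ : P → Ω → ℝ} (hφ : ∀ p, Measurable (φ p)) (hφ1 : ∀ p ω, |φ p ω| ≤ 1)
    (l : Fin n) :
    ∫ X, ∑ p, (∫ ω, φ p ω ∂(K X)) * s p t (X l) ∂(Measure.pi (fun _ : Fin n => dens lam m t))
      ≤ (Real.exp ε - Real.exp (-ε)) / 2 * B1 + 2 * δ * B2 := by
  have hprob := h.prob t
  set M := dens lam m t with hM
  have hφi : ∀ (ν : Measure Ω) [IsProbabilityMeasure ν] p, Integrable (φ p) ν := fun ν _ p =>
    Integrable.of_bound (hφ p).aestronglyMeasurable 1 (Filter.Eventually.of_forall (hφ1 p))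
  have hFm : ∀ p, StronglyMeasurable fun X => ∫ ω, φ p ω ∂(K X) := fun p =>
    (hφ p).stronglyMeasurable.integral_kernel
  have hF1 : ∀ p X, |∫ ω, φ p ω ∂(K X)| ≤ 1 := fun p X => by
    have := norm_integral_le_of_norm_le_const (μ := K X) (f := φ p) (C := 1)
      (Filter.Eventually.of_forall (hφ1 p))
    simpa using this
  have hintg : Integrable (fun X : Fin n → E => ∑ p, (∫ ω, φ p ω ∂(K X)) * s p t (X l))
      (Measure.pi (fun _ : Fin n => M)) := by
    refine integrable_finsetSum _ fun p _ => ?_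
    exact (h.s_eval_int p t l).bdd_mul (c := 1) (hFm p).aestronglyMeasurable
      (Filter.Eventually.of_forall (hF1 p))
  rw [integral_pi_update (fun _ : Fin n => M) l hintg]
  simp only [Function.update_self]
  -- bound for each fixed `X`
  have hX : ∀ X : Fin n → E,
      ∫ y, ∑ p, (∫ ω, φ p ω ∂(K (Function.update X l y))) * s p t y ∂M
        ≤ (Real.exp ε - Real.exp (-ε)) / 2 * B1 + 2 * δ * B2 := by
    intro X
    set g : E → Ω → ℝ := fun y ω => ∑ p, φ p ω * s p t y with hg
    set H : E → ℝ := fun y => ∑ p, |s p t y| with hH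
    have hgm : ∀ y, Measurable (g y) := fun y =>
      Finset.measurable_sum _ fun p _ => (hφ p).mul_const _
    have hgH : ∀ y ω, |g y ω| ≤ H y := fun y ω => by
      refine (Finset.abs_sum_le_sum_abs _ _).trans (Finset.sum_le_sum fun p _ => ?_)
      rw [abs_mul]
      calc |φ p ω| * |s p t y| ≤ 1 * |s p t y| := by gcongr; exact hφ1 p ω
        _ = _ := one_mul _
    have hHi : Integrable H M := integrable_finsetSum _ fun p _ => (h.s_int p t).abs
    have hgi : Integrable (Function.uncurry g) (M.prod (K X)) := by
      have e : Function.uncurry g = fun z : E × Ω => ∑ p, s p t z.1 * φ p z.2 := by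
        ext z; simp only [Function.uncurry, hg]
        exact Finset.sum_congr rfl fun p _ => mul_comm _ _
      rw [e]
      exact integrable_finsetSum _ fun p _ => (h.s_int p t).mul_prod (hφi (K X) p)
    have hswap : ∫ y, ∫ ω, g y ω ∂(K X) ∂M = 0 := by
      rw [integral_integral_swap hgi]
      have : ∀ ω, ∫ y, g y ω ∂M = 0 := fun ω => by
        simp only [hg]
        rw [integral_finsetSum _ fun p _ => (h.s_int p t).const_mul _]
        refine Finset.sum_eq_zero fun p _ => ?_
        rw [integral_const_mul, h.s_zero, mul_zero]
      simp [this]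
    have hswap2 : ∫ y, ∫ ω, |g y ω| ∂(K X) ∂M ≤ B1 := by
      rw [integral_integral_swap (f := fun y ω => |g y ω|) hgi.abs]
      calc _ ≤ ∫ ω, B1 ∂(K X) := by
            refine integral_mono_of_nonneg
              (Filter.Eventually.of_forall fun ω => integral_nonneg fun _ => abs_nonneg _)
              (integrable_const _) (Filter.Eventually.of_forall fun ω => ?_)
            exact h.s_l1 t (fun p => φ p ω) fun p => hφ1 p ω
        _ = B1 := by simp
    have hadj : ∀ y, Adjacent X (Function.update X l y) := fun y =>
      ⟨l, fun j hj => by rw [Function.update_of_ne hj]⟩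
    have hadj' : ∀ y, Adjacent (Function.update X l y) X := fun y =>
      ⟨l, fun j hj => by rw [Function.update_of_ne hj]⟩
    have hpt : ∀ y, ∑ p, (∫ ω, φ p ω ∂(K (Function.update X l y))) * s p t y
        ≤ (Real.exp ε + Real.exp (-ε)) / 2 * ∫ ω, g y ω ∂(K X)
          + (Real.exp ε - Real.exp (-ε)) / 2 * ∫ ω, |g y ω| ∂(K X) + 2 * δ * H y := by
      intro y
      have e : ∑ p, (∫ ω, φ p ω ∂(K (Function.update X l y))) * s p t y
          = ∫ ω, g y ω ∂(K (Function.update X l y)) := by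
        simp only [hg]
        rw [integral_finsetSum _ fun p _ => (hφi _ p).mul_const _]
        refine Finset.sum_congr rfl fun p _ => ?_
        rw [integral_mul_const]
      rw [e]
      exact dp_integral_signed (K X) (K (Function.update X l y)) hε hδ
        (hdp X _ (hadj y)) (hdp _ X (hadj' y)) (hgm y) (hgH y)
    have i1 : Integrable (fun y => ∫ ω, g y ω ∂(K X)) M := hgi.integral_prod_left
    have i2 : Integrable (fun y => ∫ ω, |g y ω| ∂(K X)) M := hgi.abs.integral_prod_left
    have hupd : Measurable fun y : E => Function.update X l y := by fun_prop
    calc _ ≤ ∫ y, ((Real.exp ε + Real.exp (-ε)) / 2 * ∫ ω, g y ω ∂(K X)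
          + (Real.exp ε - Real.exp (-ε)) / 2 * ∫ ω, |g y ω| ∂(K X) + 2 * δ * H y) ∂M := by
          refine integral_mono ?_ (((i1.const_mul _).add (i2.const_mul _)).add
            (hHi.const_mul _)) hpt
          refine integrable_finsetSum _ fun p _ => ?_
          exact (h.s_int p t).bdd_mul (c := 1)
            ((hFm p).comp_measurable hupd).aestronglyMeasurable
            (Filter.Eventually.of_forall fun y => hF1 p _)
      _ = (Real.exp ε - Real.exp (-ε)) / 2 * (∫ y, ∫ ω, |g y ω| ∂(K X) ∂M)
            + 2 * δ * ∫ y, H y ∂M := by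
          have i3 : Integrable (fun y => (Real.exp ε + Real.exp (-ε)) / 2 * ∫ ω, g y ω ∂(K X)
              + (Real.exp ε - Real.exp (-ε)) / 2 * ∫ ω, |g y ω| ∂(K X)) M :=
            (i1.const_mul _).add (i2.const_mul _)
          rw [integral_add i3 (hHi.const_mul _),
            integral_add (i1.const_mul _) (i2.const_mul _), integral_const_mul,
            integral_const_mul, integral_const_mul, hswap]
          ring
      _ ≤ _ := by
          have hb : 0 ≤ (Real.exp ε - Real.exp (-ε)) / 2 := by
            have : Real.exp (-ε) ≤ Real.exp ε := Real.exp_le_exp.2 (by linarith)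
            linarith
          have hHB : ∫ y, H y ∂M ≤ B2 := by
            rw [integral_finsetSum _ fun p _ => (h.s_int p t).abs]
            exact h.s_abs t
          gcongr
  calc _ ≤ ∫ X, ((Real.exp ε - Real.exp (-ε)) / 2 * B1 + 2 * δ * B2)
        ∂(Measure.pi (fun _ : Fin n => M)) := by
        have hi := (mp_update (fun _ : Fin n => M) l).integrable_comp_of_integrable hintg
        have hi2 := hi.integral_prod_left
        simp only [Function.comp_def, Function.update_self] at hi2
        exact integral_mono hi2 (integrable_const _) hX
    _ = _ := by simp

theorem dp_bound (h : IsFam lam m s V B1 B2) {n : ℕ} (t : P → ℝ)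
    {Ω : Type*} [MeasurableSpace Ω] (K : Kernel (Fin n → E) Ω) [IsMarkovKernel K]
    {ε δ : ℝ} (hε : 0 ≤ ε) (hδ : 0 ≤ δ) (hdp : IsDP K ε δ)
    {φ : P → Ω → ℝ} (hφ : ∀ p, Measurable (φ p)) (hφ1 : ∀ p ω, |φ p ω| ≤ 1)
    (w : P → ℝ) (hw : ∀ p, |w p| ≤ 1) :
    ∑ p, w p * ∫ X, (∫ ω, φ p ω ∂(K X)) * ∑ l, s p t (X l)
        ∂(Measure.pi (fun _ : Fin n => dens lam m t))
      ≤ n * ((Real.exp ε - Real.exp (-ε)) / 2 * B1 + 2 * δ * B2) := by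
  have hprob := h.prob t
  have hφm : ∀ p, Measurable fun ω => w p * φ p ω := fun p => (hφ p).const_mul _
  have hφ1' : ∀ p ω, |w p * φ p ω| ≤ 1 := fun p ω => by
    rw [abs_mul]
    exact mul_le_one₀ (hw p) (abs_nonneg _) (hφ1 p ω)
  have hFm : ∀ p, StronglyMeasurable fun X => ∫ ω, w p * φ p ω ∂(K X) := fun p =>
    (hφm p).stronglyMeasurable.integral_kernel
  have hF1 : ∀ p X, |∫ ω, w p * φ p ω ∂(K X)| ≤ 1 := fun p X => by
    have := norm_integral_le_of_norm_le_const (μ := K X) (f := fun ω => w p * φ p ω) (C := 1)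
      (Filter.Eventually.of_forall (hφ1' p))
    simpa using this
  have hintg : ∀ p (l : Fin n), Integrable (fun X : Fin n → E =>
      (∫ ω, w p * φ p ω ∂(K X)) * s p t (X l)) (Measure.pi (fun _ : Fin n => dens lam m t)) :=
    fun p l => (h.s_eval_int p t l).bdd_mul (c := 1) (hFm p).aestronglyMeasurable
      (Filter.Eventually.of_forall (hF1 p))
  have e : ∑ p, w p * ∫ X, (∫ ω, φ p ω ∂(K X)) * ∑ l, s p t (X l)
        ∂(Measure.pi (fun _ : Fin n => dens lam m t))
      = ∑ l : Fin n, ∫ X, ∑ p, (∫ ω, w p * φ p ω ∂(K X)) * s p t (X l)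
        ∂(Measure.pi (fun _ : Fin n => dens lam m t)) := by
    have e1 : ∀ p, w p * ∫ X, (∫ ω, φ p ω ∂(K X)) * ∑ l, s p t (X l)
        ∂(Measure.pi (fun _ : Fin n => dens lam m t))
        = ∑ l : Fin n, ∫ X, (∫ ω, w p * φ p ω ∂(K X)) * s p t (X l)
        ∂(Measure.pi (fun _ : Fin n => dens lam m t)) := fun p => by
      rw [← integral_finsetSum _ fun l _ => hintg p l, ← integral_const_mul]
      refine integral_congr_ae (Filter.Eventually.of_forall fun X => ?_)
      simp only
      rw [integral_const_mul, ← Finset.mul_sum, mul_assoc]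
    simp only [e1]
    rw [Finset.sum_comm]
    refine Finset.sum_congr rfl fun l _ => ?_
    rw [integral_finsetSum _ fun p _ => hintg p l]
  rw [e]
  calc _ ≤ ∑ l : Fin n, ((Real.exp ε - Real.exp (-ε)) / 2 * B1 + 2 * δ * B2) :=
        Finset.sum_le_sum fun l _ => h.dp_bound_one t K hε hδ hdp hφm hφ1' l
    _ = _ := by simp; ring


theorem meas_outer [SigmaFinite lam] (h : IsFam lam m s V B1 B2) {n : ℕ}
    {G : (P → ℝ) → (Fin n → E) → ℝ} (hG : Measurable (fun z : (P → ℝ) × (Fin n → E) => G z.1 z.2)) :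
    StronglyMeasurable fun t => ∫ x, G t x ∂(Measure.pi (fun _ : Fin n => dens lam m t)) := by
  simp only [h.integral_pi_dens n]
  exact StronglyMeasurable.integral_prod_right
    (f := fun t (x : Fin n → E) => (∏ l, m t (x l)) * G t x)
    ((h.prod_meas n).mul hG).stronglyMeasurable

theorem conclusion [SigmaFinite lam] (h : IsFam lam m s V B1 B2) {n : ℕ}
    {Ω : Type*} [MeasurableSpace Ω] (K : Kernel (Fin n → E) Ω) [IsMarkovKernel K]
    {ε δ : ℝ} (hε : 0 ≤ ε) (hδ : 0 ≤ δ) (hdp : IsDP K ε δ)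
    {φ : P → Ω → ℝ} (hφ : ∀ p, Measurable (φ p)) (hφ1 : ∀ p ω, |φ p ω| ≤ 1) (L : ℝ)
    (hL : ∀ t : P → ℝ, (∀ p, |t p| ≤ 1) → 2 * ((2 / 3) * (∑ p, t p ^ 2 - L) - (1 / 3) * ∑ p, |t p|)
      ≤ ∑ p, 2 * t p * ∫ X, (∫ ω, φ p ω ∂(K X)) ∂(Measure.pi (fun _ : Fin n => dens lam m t))) :
    (Fintype.card P : ℝ) / 9 - 4 / 3 * L ≤ Fintype.card P * Real.sqrt (n * V) ∧
    (Fintype.card P : ℝ) / 9 - 4 / 3 * L ≤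
      n * ((Real.exp ε - Real.exp (-ε)) / 2 * B1 + 2 * δ * B2) := by
  have hprob := h.prob
  have hFm : ∀ p, Measurable fun X => ∫ ω, φ p ω ∂(K X) := fun p =>
    (hφ p).stronglyMeasurable.integral_kernel.measurable
  have hF1 : ∀ p X, |∫ ω, φ p ω ∂(K X)| ≤ 1 := fun p X => by
    have := norm_integral_le_of_norm_le_const (μ := K X) (f := φ p) (C := 1)
      (Filter.Eventually.of_forall (hφ1 p))
    simpa using this
  have hEF1 : ∀ p t, |∫ X, (∫ ω, φ p ω ∂(K X))
      ∂(Measure.pi (fun _ : Fin n => dens lam m t))| ≤ 1 := fun p t => by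
    have := norm_integral_le_of_norm_le_const (μ := Measure.pi (fun _ : Fin n => dens lam m t))
      (f := fun X => ∫ ω, φ p ω ∂(K X)) (C := 1)
      (Filter.Eventually.of_forall (hF1 p))
    simpa using this
  have iL : ∀ p, Integrable (fun t : P → ℝ => 2 * t p * ∫ X, (∫ ω, φ p ω ∂(K X))
      ∂(Measure.pi (fun _ : Fin n => dens lam m t))) (prior P) := fun p => by
    have hm := h.meas_outer (n := n) (G := fun _ X => ∫ ω, φ p ω ∂(K X))
      ((hFm p).comp measurable_snd)
    refine Integrable.of_bound (C := 2) (((measurable_pi_apply p).const_mul 2).mul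
      hm.measurable).aestronglyMeasurable ?_
    filter_upwards [prior_ae P] with t ht
    rw [Real.norm_eq_abs, abs_mul, abs_mul, abs_two]
    have := hEF1 p t
    have h2 := ht p
    nlinarith [abs_nonneg (t p), abs_nonneg (∫ X, (∫ ω, φ p ω ∂(K X))
      ∂(Measure.pi (fun _ : Fin n => dens lam m t)))]
  have bR : ∀ p, ∀ t : P → ℝ, (∀ p, |t p| ≤ 1) →
      |(1 - t p ^ 2) * ∫ X, (∫ ω, φ p ω ∂(K X)) * ∑ l, s p t (X l)
      ∂(Measure.pi (fun _ : Fin n => dens lam m t))| ≤ Real.sqrt (n * V) := fun p t ht => by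
    rw [abs_mul]
    have h1 : |1 - t p ^ 2| ≤ 1 := by
      have := (sq_le_one_iff_abs_le_one _).2 (ht p)
      rw [abs_le]; constructor <;> nlinarith [sq_nonneg (t p)]
    have h2 := h.stat_bound p t (hFm p) (hF1 p)
    calc _ ≤ 1 * Real.sqrt (n * V) := mul_le_mul h1 h2 (abs_nonneg _) (by norm_num)
      _ = _ := one_mul _
  have iR : ∀ p, Integrable (fun t : P → ℝ => (1 - t p ^ 2) *
      ∫ X, (∫ ω, φ p ω ∂(K X)) * ∑ l, s p t (X l)
      ∂(Measure.pi (fun _ : Fin n => dens lam m t))) (prior P) := fun p => by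
    have hm := h.meas_outer (n := n) (G := fun t X => (∫ ω, φ p ω ∂(K X)) * ∑ l, s p t (X l))
      (((hFm p).comp measurable_snd).mul (h.sum_meas n p))
    refine Integrable.of_bound (C := Real.sqrt (n * V))
      (Measurable.aestronglyMeasurable (Measurable.mul (by fun_prop) hm.measurable)) ?_
    filter_upwards [prior_ae P] with t ht
    exact bR p t ht
  have it : ∀ (g : ℝ → ℝ), Continuous g → ∀ p, Integrable (fun t : P → ℝ => g (t p)) (prior P) ∧
      ∫ t : P → ℝ, g (t p) ∂(prior P) = ∫ u, g u ∂unif := fun g hg p => by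
    have gi : Integrable g unif := by
      have := hg.continuousOn.integrableOn_Icc (μ := volume) (a := -1) (b := 1)
      exact Integrable.smul_measure this (by norm_num)
    exact ⟨integrable_comp_eval (μ := fun _ : P => unif) gi,
      integral_comp_eval (μ := fun _ : P => unif) hg.aestronglyMeasurable⟩
  have e2 : ∫ u, u ^ 2 ∂unif = 1 / 3 := by
    rw [integral_unif]; norm_num
  have e1 : ∫ u, |u| ∂unif = 1 / 2 := by
    rw [integral_unif, ← intervalIntegral.integral_add_adjacent_intervals (b := 0)
      (continuous_abs.intervalIntegrable _ _) (continuous_abs.intervalIntegrable _ _)]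
    have h1 : ∫ u in (-1:ℝ)..0, |u| = ∫ u in (-1:ℝ)..0, -u :=
      intervalIntegral.integral_congr fun u hu => by
        rw [Set.uIcc_of_le (by norm_num)] at hu
        exact abs_of_nonpos hu.2
    have h2 : ∫ u in (0:ℝ)..1, |u| = ∫ u in (0:ℝ)..1, u :=
      intervalIntegral.integral_congr fun u hu => by
        rw [Set.uIcc_of_le (by norm_num)] at hu
        exact abs_of_nonneg hu.1
    rw [h1, h2, intervalIntegral.integral_neg]
    norm_num
  have key : (Fintype.card P : ℝ) / 9 - 4 / 3 * L ≤ ∑ p, ∫ t : P → ℝ, (1 - t p ^ 2) *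
      ∫ X, (∫ ω, φ p ω ∂(K X)) * ∑ l, s p t (X l)
      ∂(Measure.pi (fun _ : Fin n => dens lam m t)) ∂(prior P) := by
    have i1 : Integrable (fun t : P → ℝ => ∑ p, t p ^ 2) (prior P) :=
      integrable_finsetSum _ fun p _ => (it (fun u => u ^ 2) (by fun_prop) p).1
    have i2 : Integrable (fun t : P → ℝ => ∑ p, |t p|) (prior P) :=
      integrable_finsetSum _ fun p _ => (it (fun u => |u|) (by fun_prop) p).1
    have i3 : Integrable (fun t : P → ℝ => (2 / 3) * (∑ p, t p ^ 2 - L)) (prior P) :=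
      (i1.sub (integrable_const _)).const_mul _
    have i4 : Integrable (fun t : P → ℝ => 2 * ((2 / 3) * (∑ p, t p ^ 2 - L)
        - (1 / 3) * ∑ p, |t p|)) (prior P) :=
      (i3.sub (i2.const_mul _)).const_mul _
    calc _ = ∫ t : P → ℝ, 2 * ((2 / 3) * (∑ p, t p ^ 2 - L) - (1 / 3) * ∑ p, |t p|)
          ∂(prior P) := by
          rw [integral_const_mul, integral_sub i3 (i2.const_mul _), integral_const_mul,
            integral_const_mul, integral_sub i1 (integrable_const _),
            integral_finsetSum _ fun p _ => (it (fun u => u ^ 2) (by fun_prop) p).1,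
            integral_finsetSum _ fun p _ => (it (fun u => |u|) (by fun_prop) p).1]
          have a1 : ∀ p : P, ∫ t : P → ℝ, t p ^ 2 ∂(prior P) = 1 / 3 := fun p => by
            rw [(it (fun u => u ^ 2) (by fun_prop) p).2, e2]
          have a2 : ∀ p : P, ∫ t : P → ℝ, |t p| ∂(prior P) = 1 / 2 := fun p => by
            rw [(it (fun u => |u|) (by fun_prop) p).2, e1]
          simp only [a1, a2]
          simp
          ring
      _ ≤ ∫ t : P → ℝ, ∑ p, 2 * t p * ∫ X, (∫ ω, φ p ω ∂(K X))
            ∂(Measure.pi (fun _ : Fin n => dens lam m t)) ∂(prior P) := by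
          refine integral_mono_ae i4 (integrable_finsetSum _ fun p _ => iL p) ?_
          filter_upwards [prior_ae P] with t ht
          exact hL t ht
      _ = _ := by
          rw [integral_finsetSum _ fun p _ => iL p]
          exact Finset.sum_congr rfl fun p _ => h.main_identity p (hFm p) (hF1 p)
  constructor
  · refine key.trans ?_
    calc _ ≤ ∑ p : P, Real.sqrt (n * V) := by
          refine Finset.sum_le_sum fun p _ => ?_
          have := norm_integral_le_of_norm_le_const (μ := prior P) (C := Real.sqrt (n * V))
            (f := fun t : P → ℝ => (1 - t p ^ 2) *
              ∫ X, (∫ ω, φ p ω ∂(K X)) * ∑ l, s p t (X l)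
              ∂(Measure.pi (fun _ : Fin n => dens lam m t))) (by
                filter_upwards [prior_ae P] with t ht
                exact bR p t ht)
          simp only [Real.norm_eq_abs, probReal_univ, mul_one] at this
          exact (le_abs_self _).trans this
      _ = _ := by simp
  · refine key.trans ?_
    rw [← integral_finsetSum _ fun p _ => iR p]
    calc _ ≤ ∫ t : P → ℝ, n * ((Real.exp ε - Real.exp (-ε)) / 2 * B1 + 2 * δ * B2)
          ∂(prior P) := by
          refine integral_mono_ae (integrable_finsetSum _ fun p _ => iR p)
            (integrable_const _) ?_
          filter_upwards [prior_ae P] with t ht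
          refine h.dp_bound t K hε hδ hdp hφ hφ1 (fun p => 1 - t p ^ 2) fun p => ?_
          have := (sq_le_one_iff_abs_le_one _).2 (ht p)
          rw [abs_le]; constructor <;> nlinarith [sq_nonneg (t p)]
      _ = _ := by simp

end IsFam

/-! ### Measurable selection of a nearby parameter -/

theorem TV_dens_le {E P : Type*} [MeasurableSpace E] {lam : Measure E} {m : (P → ℝ) → E → ℝ}
    (hpos : ∀ t x, 0 < m t x) (hintg : ∀ t, Integrable (m t) lam)
    (hone : ∀ t, ∫ x, m t x ∂lam = 1) (t t' : P → ℝ) :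
    TV (dens lam m t) (dens lam m t') ≤ ∫ x, max (m t x - m t' x) 0 ∂lam := by
  have hr : ∀ t (A : Set E), MeasurableSet A →
      (dens lam m t A).toReal = ∫ x in A, m t x ∂lam := fun t A hA => by
    rw [dens, withDensity_apply _ hA, integral_eq_lintegral_of_nonneg_ae
      (Filter.Eventually.of_forall fun x => (hpos t x).le) (hintg t).1.restrict]
  have hi : Integrable (fun x => max (m t x - m t' x) 0) lam :=
    ((hintg t).sub (hintg t')).pos_part
  have one : ∀ A : Set E, MeasurableSet A →
      (dens lam m t A).toReal - (dens lam m t' A).toReal ≤ ∫ x, max (m t x - m t' x) 0 ∂lam := by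
    intro A hA
    rw [hr t A hA, hr t' A hA, ← integral_sub (hintg t).integrableOn (hintg t').integrableOn]
    calc _ ≤ ∫ x in A, max (m t x - m t' x) 0 ∂lam :=
          integral_mono ((hintg t).sub (hintg t')).integrableOn hi.integrableOn
            fun x => le_max_left _ _
      _ ≤ _ := setIntegral_le_integral hi
            (Filter.Eventually.of_forall fun x => le_max_right _ _)
  refine TV_le _ _ fun A hA => abs_sub_le_iff.2 ⟨one A hA, ?_⟩
  have h2 := one Aᶜ hA.compl
  rw [hr t _ hA.compl, hr t' _ hA.compl, setIntegral_compl hA (hintg t),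
    setIntegral_compl hA (hintg t'), hone, hone] at h2
  rw [hr t _ hA, hr t' _ hA]
  linarith

theorem exists_net {E P : Type*} [MeasurableSpace E] [Fintype P] {lam : Measure E}
    {m : (P → ℝ) → E → ℝ}
    (hpos : ∀ t x, 0 < m t x) (hintg : ∀ t, Integrable (m t) lam)
    (hone : ∀ t, ∫ x, m t x ∂lam = 1) (hcont : ∀ x, Continuous fun t => m t x)
    {α : ℝ} (hα : 0 < α) :
    ∃ T : ℕ → P → ℝ, (∀ j p, |T j p| ≤ 1) ∧
      ∀ t : P → ℝ, (∀ p, |t p| ≤ 1) → ∃ j, TV (dens lam m t) (dens lam m (T j)) ≤ α := by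
  set Bx := {t : P → ℝ // ∀ p, |t p| ≤ 1}
  have : Nonempty Bx := ⟨⟨fun _ => 0, by simp⟩⟩
  refine ⟨fun j => (TopologicalSpace.denseSeq Bx j).1,
    fun j => (TopologicalSpace.denseSeq Bx j).2, fun t ht => ?_⟩
  have hd := TopologicalSpace.denseRange_denseSeq Bx
  have hmem : (⟨t, ht⟩ : Bx) ∈ closure (Set.range (TopologicalSpace.denseSeq Bx)) := hd _
  obtain ⟨u, hu, hlim⟩ := mem_closure_iff_seq_limit.1 hmem
  have hlim' : Filter.Tendsto (fun n => (u n).1) Filter.atTop (nhds t) :=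
    (continuous_subtype_val.tendsto _).comp hlim
  have hT : Filter.Tendsto (fun n => ∫ x, max (m t x - m (u n).1 x) 0 ∂lam) Filter.atTop
      (nhds (∫ x, (0:ℝ) ∂lam)) := by
    refine tendsto_integral_of_dominated_convergence (m t) (fun n => ?_) (hintg t) (fun n => ?_) ?_
    · exact (((hintg t).sub (hintg _)).pos_part).1
    · refine Filter.Eventually.of_forall fun x => ?_
      rw [Real.norm_eq_abs, abs_of_nonneg (le_max_right _ _)]
      exact max_le (by linarith [hpos (u n).1 x]) (hpos t x).le
    · refine Filter.Eventually.of_forall fun x => ?_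
      have h1 : Filter.Tendsto (fun n => m (u n).1 x) Filter.atTop (nhds (m t x)) :=
        ((hcont x).tendsto t).comp hlim'
      have h2 := (h1.const_sub (m t x)).max (tendsto_const_nhds (x := (0:ℝ)))
      simpa using h2
  rw [integral_zero] at hT
  obtain ⟨n, hn⟩ := (hT.eventually (ge_mem_nhds hα)).exists
  obtain ⟨j, hj⟩ := hu n
  refine ⟨j, ?_⟩
  simp only [hj]
  exact (TV_dens_le hpos hintg hone _ _).trans hn

theorem exists_selection {E P : Type*} [MeasurableSpace E] [Fintype P]
    (D : (P → ℝ) → Measure E) (hD : ∀ t, IsProbabilityMeasure (D t))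
    {α : ℝ} (T : ℕ → P → ℝ) (hT : ∀ j p, |T j p| ≤ 1)
    (hTn : ∀ t : P → ℝ, (∀ p, |t p| ≤ 1) → ∃ j, TV (D t) (D (T j)) ≤ α) :
    ∃ φ : P → Measure E → ℝ, (∀ p, Measurable (φ p)) ∧ (∀ p Q, |φ p Q| ≤ 1) ∧
      ∀ t : P → ℝ, (∀ p, |t p| ≤ 1) → ∀ Q : Measure E, IsProbabilityMeasure Q →
        TV Q (D t) ≤ α → TV (D t) (D fun p => φ p Q) ≤ 9 * α := by
  classical
  choose A hAm hA using fun i j => exists_TV_half (D (T i)) (D (T j))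
  set good : ℕ → Measure E → Prop := fun g Q =>
    ∀ i j, |(Q (A i j)).toReal - (D (T g) (A i j)).toReal| ≤ 2 * α with hgood
  have hgm : ∀ g, MeasurableSet {Q | good g Q} := fun g => by
    simp only [hgood, Set.ofPred_forall]
    refine MeasurableSet.iInter fun i => MeasurableSet.iInter fun j => ?_
    refine measurableSet_le ?_ measurable_const
    have : Measurable fun Q : Measure E => (Q (A i j)).toReal :=
      (Measure.measurable_coe (hAm i j)).ennreal_toReal
    exact _root_.continuous_abs.measurable.comp (this.sub_const _)
  have hem : MeasurableSet {Q | ∃ g, good g Q} := by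
    simp only [Set.ofPred_exists]
    exact MeasurableSet.iUnion hgm
  set p' : ℕ → Measure E → Prop := fun g Q => good g Q ∨ ¬ ∃ g, good g Q with hp'
  have hp'm : ∀ g, MeasurableSet {Q | p' g Q} := fun g => (hgm g).union hem.compl
  have hex : ∀ Q, ∃ g, p' g Q := fun Q => by
    by_cases h : ∃ g, good g Q
    · exact ⟨h.choose, Or.inl h.choose_spec⟩
    · exact ⟨0, Or.inr h⟩
  refine ⟨fun p Q => T (Nat.find (hex Q)) p, fun p => ?_, fun p Q => hT _ _, ?_⟩
  · exact Measurable.find (f := fun g _ => T g p) (p := p') (fun g => measurable_const) hp'm hex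
  · intro t ht Q hQ hTV
    obtain ⟨j, hj⟩ := hTn t ht
    have hpt : ∀ B : Set E, MeasurableSet B →
        |(Q B).toReal - (D (T j) B).toReal| ≤ 2 * α := fun B hB => by
      have h1 := (le_TV Q (D t) hB).trans hTV
      have h2 := (le_TV (D t) (D (T j)) hB).trans hj
      have := abs_sub_le (Q B).toReal (D t B).toReal (D (T j) B).toReal
      linarith
    have hgj : ∃ g, good g Q := ⟨j, fun i i' => hpt _ (hAm i i')⟩
    have hfind : good (Nat.find (hex Q)) Q := by
      rcases Nat.find_spec (hex Q) with h | h
      · exact h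
      · exact absurd hgj h
    set g := Nat.find (hex Q) with hg
    have h1 := hA g j
    have h2 := hfind g j
    have h3 := hpt _ (hAm g j)
    have h4 : |(D (T g) (A g j)).toReal - (D (T j) (A g j)).toReal| ≤ 4 * α := by
      have := abs_sub_le (D (T g) (A g j)).toReal (Q (A g j)).toReal (D (T j) (A g j)).toReal
      rw [abs_sub_comm] at h2
      linarith
    refine TV_le _ _ fun B hB => ?_
    change |(D t B).toReal - (D (T g) B).toReal| ≤ 9 * α
    have h5 := (le_TV (D t) (D (T j)) hB).trans hj
    have h6 := le_TV (D (T g)) (D (T j)) hB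
    rw [abs_sub_comm] at h6
    have := abs_sub_le (D t B).toReal (D (T j) B).toReal (D (T g) B).toReal
    linarith

theorem success_bound {X Ω P : Type*} [MeasurableSpace X] [MeasurableSpace Ω] [Fintype P]
    (ν : Measure X) [IsProbabilityMeasure ν] (K : Kernel X Ω) [IsMarkovKernel K]
    {φ : P → Ω → ℝ} (hφ : ∀ p, Measurable (φ p)) (hφ1 : ∀ p ω, |φ p ω| ≤ 1) (t : P → ℝ) (L : ℝ)
    (S : Set Ω) (hS : (2 / 3 : ℝ≥0∞) ≤ (ν.bind fun x => K x) S)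
    (hSt : ∀ ω ∈ S, ∑ p, t p ^ 2 - L ≤ ∑ p, t p * φ p ω) :
    2 * ((2 / 3) * (∑ p, t p ^ 2 - L) - (1 / 3) * ∑ p, |t p|)
      ≤ ∑ p, 2 * t p * ∫ x, (∫ ω, φ p ω ∂(K x)) ∂ν := by
  set a := ∑ p, t p ^ 2 - L with ha
  set b := ∑ p, |t p| with hb
  set f : Ω → ℝ := fun ω => ∑ p, t p * φ p ω with hf
  have hfm : Measurable f := Finset.measurable_sum _ fun p _ => (hφ p).const_mul _
  have hfb : ∀ ω, |f ω| ≤ b := fun ω => by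
    refine (Finset.abs_sum_le_sum_abs _ _).trans (Finset.sum_le_sum fun p _ => ?_)
    rw [abs_mul]
    exact mul_le_of_le_one_right (abs_nonneg _) (hφ1 p ω)
  have hφi : ∀ x p, Integrable (φ p) (K x) := fun x p =>
    Integrable.of_bound (hφ p).aestronglyMeasurable 1 (Filter.Eventually.of_forall (hφ1 p))
  have hfi : ∀ x, Integrable f (K x) := fun x =>
    Integrable.of_bound hfm.aestronglyMeasurable b (Filter.Eventually.of_forall hfb)
  have hFm : ∀ p, Measurable fun X => ∫ ω, φ p ω ∂(K X) := fun p =>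
    (hφ p).stronglyMeasurable.integral_kernel.measurable
  have hF1 : ∀ p X, |∫ ω, φ p ω ∂(K X)| ≤ 1 := fun p X => by
    have := norm_integral_le_of_norm_le_const (μ := K X) (f := φ p) (C := 1)
      (Filter.Eventually.of_forall (hφ1 p))
    simpa using this
  have hFi : ∀ p, Integrable (fun x => ∫ ω, φ p ω ∂(K x)) ν := fun p =>
    Integrable.of_bound (hFm p).aestronglyMeasurable 1 (Filter.Eventually.of_forall (hF1 p))
  have e1 : ∀ x, ∫ ω, f ω ∂(K x) = ∑ p, t p * ∫ ω, φ p ω ∂(K x) := fun x => by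
    simp only [hf]
    rw [integral_finsetSum _ fun p _ => (hφi x p).const_mul _]
    simp only [integral_const_mul]
  have hI : Integrable (fun x => ∫ ω, f ω ∂(K x)) ν := by
    simp only [e1]
    exact integrable_finsetSum _ fun p _ => (hFi p).const_mul _
  have e2 : ∑ p, 2 * t p * ∫ x, (∫ ω, φ p ω ∂(K x)) ∂ν = 2 * ∫ x, ∫ ω, f ω ∂(K x) ∂ν := by
    simp only [e1]
    rw [integral_finsetSum _ fun p _ => (hFi p).const_mul _, Finset.mul_sum]
    refine Finset.sum_congr rfl fun p _ => ?_
    rw [integral_const_mul]; ring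
  rw [e2]
  refine mul_le_mul_of_nonneg_left ?_ (by norm_num)
  rcases lt_or_ge (a + b) 0 with hab | hab
  · have : -b ≤ ∫ x, ∫ ω, f ω ∂(K x) ∂ν := by
      have h1 : ∀ x, -b ≤ ∫ ω, f ω ∂(K x) := fun x => by
        calc -b = ∫ ω, -b ∂(K x) := by simp
          _ ≤ _ := integral_mono (integrable_const _) (hfi x)
                fun ω => (abs_le.1 (hfb ω)).1
      calc -b = ∫ x, -b ∂ν := by simp
          _ ≤ _ := integral_mono (integrable_const _) hI h1
    linarith
  · set G : Set Ω := {ω | a ≤ f ω} with hG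
    have hGm : MeasurableSet G := measurableSet_le measurable_const hfm
    have hSG : S ⊆ G := fun ω hω => hSt ω hω
    have hKm : Measurable fun x => K x := K.measurable
    have hG23 : (2 / 3 : ℝ) ≤ ∫ x, (K x).real G ∂ν := by
      have h1 : (2 / 3 : ℝ≥0∞) ≤ ∫⁻ x, K x G ∂ν := by
        rw [← Measure.bind_apply hGm hKm.aemeasurable]
        exact hS.trans (measure_mono hSG)
      have hle : ∫⁻ x, K x G ∂ν ≤ 1 := by
        calc _ ≤ ∫⁻ x, 1 ∂ν := lintegral_mono fun x => prob_le_one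
          _ = 1 := by simp
      have h2 : ∫ x, (K x).real G ∂ν = (∫⁻ x, K x G ∂ν).toReal := by
        simp only [Measure.real]
        exact integral_toReal (K.measurable_coe hGm).aemeasurable
          (Filter.Eventually.of_forall fun x => measure_lt_top _ _)
      rw [h2]
      have := ENNReal.toReal_mono (ne_top_of_le_ne_top ENNReal.one_ne_top hle) h1
      simpa using this
    have hKG : Integrable (fun x => (K x).real G) ν :=
      Integrable.of_bound (K.measurable_coe hGm).ennreal_toReal.aestronglyMeasurable 1
        (Filter.Eventually.of_forall fun x => by
          rw [Real.norm_eq_abs, abs_of_nonneg measureReal_nonneg]; exact measureReal_le_one)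
    have h1 : ∀ x, -b + (a + b) * (K x).real G ≤ ∫ ω, f ω ∂(K x) := fun x => by
      have hind : Integrable (G.indicator fun _ => (1:ℝ)) (K x) :=
        (integrable_const _).indicator hGm
      calc _ = ∫ ω, (-b + (a + b) * G.indicator (fun _ => (1:ℝ)) ω) ∂(K x) := by
            rw [integral_add (integrable_const _) (hind.const_mul _), integral_const_mul,
              integral_indicator_const _ hGm]
            simp
        _ ≤ _ := by
            refine integral_mono ((integrable_const _).add (hind.const_mul _)) (hfi x)
              fun ω => ?_
            by_cases hω : ω ∈ G
            · simp only [Set.indicator_of_mem hω]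
              have : a ≤ f ω := hω
              linarith
            · simp only [Set.indicator_of_notMem hω]
              linarith [(abs_le.1 (hfb ω)).1]
    have h2 : -b + (a + b) * ∫ x, (K x).real G ∂ν ≤ ∫ x, ∫ ω, f ω ∂(K x) ∂ν := by
      calc _ = ∫ x, (-b + (a + b) * (K x).real G) ∂ν := by
            rw [integral_add (integrable_const _) (hKG.const_mul _), integral_const_mul]
            simp
        _ ≤ _ := integral_mono ((integrable_const _).add (hKG.const_mul _)) hI h1
    nlinarith

/-- The abstract lower bound. -/
theorem IsFam.lower {E P : Type*} [MeasurableSpace E] [Fintype P] [DecidableEq P] {lam : Measure E}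
    {m : (P → ℝ) → E → ℝ} {s : P → (P → ℝ) → E → ℝ} {V B1 B2 : ℝ} [SigmaFinite lam]
    (h : IsFam lam m s V B1 B2) (hcont : ∀ x, Continuous fun t => m t x) {n : ℕ}
    (K : Kernel (Fin n → E) (Measure E)) [IsMarkovKernel K]
    {α ε δ : ℝ} (hα : 0 < α) (hε : 0 ≤ ε) (hδ : 0 ≤ δ) (hdp : IsDP K ε δ) (L : ℝ)
    (hpar : ∀ t t' : P → ℝ, (∀ p, |t p| ≤ 1) → (∀ p, |t' p| ≤ 1) →
      TV (dens lam m t) (dens lam m t') ≤ 9 * α → ∑ p, t p ^ 2 - L ≤ ∑ p, t p * t' p)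
    (hS : ∀ t : P → ℝ, (∀ p, |t p| ≤ 1) → (2 / 3 : ℝ≥0∞) ≤
            ((Measure.pi fun _ : Fin n => dens lam m t).bind fun x => K x)
              {Q : Measure E | IsProbabilityMeasure Q ∧ TV Q (dens lam m t) ≤ α}) :
    (Fintype.card P : ℝ) / 9 - 4 / 3 * L ≤ Fintype.card P * Real.sqrt (n * V) ∧
    (Fintype.card P : ℝ) / 9 - 4 / 3 * L ≤
      n * ((Real.exp ε - Real.exp (-ε)) / 2 * B1 + 2 * δ * B2) := by
  have hprob := h.prob
  obtain ⟨T, hT1, hT2⟩ := exists_net h.m_pos h.m_int h.m_one hcont hα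
  obtain ⟨φ, hφ, hφ1, hφ2⟩ := exists_selection (dens lam m) hprob T hT1 hT2
  refine h.conclusion K hε hδ hdp hφ hφ1 L fun t ht => ?_
  refine success_bound _ K hφ hφ1 t L _ (hS t ht) fun Q hQ => ?_
  exact hpar t _ ht (fun p => hφ1 p Q) (hφ2 t ht Q hQ.1 hQ.2)

/-! ### Standard Gaussian computations -/

theorem iadd {X : Type*} [MeasurableSpace X] {μ : Measure X} {f g : X → ℝ} (hf : Integrable f μ)
    (hg : Integrable g μ) : Integrable (fun x => f x + g x) μ := hf.add hg

/-- Standard Gaussian measure. -/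
def gam (d : ℕ) : Measure (Fin d → ℝ) := Measure.pi fun _ : Fin d => gaussianReal 0 1

instance gam_prob (d : ℕ) : IsProbabilityMeasure (gam d) := by unfold gam; infer_instance

/-- Functions with all moments. -/
def Nice {d : ℕ} (f : (Fin d → ℝ) → ℝ) : Prop := ∀ p : ℝ≥0∞, p ≠ ∞ → MemLp f p (gam d)

namespace Nice
variable {d : ℕ} {f g : (Fin d → ℝ) → ℝ}

theorem int (hf : Nice f) : Integrable f (gam d) := memLp_one_iff_integrable.1 (hf 1 (by simp))

theorem add (hf : Nice f) (hg : Nice g) : Nice (fun x => f x + g x) := fun p hp =>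
  (hf p hp).add (hg p hp)

theorem sub (hf : Nice f) (hg : Nice g) : Nice (fun x => f x - g x) := fun p hp =>
  (hf p hp).sub (hg p hp)

theorem mul (hf : Nice f) (hg : Nice g) : Nice (fun x => f x * g x) := fun p hp => by
  have hh : ENNReal.HolderTriple (2 * p) (2 * p) p := by
    constructor
    rcases eq_or_ne p 0 with rfl | h0
    · simp
    · rw [ENNReal.mul_inv (by simp) (by simp), ← two_mul, ← mul_assoc,
        ENNReal.mul_inv_cancel (by simp) (by simp), one_mul]
  have h2 : (2 : ℝ≥0∞) * p ≠ ∞ := ENNReal.mul_ne_top (by simp) hp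
  exact MemLp.mul (p := 2 * p) (q := 2 * p) (hg _ h2) (hf _ h2)

theorem const (c : ℝ) : Nice (fun _ : Fin d → ℝ => c) := fun p _ => memLp_const c

theorem coord (i : Fin d) : Nice (fun x : Fin d → ℝ => x i) := fun p hp =>
  (memLp_id_gaussianReal' p hp).comp_measurePreserving
    (measurePreserving_eval (fun _ : Fin d => gaussianReal 0 1) i)

theorem pow (hf : Nice f) (n : ℕ) : Nice (fun x => f x ^ n) := by
  induction n with
  | zero => simpa using const (d := d) 1
  | succ n ih => simpa only [pow_succ] using ih.mul hf

theorem sum {ι : Type*} (s : Finset ι) {F : ι → (Fin d → ℝ) → ℝ} (hF : ∀ i, Nice (F i)) :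
    Nice (fun x => ∑ i ∈ s, F i x) := fun p hp => by
  have := memLp_finsetSum s (μ := gam d) (p := p) (f := F) fun i _ => hF i p hp
  exact this

end Nice

theorem gauss_m1 : ∫ x, x ∂(gaussianReal 0 1) = 0 := integral_id_gaussianReal

theorem gauss_m2 : ∫ x, x ^ 2 ∂(gaussianReal 0 1) = 1 := by
  have h := variance_eq_sub (μ := gaussianReal 0 1) (X := id) (memLp_id_gaussianReal' 2 (by simp))
  rw [variance_id_gaussianReal] at h
  simp only [id, gauss_m1, Pi.pow_apply] at h
  simpa using h.symm

theorem gauss_m3 : ∫ x, x ^ 3 ∂(gaussianReal 0 1) = 0 := by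
  have h : ∫ x, x ^ 3 ∂(Measure.map (fun x => -x) (gaussianReal 0 1))
      = ∫ x, (-x) ^ 3 ∂(gaussianReal 0 1) :=
    integral_map (by fun_prop) (by fun_prop)
  rw [gaussianReal_map_neg, neg_zero] at h
  have h2 : ∀ x : ℝ, (-x) ^ 3 = - x ^ 3 := fun x => by ring
  simp only [h2, integral_neg] at h
  linarith

/-- A constant dominating the fourth moment. -/
def B4 : ℝ := max 3 (∫ x, x ^ 4 ∂(gaussianReal 0 1))

theorem three_le_B4 : 3 ≤ B4 := le_max_left _ _
theorem m4_le : ∫ x, x ^ 4 ∂(gaussianReal 0 1) ≤ B4 := le_max_right _ _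

theorem gam_split {d : ℕ} (a : Fin d) (n : ℕ) {G : (Fin d → ℝ) → ℝ} (hG : Nice G)
    (hfree : ∀ x s, G (Function.update x a s) = G x) :
    ∫ x, x a ^ n * G x ∂(gam d) = (∫ s, s ^ n ∂(gaussianReal 0 1)) * ∫ x, G x ∂(gam d) :=
  integral_pi_split (fun _ : Fin d => gaussianReal 0 1) a (h := fun s => s ^ n) (g := G)
    (((Nice.coord a).pow n).mul hG).int hfree

/-- Moments of affine forms. -/
theorem affine_moments {d : ℕ} (c : Fin d → ℝ) (c0 : ℝ) (s : Finset (Fin d)) :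
    ∫ x, (c0 + ∑ e ∈ s, c e * x e) ^ 2 ∂(gam d) = c0 ^ 2 + ∑ e ∈ s, c e ^ 2 ∧
    ∫ x, (c0 + ∑ e ∈ s, c e * x e) ^ 4 ∂(gam d) ≤ B4 * (c0 ^ 2 + ∑ e ∈ s, c e ^ 2) ^ 2 := by
  induction s using Finset.induction_on with
  | empty =>
    simp only [Finset.sum_empty, add_zero, integral_const, probReal_univ, smul_eq_mul, one_mul,
      true_and]
    nlinarith [three_le_B4, sq_nonneg (c0 ^ 2)]
  | insert a s ha ih =>
    set Y : (Fin d → ℝ) → ℝ := fun x => c0 + ∑ e ∈ s, c e * x e with hY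
    have hYn : Nice Y := (Nice.const c0).add (Nice.sum s fun e => (Nice.const _).mul (Nice.coord e))
    have hYf : ∀ x r, Y (Function.update x a r) = Y x := fun x r => by
      simp only [hY]
      congr 1
      refine Finset.sum_congr rfl fun e he => ?_
      rw [Function.update_of_ne (ne_of_mem_of_not_mem he ha)]
    have hYpf : ∀ (k : ℕ) x r, Y (Function.update x a r) ^ k = Y x ^ k := fun k x r => by rw [hYf]
    have e0 : ∀ x : Fin d → ℝ, c0 + ∑ e ∈ insert a s, c e * x e = Y x + c a * x a := fun x => by
      rw [Finset.sum_insert ha]; simp only [hY]; ring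
    simp only [e0]
    have n2 := hYn.pow 2
    have n4 := hYn.pow 4
    have i11 : Integrable (fun x => 2 * c a * (x a ^ 1 * Y x)) (gam d) :=
      ((((Nice.coord a).pow 1).mul hYn).int).const_mul _
    have sp := fun n k => gam_split a n (hYn.pow k) (hYpf k)
    have s20 := sp 2 0
    have s11 := sp 1 1
    have s13 := sp 1 3
    have s22 := sp 2 2
    have s31 := sp 3 1
    have s40 := sp 4 0
    simp only [pow_zero, pow_one, mul_one, gauss_m1, gauss_m2, gauss_m3, zero_mul, one_mul,
      integral_const, probReal_univ, smul_eq_mul] at s20 s11 s13 s22 s31 s40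
    have ip : ∀ n k, Integrable (fun x : Fin d → ℝ => x a ^ n * Y x ^ k) (gam d) := fun n k =>
      (((Nice.coord a).pow n).mul (hYn.pow k)).int
    have i20 := ip 2 0
    have i11 := ip 1 1
    have i13 := ip 1 3
    have i22 := ip 2 2
    have i31 := ip 3 1
    have i40 := ip 4 0
    simp only [pow_zero, pow_one, mul_one] at i20 i11 i13 i22 i31 i40
    have E2 : ∫ x, (Y x + c a * x a) ^ 2 ∂(gam d) = ∫ x, Y x ^ 2 ∂(gam d) + c a ^ 2 := by
      have : ∀ x, (Y x + c a * x a) ^ 2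
          = Y x ^ 2 + (2 * c a * (x a * Y x) + c a ^ 2 * x a ^ 2) := fun x => by ring
      simp only [this]
      rw [integral_add n2.int (iadd (i11.const_mul _) (i20.const_mul _)),
        integral_add (i11.const_mul _) (i20.const_mul _), integral_const_mul,
        integral_const_mul, s11, s20]
      ring
    have E4 : ∫ x, (Y x + c a * x a) ^ 4 ∂(gam d) = ∫ x, Y x ^ 4 ∂(gam d)
        + 6 * c a ^ 2 * (∫ x, Y x ^ 2 ∂(gam d))
        + c a ^ 4 * ∫ x, x ^ 4 ∂(gaussianReal 0 1) := by
      have : ∀ x, (Y x + c a * x a) ^ 4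
          = Y x ^ 4 + (4 * c a * (x a * Y x ^ 3) + (6 * c a ^ 2 * (x a ^ 2 * Y x ^ 2)
            + (4 * c a ^ 3 * (x a ^ 3 * Y x) + c a ^ 4 * x a ^ 4))) := fun x => by ring
      simp only [this]
      have j1 := iadd (i31.const_mul (4 * c a ^ 3)) (i40.const_mul (c a ^ 4))
      have j2 := iadd (i22.const_mul (6 * c a ^ 2)) j1
      have j3 := iadd (i13.const_mul (4 * c a)) j2
      rw [integral_add n4.int j3, integral_add (i13.const_mul _) j2,
        integral_add (i22.const_mul _) j1, integral_add (i31.const_mul _) (i40.const_mul _)]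
      simp only [integral_const_mul]
      rw [s13, s22, s31, s40]
      ring
    rw [E2, E4, ih.1, Finset.sum_insert ha]
    refine ⟨by ring, ?_⟩
    have h4 := ih.2
    set S := c0 ^ 2 + ∑ e ∈ s, c e ^ 2 with hS
    have hS0 : 0 ≤ S := by
      rw [← ih.1]; exact integral_nonneg fun x => sq_nonneg _
    have e3 : c0 ^ 2 + (c a ^ 2 + ∑ e ∈ s, c e ^ 2) = S + c a ^ 2 := by rw [hS]; ring
    rw [e3]
    have h5 : c a ^ 4 * ∫ x, x ^ 4 ∂(gaussianReal 0 1) ≤ c a ^ 4 * B4 :=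
      mul_le_mul_of_nonneg_left m4_le (by positivity)
    nlinarith [three_le_B4, mul_nonneg (mul_nonneg (sq_nonneg (c a)) hS0)
      (sub_nonneg.2 three_le_B4)]

/-! ### The linear-regression block: features, forms and the sine test -/

section block
variable {d : ℕ} (Z : Fin d → Prop) [DecidablePred Z]

/-- Features index: a constant feature plus the free coordinates. -/
abbrev BZ : Type := Option {b : Fin d // ¬ Z b}
/-- Parameters of a block. -/
abbrev JZ : Type := {a : Fin d // Z a} × BZ Z

/-- The features. -/
def feat (x : Fin d → ℝ) (b : BZ Z) : ℝ := b.elim 1 fun e => x e.1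

/-- The regression function. -/
def lin (θ : JZ Z → ℝ) (x : Fin d → ℝ) (a : {a : Fin d // Z a}) : ℝ :=
  ∑ b, θ (a, b) * feat Z x b

/-- The bilinear form pairing noise and the regression function. -/
def pair (θ : JZ Z → ℝ) (x : Fin d → ℝ) : ℝ := ∑ a : {a : Fin d // Z a}, x a.1 * lin Z θ x a

/-- Independence of the coordinates in `Z`. -/
def ZFree (G : (Fin d → ℝ) → ℝ) : Prop := ∀ x y : Fin d → ℝ, (∀ e, ¬ Z e → x e = y e) → G x = G y

theorem ZFree.upd {Z : Fin d → Prop} {G : (Fin d → ℝ) → ℝ} (hG : ZFree Z G) {a : Fin d} (ha : Z a)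
    (x : Fin d → ℝ) (s : ℝ) : G (Function.update x a s) = G x :=
  hG _ _ fun e he => Function.update_of_ne (by rintro rfl; exact he ha) _ _

theorem feat_nice (b : BZ Z) : Nice fun x => feat Z x b := by
  cases b with
  | none => exact Nice.const 1
  | some e => exact Nice.coord e.1

theorem feat_free {x y : Fin d → ℝ} (h : ∀ e, ¬ Z e → x e = y e) : feat Z x = feat Z y := by
  funext b
  cases b with
  | none => rfl
  | some e => exact h e.1 e.2

theorem lin_nice (θ : JZ Z → ℝ) (a) : Nice fun x => lin Z θ x a :=
  Nice.sum _ fun b => (Nice.const _).mul (feat_nice Z b)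

theorem lin_free (θ : JZ Z → ℝ) (a) : ZFree Z fun x => lin Z θ x a := fun x y h => by
  simp only [lin, feat_free Z h]

theorem pair_nice (θ : JZ Z → ℝ) : Nice fun x => pair Z θ x :=
  Nice.sum _ fun a => (Nice.coord _).mul (lin_nice Z θ a)

theorem lin_eq (θ : JZ Z → ℝ) (x : Fin d → ℝ) (a) :
    lin Z θ x a = θ (a, none) + ∑ e ∈ Finset.univ.filter (fun e => ¬ Z e),
      (if h : ¬ Z e then θ (a, some ⟨e, h⟩) else 0) * x e := by
  rw [lin, Fintype.sum_option]
  congr 1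
  · simp [feat]
  · rw [Finset.sum_subtype (p := fun e => ¬ Z e) (Finset.univ.filter (fun e => ¬ Z e)) (by simp)]
    refine Finset.sum_congr rfl fun e _ => ?_
    rw [dif_pos e.2]
    rfl

theorem sq_eq (θ : JZ Z → ℝ) (a) :
    ∑ b, θ (a, b) ^ 2 = θ (a, none) ^ 2 + ∑ e ∈ Finset.univ.filter (fun e => ¬ Z e),
      (if h : ¬ Z e then θ (a, some ⟨e, h⟩) else 0) ^ 2 := by
  rw [Fintype.sum_option]
  congr 1
  rw [Finset.sum_subtype (p := fun e => ¬ Z e) (Finset.univ.filter (fun e => ¬ Z e)) (by simp)]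
  refine Finset.sum_congr rfl fun e _ => ?_
  rw [dif_pos e.2]

theorem lin_m2 (θ : JZ Z → ℝ) (a) : ∫ x, lin Z θ x a ^ 2 ∂(gam d) = ∑ b, θ (a, b) ^ 2 := by
  simp only [lin_eq, sq_eq]
  exact (affine_moments _ _ _).1

theorem lin_m4 (θ : JZ Z → ℝ) (a) :
    ∫ x, lin Z θ x a ^ 4 ∂(gam d) ≤ B4 * (∑ b, θ (a, b) ^ 2) ^ 2 := by
  simp only [lin_eq, sq_eq]
  exact (affine_moments _ _ _).2

theorem mom1 {a : Fin d} (ha : Z a) {G : (Fin d → ℝ) → ℝ} (hG : Nice G) (hf : ZFree Z G) :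
    ∫ x, x a * G x ∂(gam d) = 0 := by
  have := gam_split a 1 hG (hf.upd ha)
  simpa only [pow_one, gauss_m1, zero_mul] using this

theorem mom11 {a a' : Fin d} (ha : Z a) (ha' : Z a') {G : (Fin d → ℝ) → ℝ} (hG : Nice G)
    (hf : ZFree Z G) :
    ∫ x, x a * x a' * G x ∂(gam d) = if a = a' then ∫ x, G x ∂(gam d) else 0 := by
  split_ifs with h
  · subst h
    have := gam_split a 2 hG (hf.upd ha)
    simpa only [pow_two, ← pow_two, gauss_m2, one_mul] using this
  · have := gam_split a 1 ((Nice.coord a').mul hG) (fun x s => by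
      rw [hf.upd ha, Function.update_of_ne (Ne.symm h)])
    simpa only [pow_one, gauss_m1, zero_mul, mul_assoc] using this

theorem quad {v : {a : Fin d // Z a} → (Fin d → ℝ) → ℝ} (hv : ∀ a, Nice (v a))
    (hvf : ∀ a, ZFree Z (v a)) {G : (Fin d → ℝ) → ℝ} (hG : Nice G) (hf : ZFree Z G) :
    ∫ x, (∑ a : {a : Fin d // Z a}, x a.1 * v a x) ^ 2 * G x ∂(gam d)
      = ∫ x, (∑ a, v a x ^ 2) * G x ∂(gam d) := by
  have e : ∀ x, (∑ a : {a : Fin d // Z a}, x a.1 * v a x) ^ 2 * G x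
      = ∑ a : {a : Fin d // Z a}, ∑ a' : {a : Fin d // Z a},
        x a.1 * x a'.1 * (v a x * v a' x * G x) := fun x => by
    rw [pow_two, Finset.sum_mul_sum, Finset.sum_mul]
    refine Finset.sum_congr rfl fun a _ => ?_
    rw [Finset.sum_mul]
    exact Finset.sum_congr rfl fun a' _ => by ring
  simp only [e]
  have hn : ∀ a a', Nice (fun x => v a x * v a' x * G x) := fun a a' =>
    ((hv a).mul (hv a')).mul hG
  have hz : ∀ a a', ZFree Z (fun x => v a x * v a' x * G x) := fun a a' x y h => by
    simp only [hvf a x y h, hvf a' x y h, hf x y h]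
  have hi : ∀ a a', Integrable (fun x : Fin d → ℝ =>
      x a.1 * x a'.1 * (v a x * v a' x * G x)) (gam d) := fun a a' =>
    (((Nice.coord _).mul (Nice.coord _)).mul (hn a a')).int
  rw [integral_finsetSum _ fun a _ => integrable_finsetSum _ fun a' _ => hi a a']
  have e2 : ∀ x, (∑ a, v a x ^ 2) * G x = ∑ a, v a x * v a x * G x := fun x => by
    rw [Finset.sum_mul]
    exact Finset.sum_congr rfl fun a _ => by ring
  simp only [e2]
  rw [integral_finsetSum _ fun a _ => (hn a a).int]
  refine Finset.sum_congr rfl fun a _ => ?_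
  rw [integral_finsetSum _ fun a' _ => hi a a']
  simp only [mom11 Z a.2 (Subtype.property _) (hn _ _) (hz _ _), ← Subtype.ext_iff]
  simp

theorem lin_sum_m2 (θ : JZ Z → ℝ) :
    ∫ x, (∑ a, lin Z θ x a ^ 2) ∂(gam d) = ∑ j, θ j ^ 2 := by
  rw [integral_finsetSum _ fun a _ => ((lin_nice Z θ a).pow 2).int, Fintype.sum_prod_type]
  simp only [lin_m2]

theorem pair_m2 (θ : JZ Z → ℝ) : ∫ x, pair Z θ x ^ 2 ∂(gam d) = ∑ j, θ j ^ 2 := by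
  have := quad Z (v := fun a x => lin Z θ x a) (lin_nice Z θ) (lin_free Z θ)
    (Nice.const 1) (fun _ _ _ => rfl)
  simp only [mul_one] at this
  rw [← lin_sum_m2]
  exact this

theorem pair_m1 (θ : JZ Z → ℝ) : ∫ x, pair Z θ x ∂(gam d) = 0 := by
  simp only [pair]
  rw [integral_finsetSum _ fun a _ => ((Nice.coord _).mul (lin_nice Z θ a)).int]
  exact Finset.sum_eq_zero fun a _ => mom1 Z a.2 (lin_nice Z θ a) (lin_free Z θ a)

theorem pair_l1 (θ : JZ Z → ℝ) : ∫ x, |pair Z θ x| ∂(gam d) ≤ Real.sqrt (∑ j, θ j ^ 2) := by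
  rw [← pair_m2]
  refine Real.le_sqrt_of_sq_le ?_
  have hv := variance_nonneg (fun x => |pair Z θ x|) (gam d)
  have hm : MemLp (fun x => |pair Z θ x|) 2 (gam d) := ((pair_nice Z θ) 2 (by simp)).abs
  rw [variance_eq_sub hm] at hv
  simp only [Pi.pow_apply, sq_abs] at hv
  linarith

theorem lin_sum_m4 (θ : JZ Z → ℝ) :
    ∫ x, (∑ a, lin Z θ x a ^ 2) ^ 2 ∂(gam d) ≤ B4 * (∑ j, θ j ^ 2) ^ 2 := by
  set r : {a : Fin d // Z a} → ℝ := fun a => ∑ b, θ (a, b) ^ 2 with hr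
  have hr0 : ∀ a, 0 ≤ r a := fun a => Finset.sum_nonneg fun _ _ => sq_nonneg _
  have hB : 0 ≤ B4 := by linarith [three_le_B4]
  have h2n : ∀ a, Nice fun x => lin Z θ x a ^ 2 := fun a => (lin_nice Z θ a).pow 2
  have e : ∀ x, (∑ a, lin Z θ x a ^ 2) ^ 2 = ∑ a, ∑ a', lin Z θ x a ^ 2 * lin Z θ x a' ^ 2 :=
    fun x => by rw [pow_two, Finset.sum_mul_sum]
  simp only [e]
  rw [integral_finsetSum _ fun a _ => integrable_finsetSum _ fun a' _ => ((h2n a).mul (h2n a')).int,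
    Fintype.sum_prod_type]
  have e3 : B4 * (∑ a, ∑ b, θ (a, b) ^ 2) ^ 2 = ∑ a, ∑ a', B4 * (r a * r a') := by
    rw [pow_two, Finset.sum_mul_sum, Finset.mul_sum]
    simp only [Finset.mul_sum, hr]
  rw [e3]
  refine Finset.sum_le_sum fun a _ => ?_
  rw [integral_finsetSum _ fun a' _ => ((h2n a).mul (h2n a')).int]
  refine Finset.sum_le_sum fun a' _ => ?_
  -- Cauchy-Schwarz in the form of AM-GM with weights
  have key : ∀ l : ℝ, 0 < l → ∫ x, lin Z θ x a ^ 2 * lin Z θ x a' ^ 2 ∂(gam d)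
      ≤ l / 2 * (B4 * r a ^ 2) + l⁻¹ / 2 * (B4 * r a' ^ 2) := fun l hl => by
    have n4 : ∀ a, Nice fun x => lin Z θ x a ^ 4 := fun a => (lin_nice Z θ a).pow 4
    calc _ ≤ ∫ x, (l / 2 * lin Z θ x a ^ 4 + l⁻¹ / 2 * lin Z θ x a' ^ 4) ∂(gam d) := by
          refine integral_mono ((h2n a).mul (h2n a')).int
            (iadd ((n4 a).int.const_mul _) ((n4 a').int.const_mul _)) fun x => ?_
          simp only
          have h : 0 ≤ l⁻¹ / 2 * (l * lin Z θ x a ^ 2 - lin Z θ x a' ^ 2) ^ 2 := by positivity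
          have e : l⁻¹ / 2 * (l * lin Z θ x a ^ 2 - lin Z θ x a' ^ 2) ^ 2
              = l / 2 * lin Z θ x a ^ 4 + l⁻¹ / 2 * lin Z θ x a' ^ 4
                - lin Z θ x a ^ 2 * lin Z θ x a' ^ 2 := by
            field_simp
            ring
          linarith
      _ = l / 2 * (∫ x, lin Z θ x a ^ 4 ∂(gam d)) + l⁻¹ / 2 * ∫ x, lin Z θ x a' ^ 4 ∂(gam d) := by
          rw [integral_add ((n4 a).int.const_mul _) ((n4 a').int.const_mul _),
            integral_const_mul, integral_const_mul]
      _ ≤ _ := by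
          gcongr
          · exact lin_m4 Z θ a
          · exact lin_m4 Z θ a'
  refine le_of_forall_pos_le_add fun η hη => ?_
  rcases (hr0 a).eq_or_lt with ha | ha
  · have := key ((η / (B4 * r a' ^ 2 + 1))⁻¹) (by positivity)
    rw [← ha] at this ⊢
    refine this.trans ?_
    rw [inv_inv]
    have h0 : 0 ≤ B4 * r a' ^ 2 := by positivity
    have : η / (B4 * r a' ^ 2 + 1) / 2 * (B4 * r a' ^ 2) ≤ η := by
      rw [div_div, div_mul_eq_mul_div, div_le_iff₀ (by positivity)]
      nlinarith
    simpa using this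
  rcases (hr0 a').eq_or_lt with ha' | ha'
  · have := key (η / (B4 * r a ^ 2 + 1)) (by positivity)
    rw [← ha'] at this ⊢
    refine this.trans ?_
    have h0 : 0 ≤ B4 * r a ^ 2 := by positivity
    have : η / (B4 * r a ^ 2 + 1) / 2 * (B4 * r a ^ 2) ≤ η := by
      rw [div_div, div_mul_eq_mul_div, div_le_iff₀ (by positivity)]
      nlinarith
    simpa using this
  · have := key (r a' / r a) (by positivity)
    have e5 : r a' / r a / 2 * (B4 * r a ^ 2) + (r a' / r a)⁻¹ / 2 * (B4 * r a' ^ 2)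
        = B4 * (r a * r a') := by
      field_simp
      ring
    linarith

theorem sin_cos_bound (X c : ℝ) (hc : 0 ≤ c) :
    c - c ^ 2 / 2 - c * X ^ 2 / 2 ≤ Real.sin c * Real.cos X := by
  have h1 : c - c ^ 2 / 2 ≤ Real.sin c := by
    rcases hc.eq_or_lt with rfl | hc'
    · simp
    rcases le_or_gt c 3 with h | h
    · have := Real.sin_gt_sub_cube hc'
      nlinarith [mul_nonneg (sq_nonneg c) (sub_nonneg.2 h)]
    · nlinarith [Real.neg_one_le_sin c]
  have h2 : |Real.sin c| ≤ c := (Real.abs_sin_le_abs).trans (abs_of_nonneg hc).le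
  have h3 := Real.one_sub_sq_div_two_le_cos (x := X)
  have h4 := Real.cos_le_one X
  have h5 : Real.sin c * (1 - Real.cos X) ≤ c * (X ^ 2 / 2) :=
    mul_le_mul ((le_abs_self _).trans h2) (by linarith) (by linarith) hc
  nlinarith

/-- Flip the signs of the `Z` coordinates. -/
def zflip (x : Fin d → ℝ) : Fin d → ℝ := fun e => if Z e then - x e else x e

theorem flip_mp : MeasurePreserving (zflip Z) (gam d) (gam d) := by
  refine measurePreserving_pi (fun _ : Fin d => gaussianReal 0 1) (fun _ => gaussianReal 0 1)
    (f := fun e s => if Z e then - s else s) fun e => ?_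
  by_cases h : Z e
  · simp only [h, if_true]
    exact ⟨measurable_neg, by rw [gaussianReal_map_neg, neg_zero]⟩
  · simp only [h, if_false]
    exact MeasurePreserving.id _

theorem lin_flip (θ : JZ Z → ℝ) (x) : lin Z θ (zflip Z x) = lin Z θ x := by
  funext a
  exact lin_free Z θ a _ _ fun e he => by simp [zflip, he]

theorem pair_flip (θ : JZ Z → ℝ) (x) : pair Z θ (zflip Z x) = - pair Z θ x := by
  simp only [pair, lin_flip]
  rw [← Finset.sum_neg_distrib]
  refine Finset.sum_congr rfl fun a _ => ?_
  simp [zflip, a.2]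

theorem feat_meas (b) : Measurable fun x => feat Z x b := by
  cases b with
  | none => exact measurable_const
  | some e => exact measurable_pi_apply e.1

theorem lin_meas (θ : JZ Z → ℝ) (a) : Measurable fun x => lin Z θ x a :=
  Finset.measurable_sum _ fun b _ => (feat_meas Z b).const_mul _

theorem pair_meas (θ : JZ Z → ℝ) : Measurable fun x => pair Z θ x :=
  Finset.measurable_sum _ fun a _ => (measurable_pi_apply a.1).mul (lin_meas Z θ a)

theorem odd_zero {f : (Fin d → ℝ) → ℝ} (hf : Measurable f) (h : ∀ x, f (zflip Z x) = - f x) :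
    ∫ x, f x ∂(gam d) = 0 := by
  have h1 : ∫ x, f (zflip Z x) ∂(gam d) = ∫ x, f x ∂(gam d) := by
    conv_rhs => rw [← (flip_mp Z).map_eq]
    exact (integral_map (flip_mp Z).measurable.aemeasurable hf.aestronglyMeasurable).symm
  simp only [h, integral_neg] at h1
  linarith

theorem sine_zero (θ : JZ Z → ℝ) (κ : ℝ) : ∫ x, Real.sin (κ * pair Z θ x) ∂(gam d) = 0 := by
  refine odd_zero Z (Real.measurable_sin.comp ((pair_meas Z θ).const_mul κ)) fun x => ?_
  rw [pair_flip, mul_neg, Real.sin_neg]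

theorem sine_lower (θ : JZ Z → ℝ) {σ : ℝ} (hσ : σ = Real.sqrt (∑ j, θ j ^ 2)) (h1 : σ ≤ 1 / 2) :
    σ / (2 * B4) ≤ ∫ x, Real.sin ((B4 * σ)⁻¹ * (pair Z θ x + ∑ a, lin Z θ x a ^ 2)) ∂(gam d) := by
  have hB := three_le_B4
  have hσ0 : 0 ≤ σ := hσ ▸ Real.sqrt_nonneg _
  rcases hσ0.eq_or_lt with h0 | hpos
  · rw [← h0]; simp
  set κ := (B4 * σ)⁻¹ with hκ
  have hκ0 : 0 < κ := by positivity
  set W : (Fin d → ℝ) → ℝ := fun x => ∑ a, lin Z θ x a ^ 2 with hW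
  have hWn : Nice W := Nice.sum _ fun a => (lin_nice Z θ a).pow 2
  have hWm : Measurable W := Finset.measurable_sum _ fun a _ => (lin_meas Z θ a).pow_const 2
  have hWf : ZFree Z W := fun x y h => by
    simp only [hW]
    exact Finset.sum_congr rfl fun a _ => by
      have := lin_free Z θ a x y h
      simp only at this
      rw [this]
  have hW0 : ∀ x, 0 ≤ W x := fun x => Finset.sum_nonneg fun _ _ => sq_nonneg _
  have hs2 : ∑ j, θ j ^ 2 = σ ^ 2 := by
    rw [hσ, Real.sq_sqrt (Finset.sum_nonneg fun _ _ => sq_nonneg _)]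
  have hbd : ∀ {f : (Fin d → ℝ) → ℝ}, Measurable f → (∀ x, |f x| ≤ 1) → Integrable f (gam d) :=
    fun hf h => Integrable.of_bound hf.aestronglyMeasurable 1 (Filter.Eventually.of_forall h)
  have hpm := pair_meas Z θ
  have i1 : Integrable (fun x => Real.sin (κ * pair Z θ x) * Real.cos (κ * W x)) (gam d) :=
    hbd (by fun_prop) fun x => by
      rw [abs_mul]
      exact mul_le_one₀ (Real.abs_sin_le_one _) (abs_nonneg _) (Real.abs_cos_le_one _)
  have i2 : Integrable (fun x => Real.sin (κ * W x) * Real.cos (κ * pair Z θ x)) (gam d) :=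
    hbd (by fun_prop) fun x => by
      rw [abs_mul]
      exact mul_le_one₀ (Real.abs_sin_le_one _) (abs_nonneg _) (Real.abs_cos_le_one _)
  have e1 : ∫ x, Real.sin (κ * pair Z θ x) * Real.cos (κ * W x) ∂(gam d) = 0 := by
    refine odd_zero Z (by fun_prop) fun x => ?_
    have : W (zflip Z x) = W x := by simp only [hW, lin_flip]
    rw [pair_flip, this, mul_neg, Real.sin_neg, neg_mul]
  have e2 : ∀ x, Real.sin (κ * (pair Z θ x + ∑ a, lin Z θ x a ^ 2)) = Real.sin (κ * pair Z θ x) * Real.cos (κ * W x)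
      + Real.sin (κ * W x) * Real.cos (κ * pair Z θ x) := fun x => by
    change Real.sin (κ * (pair Z θ x + W x)) = _
    rw [mul_add, Real.sin_add]; ring
  simp only [e2]
  rw [integral_add i1 i2, e1, zero_add]
  have n3 : Nice fun x => pair Z θ x ^ 2 * W x := ((pair_nice Z θ).pow 2).mul hWn
  have hq : ∫ x, pair Z θ x ^ 2 * W x ∂(gam d) = ∫ x, W x ^ 2 ∂(gam d) := by
    have := quad Z (v := fun a x => lin Z θ x a) (lin_nice Z θ) (lin_free Z θ) hWn hWf
    simp only [pow_two (W _)]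
    exact this
  have h4 : ∫ x, W x ^ 2 ∂(gam d) ≤ B4 * (σ ^ 2) ^ 2 := by
    have := lin_sum_m4 Z θ
    rw [hs2] at this
    exact this
  have h2 : ∫ x, W x ∂(gam d) = σ ^ 2 := by rw [← hs2, ← lin_sum_m2]
  have j1 : Integrable (fun x => κ * W x) (gam d) := hWn.int.const_mul _
  have j2 : Integrable (fun x => κ ^ 2 / 2 * W x ^ 2) (gam d) := (hWn.pow 2).int.const_mul _
  have j3 : Integrable (fun x => κ ^ 3 / 2 * (pair Z θ x ^ 2 * W x)) (gam d) := n3.int.const_mul _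
  calc σ / (2 * B4) ≤ κ * σ ^ 2 - κ ^ 2 / 2 * (B4 * (σ ^ 2) ^ 2)
        - κ ^ 3 / 2 * (B4 * (σ ^ 2) ^ 2) := by
        have : κ * σ ^ 2 - κ ^ 2 / 2 * (B4 * (σ ^ 2) ^ 2) - κ ^ 3 / 2 * (B4 * (σ ^ 2) ^ 2)
          = σ / B4 * (1 - σ / 2 - 1 / (2 * B4)) := by
          rw [hκ]; field_simp
        rw [this]
        have h6 : 1 / (2 * B4) ≤ 1 / 6 := by
          apply one_div_le_one_div_of_le (by norm_num); linarith
        have h7 : σ / (2 * B4) = σ / B4 * (1 / 2) := by field_simp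
        rw [h7]
        refine mul_le_mul_of_nonneg_left (by linarith) (by positivity)
    _ ≤ κ * (∫ x, W x ∂(gam d)) - κ ^ 2 / 2 * (∫ x, W x ^ 2 ∂(gam d))
        - κ ^ 3 / 2 * (∫ x, pair Z θ x ^ 2 * W x ∂(gam d)) := by
        rw [h2, hq]
        gcongr
    _ = ∫ x, (κ * W x - κ ^ 2 / 2 * W x ^ 2 - κ ^ 3 / 2 * (pair Z θ x ^ 2 * W x)) ∂(gam d) := by
        have j12 : Integrable (fun x => κ * W x - κ ^ 2 / 2 * W x ^ 2) (gam d) := j1.sub j2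
        rw [integral_sub j12 j3, integral_sub j1 j2, integral_const_mul, integral_const_mul,
          integral_const_mul]
    _ ≤ _ := by
        have j12 : Integrable (fun x => κ * W x - κ ^ 2 / 2 * W x ^ 2) (gam d) := j1.sub j2
        refine integral_mono (j12.sub j3) i2 fun x => ?_
        have := sin_cos_bound (κ * pair Z θ x) (κ * W x) (mul_nonneg hκ0.le (hW0 x))
        refine le_trans (le_of_eq ?_) this
        ring

end block

/-! ### Change of variables and Gaussian densities -/

section cov
variable {d : ℕ} (Z : Fin d → Prop) [DecidablePred Z]

/-- The structural map of the block. -/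
def shift (θ : JZ Z → ℝ) (x : Fin d → ℝ) : Fin d → ℝ :=
  fun c => x c + if h : Z c then lin Z θ x ⟨c, h⟩ else 0

theorem shift_of_not (θ : JZ Z → ℝ) (x : Fin d → ℝ) {e : Fin d} (he : ¬ Z e) :
    shift Z θ x e = x e := by simp [shift, he]

theorem shift_of_mem (θ : JZ Z → ℝ) (x : Fin d → ℝ) (a : {a : Fin d // Z a}) :
    shift Z θ x a.1 = x a.1 + lin Z θ x a := by simp [shift, a.2]

theorem feat_shift (θ : JZ Z → ℝ) (x : Fin d → ℝ) : feat Z (shift Z θ x) = feat Z x :=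
  feat_free Z fun _ he => shift_of_not Z θ x he

theorem lin_shift (θ θ' : JZ Z → ℝ) (x : Fin d → ℝ) : lin Z θ (shift Z θ' x) = lin Z θ x := by
  funext a
  simp only [lin, feat_shift]

theorem lin_add (θ θ' : JZ Z → ℝ) (x : Fin d → ℝ) (a) :
    lin Z (θ + θ') x a = lin Z θ x a + lin Z θ' x a := by
  simp only [lin, Pi.add_apply, add_mul, Finset.sum_add_distrib]

theorem lin_neg (θ : JZ Z → ℝ) (x : Fin d → ℝ) (a) : lin Z (-θ) x a = - lin Z θ x a := by
  simp only [lin, Pi.neg_apply, neg_mul, Finset.sum_neg_distrib]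

theorem shift_shift (θ θ' : JZ Z → ℝ) (x : Fin d → ℝ) :
    shift Z θ (shift Z θ' x) = shift Z (θ + θ') x := by
  funext c
  by_cases h : Z c
  · have h1 := shift_of_mem Z θ (shift Z θ' x) ⟨c, h⟩
    have h2 := shift_of_mem Z θ' x ⟨c, h⟩
    have h3 := shift_of_mem Z (θ + θ') x ⟨c, h⟩
    simp only at h1 h2 h3
    rw [h1, h2, h3, lin_shift, lin_add]
    ring
  · rw [shift_of_not Z _ _ h, shift_of_not Z _ _ h, shift_of_not Z _ _ h]

theorem shift_zero (x : Fin d → ℝ) : shift Z 0 x = x := by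
  funext c
  simp [shift, lin]

theorem shift_neg_shift (θ : JZ Z → ℝ) (x) : shift Z (-θ) (shift Z θ x) = x := by
  rw [shift_shift, neg_add_cancel, shift_zero]

theorem shift_shift_neg (θ : JZ Z → ℝ) (x) : shift Z θ (shift Z (-θ) x) = x := by
  rw [shift_shift, add_neg_cancel, shift_zero]

theorem shift_meas (θ : JZ Z → ℝ) : Measurable (shift Z θ) := by
  rw [measurable_pi_iff]
  intro c
  by_cases h : Z c
  · simp only [shift, h, dif_pos]
    exact (measurable_pi_apply c).add (lin_meas Z θ ⟨c, h⟩)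
  · simp only [shift, h, dif_neg, not_false_eq_true, add_zero]
    exact measurable_pi_apply c

/-- Linear part of the structural map. -/
def nmat (θ : JZ Z → ℝ) : Matrix (Fin d) (Fin d) ℝ := fun c e =>
  if h : Z c ∧ ¬ Z e then θ (⟨c, h.1⟩, some ⟨e, h.2⟩) else 0

/-- Constant part of the structural map. -/
def wvec (θ : JZ Z → ℝ) : Fin d → ℝ := fun c => if h : Z c then θ (⟨c, h⟩, none) else 0

theorem shift_eq (θ : JZ Z → ℝ) (x : Fin d → ℝ) :
    shift Z θ x = wvec Z θ + (1 + nmat Z θ) *ᵥ x := by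
  funext c
  rw [Matrix.add_mulVec, Matrix.one_mulVec]
  simp only [shift, Pi.add_apply, wvec, Matrix.mulVec, dotProduct, nmat]
  by_cases h : Z c
  · simp only [h, dif_pos, true_and]
    rw [lin_eq, Finset.sum_filter]
    have : ∀ e, (if ¬ Z e then (if h' : ¬ Z e then θ (⟨c, h⟩, some ⟨e, h'⟩) else 0) * x e else 0)
        = (if h' : ¬ Z e then θ (⟨c, h⟩, some ⟨e, h'⟩) else 0) * x e := fun e => by
      by_cases he : Z e <;> simp [he]
    simp only [this]
    ring
  · simp [h]

theorem det_one_add (θ : JZ Z → ℝ) : (1 + nmat Z θ).det = 1 := by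
  rw [Matrix.twoBlockTriangular_det _ Z (fun i hi j hj => by
    have hij : i ≠ j := by rintro rfl; exact hi hj
    simp [nmat, hi, hij])]
  have h1 : (1 + nmat Z θ).toSquareBlockProp Z = 1 := by
    ext i j
    simp [Matrix.toSquareBlockProp_def, nmat, j.2, Matrix.one_apply, Subtype.ext_iff]
  have h2 : (1 + nmat Z θ).toSquareBlockProp (fun i => ¬ Z i) = 1 := by
    ext i j
    simp [Matrix.toSquareBlockProp_def, nmat, i.2, Matrix.one_apply, Subtype.ext_iff]
  rw [h1, h2]
  simp

theorem shift_mp (θ : JZ Z → ℝ) (ctr : Fin d → ℝ) :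
    MeasurePreserving (fun x => shift Z θ x + ctr) volume volume := by
  have h1 : MeasurePreserving (Matrix.toLin' (1 + nmat Z θ)) volume volume := by
    refine ⟨(LinearMap.continuous_of_finiteDimensional _).measurable, ?_⟩
    rw [Real.map_matrix_volume_pi_eq_smul_volume_pi (by rw [det_one_add]; norm_num), det_one_add]
    simp
  have h2 : MeasurePreserving (fun x : Fin d → ℝ => (wvec Z θ + ctr) + x) volume volume :=
    measurePreserving_add_left volume _
  have h3 := h2.comp h1
  convert h3 using 1
  funext x
  simp only [Function.comp, Matrix.toLin'_apply, shift_eq]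
  abel

/-- The structural map, translated, as a measurable equivalence. -/
def shiftE (θ : JZ Z → ℝ) (ctr : Fin d → ℝ) : (Fin d → ℝ) ≃ᵐ (Fin d → ℝ) where
  toFun x := shift Z θ x + ctr
  invFun y := shift Z (-θ) (y - ctr)
  left_inv x := by simp only [add_sub_cancel_right, shift_neg_shift]
  right_inv y := by simp only [shift_shift_neg, sub_add_cancel]
  measurable_toFun := (shift_meas Z θ).add_const ctr
  measurable_invFun := (shift_meas Z (-θ)).comp (measurable_id.sub_const ctr)

/-- Standard Gaussian density. -/
def g0 (x : Fin d → ℝ) : ℝ := ∏ c, gaussianPDFReal 0 1 (x c)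

theorem g0_pos (x : Fin d → ℝ) : 0 < g0 x :=
  Finset.prod_pos fun c _ => gaussianPDFReal_pos 0 1 _ one_ne_zero

theorem g0_meas : Measurable (g0 (d := d)) :=
  Finset.measurable_prod _ fun c _ => (measurable_gaussianPDFReal 0 1).comp (measurable_pi_apply c)

theorem gam_eq : gam d = volume.withDensity fun x => ENNReal.ofReal (g0 x) := by
  have := pi_withDensity_real (fun _ : Fin d => (volume : Measure ℝ))
    (fun _ => gaussianPDFReal 0 1) (fun _ x => gaussianPDFReal_nonneg 0 1 x)
    (fun _ => integrable_gaussianPDFReal 0 1)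
  rw [← volume_pi] at this
  unfold g0
  rw [← this, gam]
  congr 1
  funext _
  rw [gaussianReal_of_var_ne_zero _ one_ne_zero]
  rfl

theorem g0_eq (x : Fin d → ℝ) :
    g0 x = (Real.sqrt ((2 * Real.pi) ^ d))⁻¹ * Real.exp (-(1/2) * (x ⬝ᵥ x)) := by
  unfold g0 gaussianPDFReal
  rw [Finset.prod_mul_distrib, ← Real.exp_sum]
  congr 1
  · simp only [NNReal.coe_one, mul_one, Finset.prod_const, Finset.card_univ, Fintype.card_fin]
    rw [inv_pow]
    congr 1
    refine (Real.sqrt_eq_iff_mul_self_eq (by positivity) (by positivity)).2 ?_ |>.symm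
    rw [← mul_pow, Real.mul_self_sqrt (by positivity)]
  · congr 1
    simp only [dotProduct, Finset.mul_sum, NNReal.coe_one]
    exact Finset.sum_congr rfl fun c _ => by ring

/-- Density of a block. -/
def qd (θ : JZ Z → ℝ) (x : Fin d → ℝ) : ℝ := g0 (shift Z (-θ) x)

theorem qd_pos (θ : JZ Z → ℝ) (x : Fin d → ℝ) : 0 < qd Z θ x := g0_pos _

theorem qd_meas (θ : JZ Z → ℝ) : Measurable (qd Z θ) := g0_meas.comp (shift_meas Z _)

theorem integral_qd (θ : JZ Z → ℝ) (ctr : Fin d → ℝ) (f : (Fin d → ℝ) → ℝ) :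
    ∫ x, qd Z θ (x - ctr) * f x = ∫ ξ, f (shift Z θ ξ + ctr) ∂(gam d) := by
  have h : MeasurePreserving (shiftE Z θ ctr) volume volume := shift_mp Z θ ctr
  rw [← h.integral_comp' (fun x => qd Z θ (x - ctr) * f x), gam_eq,
    integral_withDensity_eq_integral_toReal_smul g0_meas.ennreal_ofReal
      (Filter.Eventually.of_forall fun x => by simp)]
  refine integral_congr_ae (Filter.Eventually.of_forall fun x => ?_)
  simp only [smul_eq_mul, ENNReal.toReal_ofReal (g0_pos x).le]
  change qd Z θ (shift Z θ x + ctr - ctr) * f (shift Z θ x + ctr) = _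
  rw [add_sub_cancel_right, qd, shift_neg_shift]

theorem integrable_qd (θ : JZ Z → ℝ) (ctr : Fin d → ℝ) (f : (Fin d → ℝ) → ℝ) :
    Integrable (fun x => qd Z θ (x - ctr) * f x) volume ↔
      Integrable (fun ξ => f (shift Z θ ξ + ctr)) (gam d) := by
  have h : MeasurePreserving (shiftE Z θ ctr) volume volume := shift_mp Z θ ctr
  rw [← h.integrable_comp_emb (shiftE Z θ ctr).measurableEmbedding, gam_eq,
    integrable_withDensity_iff_integrable_smul' g0_meas.ennreal_ofReal
      (Filter.Eventually.of_forall fun x => by simp)]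
  refine integrable_congr (Filter.Eventually.of_forall fun x => ?_)
  simp only [smul_eq_mul, ENNReal.toReal_ofReal (g0_pos x).le, Function.comp]
  change qd Z θ (shift Z θ x + ctr - ctr) * f (shift Z θ x + ctr) = _
  rw [add_sub_cancel_right, qd, shift_neg_shift]

/-- Covariance matrix of a block. -/
def covm (θ : JZ Z → ℝ) : Matrix (Fin d) (Fin d) ℝ :=
  ((1 + nmat Z (-θ))ᵀ * (1 + nmat Z (-θ)))⁻¹

theorem covm_posDef (θ : JZ Z → ℝ) : (covm Z θ).PosDef := by
  refine Matrix.PosDef.inv ?_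
  have hu : IsUnit (1 + nmat Z (-θ)) := by
    rw [Matrix.isUnit_iff_isUnit_det, det_one_add]; exact isUnit_one
  have := Matrix.PosDef.conjTranspose_mul_self (1 + nmat Z (-θ))
    (Matrix.mulVec_injective_iff_isUnit.2 hu)
  rwa [Matrix.conjTranspose_eq_transpose_of_trivial] at this

theorem nmat_wvec (θ : JZ Z → ℝ) : nmat Z (-θ) *ᵥ wvec Z θ = 0 := by
  funext c
  simp only [Matrix.mulVec, dotProduct, Pi.zero_apply]
  refine Finset.sum_eq_zero fun e _ => ?_
  by_cases he : Z e
  · simp [nmat, he]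
  · simp [wvec, he]

theorem wvec_neg (θ : JZ Z → ℝ) : wvec Z (-θ) = - wvec Z θ := by
  funext c
  by_cases h : Z c <;> simp [wvec, h]

theorem gauss_eq (θ : JZ Z → ℝ) (ctr : Fin d → ℝ) :
    gauss d (wvec Z θ + ctr) (covm Z θ)
      = volume.withDensity fun x => ENNReal.ofReal (qd Z θ (x - ctr)) := by
  unfold gauss
  congr 1
  funext x
  congr 1
  have hdet : ((1 + nmat Z (-θ))ᵀ * (1 + nmat Z (-θ))).det = 1 := by
    rw [Matrix.det_mul, Matrix.det_transpose, det_one_add, one_mul]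
  have h1 : (covm Z θ).det = 1 := by
    rw [covm, Matrix.det_nonsing_inv, hdet]; simp
  have h2 : (covm Z θ)⁻¹ = (1 + nmat Z (-θ))ᵀ * (1 + nmat Z (-θ)) := by
    rw [covm, Matrix.nonsing_inv_nonsing_inv]
    rw [hdet]; exact isUnit_one
  have h3 : (1 + nmat Z (-θ)) *ᵥ (x - (wvec Z θ + ctr)) = shift Z (-θ) (x - ctr) := by
    rw [shift_eq, wvec_neg]
    have : x - (wvec Z θ + ctr) = (x - ctr) - wvec Z θ := by abel
    rw [this, Matrix.mulVec_sub, Matrix.add_mulVec 1 (nmat Z (-θ)) (wvec Z θ), nmat_wvec,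
      Matrix.one_mulVec, add_zero]
    abel
  rw [h1, h2, mul_one, qd, g0_eq, ← h3, ← Matrix.mulVec_mulVec, Matrix.dotProduct_mulVec,
    Matrix.vecMul_transpose]

end cov

/-! ### The mixture family -/

section family
variable {d : ℕ} (Z : Fin d → Prop) [DecidablePred Z]

theorem continuous_feat (b : BZ Z) : Continuous fun x : Fin d → ℝ => feat Z x b := by
  cases b with
  | none => exact continuous_const
  | some e => exact continuous_apply e.1

theorem continuous_lin {X : Type*} [TopologicalSpace X] {θ : X → JZ Z → ℝ} {x : X → Fin d → ℝ}
    (hθ : Continuous θ) (hx : Continuous x) (a) : Continuous fun z => lin Z (θ z) (x z) a :=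
  continuous_finsetSum _ fun b _ =>
    ((continuous_apply (a, b)).comp hθ).mul ((continuous_feat Z b).comp hx)

theorem continuous_pair {X : Type*} [TopologicalSpace X] {θ : X → JZ Z → ℝ} {x : X → Fin d → ℝ}
    (hθ : Continuous θ) (hx : Continuous x) : Continuous fun z => pair Z (θ z) (x z) :=
  continuous_finsetSum _ fun a _ => ((continuous_apply a.1).comp hx).mul (continuous_lin Z hθ hx a)

theorem continuous_shift {X : Type*} [TopologicalSpace X] {θ : X → JZ Z → ℝ} {x : X → Fin d → ℝ}
    (hθ : Continuous θ) (hx : Continuous x) : Continuous fun z => shift Z (θ z) (x z) := by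
  refine continuous_pi fun c => ?_
  by_cases h : Z c
  · simp only [shift, h, dif_pos]
    exact ((continuous_apply c).comp hx).add (continuous_lin Z hθ hx ⟨c, h⟩)
  · simp only [shift, h, dif_neg, not_false_eq_true, add_zero]
    exact (continuous_apply c).comp hx

theorem continuous_g0 : Continuous (g0 (d := d)) := by
  have : (g0 (d := d)) = fun x => (Real.sqrt ((2 * Real.pi) ^ d))⁻¹ *
      Real.exp (-(1/2) * (x ⬝ᵥ x)) := funext g0_eq
  rw [this]
  simp only [dotProduct]
  fun_prop

theorem continuous_qd {X : Type*} [TopologicalSpace X] {θ : X → JZ Z → ℝ} {x : X → Fin d → ℝ}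
    (hθ : Continuous θ) (hx : Continuous x) : Continuous fun z => qd Z (θ z) (x z) :=
  continuous_g0.comp (continuous_shift Z hθ.neg hx)

theorem lin_smul (u : ℝ) (θ : JZ Z → ℝ) (x : Fin d → ℝ) (a) :
    lin Z (u • θ) x a = u * lin Z θ x a := by
  simp only [lin, Pi.smul_apply, smul_eq_mul, mul_assoc, Finset.mul_sum]

theorem pair_add (θ θ' : JZ Z → ℝ) (x : Fin d → ℝ) :
    pair Z (θ + θ') x = pair Z θ x + pair Z θ' x := by
  simp only [pair, lin_add, mul_add, Finset.sum_add_distrib]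

theorem pair_smul (u : ℝ) (θ : JZ Z → ℝ) (x : Fin d → ℝ) :
    pair Z (u • θ) x = u * pair Z θ x := by
  simp only [pair, lin_smul, Finset.mul_sum]
  exact Finset.sum_congr rfl fun a _ => by ring

/-- Pairing as a linear map in the parameter. -/
def pairL (x : Fin d → ℝ) : (JZ Z → ℝ) →ₗ[ℝ] ℝ where
  toFun θ := pair Z θ x
  map_add' θ θ' := pair_add Z θ θ' x
  map_smul' u θ := pair_smul Z u θ x

theorem qd_deriv (θ c : JZ Z → ℝ) (y : Fin d → ℝ) (u : ℝ) :
    HasDerivAt (fun u : ℝ => qd Z (θ + u • c) y)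
      (qd Z (θ + u • c) y * pair Z c (shift Z (-(θ + u • c)) y)) u := by
  have h1 : ∀ e, HasDerivAt (fun u : ℝ => shift Z (-(θ + u • c)) y e)
      (- if h : Z e then lin Z c y ⟨e, h⟩ else 0) u := fun e => by
    by_cases h : Z e
    · simp only [shift, h, dif_pos, lin_neg, lin_add, lin_smul]
      have := ((((hasDerivAt_id u).mul_const (lin Z c y ⟨e, h⟩)).const_add
        (lin Z θ y ⟨e, h⟩)).neg).const_add (y e)
      simpa using this
    · simp only [shift, h, dif_neg, not_false_eq_true, add_zero, neg_zero]
      exact hasDerivAt_const _ _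
  have h2 : HasDerivAt (fun u : ℝ => -(1/2) * (shift Z (-(θ + u • c)) y ⬝ᵥ shift Z (-(θ + u • c)) y))
      (pair Z c (shift Z (-(θ + u • c)) y)) u := by
    simp only [dotProduct]
    have h3 := (HasDerivAt.fun_sum (u := Finset.univ) fun e _ => (h1 e).mul (h1 e)).const_mul (-(1/2 : ℝ))
    refine HasDerivAt.congr_deriv (h3.congr_of_eventuallyEq (Filter.Eventually.of_forall fun v => ?_)) ?_
    · rfl
    · rw [pair, lin_shift, Finset.mul_sum]
      rw [← Finset.sum_filter_add_sum_filter_not Finset.univ Z]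
      rw [Finset.sum_eq_zero (s := Finset.univ.filter fun e => ¬ Z e) (fun e he => by
        have : ¬ Z e := by simpa using he
        simp [this]), add_zero]
      rw [Finset.sum_subtype (p := Z) (Finset.univ.filter Z) (by simp)]
      refine Finset.sum_congr rfl fun a _ => ?_
      rw [dif_pos a.2]
      ring
  simp only [qd, g0_eq]
  refine ((h2.exp).const_mul (Real.sqrt ((2 * Real.pi) ^ d))⁻¹).congr_deriv ?_
  ring

end family

/-! ### The mixture family satisfies the abstract hypotheses -/

section fam
variable {d : ℕ} (Z : Fin d → Prop) [DecidablePred Z] {k : ℕ}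

/-- Parameters of the i-th block. -/
def par (R : ℝ) (t : Fin k × JZ Z → ℝ) (i : Fin k) : JZ Z → ℝ := fun j => R * t (i, j)

/-- Mixture density. -/
def mm (R : ℝ) (ctr : Fin k → Fin d → ℝ) (t : Fin k × JZ Z → ℝ) (x : Fin d → ℝ) : ℝ :=
  (k : ℝ)⁻¹ * ∑ i, qd Z (par Z R t i) (x - ctr i)

/-- Directional derivative of the mixture density. -/
def num (R : ℝ) (ctr : Fin k → Fin d → ℝ) (t v : Fin k × JZ Z → ℝ) (x : Fin d → ℝ) : ℝ :=
  (k : ℝ)⁻¹ * ∑ i, qd Z (par Z R t i) (x - ctr i) *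
    pair Z (par Z R v i) (shift Z (-(par Z R t i)) (x - ctr i))

/-- Score function. -/
def sc (R : ℝ) (ctr : Fin k → Fin d → ℝ) (p : Fin k × JZ Z) (t : Fin k × JZ Z → ℝ)
    (x : Fin d → ℝ) : ℝ := num Z R ctr t (Pi.single p 1) x / mm Z R ctr t x

variable (R : ℝ) (ctr : Fin k → Fin d → ℝ)

theorem par_add (v w : Fin k × JZ Z → ℝ) (i) : par Z R (v + w) i = par Z R v i + par Z R w i := by
  funext j; simp [par, mul_add]

theorem par_smul (u : ℝ) (v : Fin k × JZ Z → ℝ) (i) : par Z R (u • v) i = u • par Z R v i := by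
  funext j; simp only [par, Pi.smul_apply, smul_eq_mul]; ring

theorem continuous_par {X : Type*} [TopologicalSpace X] {t : X → Fin k × JZ Z → ℝ}
    (ht : Continuous t) (i) : Continuous fun z => par Z R (t z) i :=
  continuous_pi fun j => continuous_const.mul ((continuous_apply (i, j)).comp ht)

theorem continuous_mm {X : Type*} [TopologicalSpace X] {t : X → Fin k × JZ Z → ℝ}
    {x : X → Fin d → ℝ} (ht : Continuous t) (hx : Continuous x) :
    Continuous fun z => mm Z R ctr (t z) (x z) :=
  continuous_const.mul (continuous_finsetSum _ fun i _ =>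
    continuous_qd Z (continuous_par Z R ht i) (hx.sub continuous_const))

theorem continuous_num {X : Type*} [TopologicalSpace X] {t : X → Fin k × JZ Z → ℝ}
    {x : X → Fin d → ℝ} (ht : Continuous t) (hx : Continuous x) (v) :
    Continuous fun z => num Z R ctr (t z) v (x z) :=
  continuous_const.mul (continuous_finsetSum _ fun i _ =>
    (continuous_qd Z (continuous_par Z R ht i) (hx.sub continuous_const)).mul
    (continuous_pair Z continuous_const
      (continuous_shift Z (continuous_par Z R ht i).neg (hx.sub continuous_const))))

theorem mm_pos (hk : 0 < k) (t) (x : Fin d → ℝ) : 0 < mm Z R ctr t x := by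
  have : Nonempty (Fin k) := ⟨⟨0, hk⟩⟩
  exact mul_pos (inv_pos.2 (by exact_mod_cast hk))
    (Finset.sum_pos (fun i _ => qd_pos Z _ _) Finset.univ_nonempty)

theorem continuous_sc (hk : 0 < k) {X : Type*} [TopologicalSpace X] {t : X → Fin k × JZ Z → ℝ}
    {x : X → Fin d → ℝ} (ht : Continuous t) (hx : Continuous x) (p) :
    Continuous fun z => sc Z R ctr p (t z) (x z) :=
  (continuous_num Z R ctr ht hx _).div (continuous_mm Z R ctr ht hx)
    fun z => (mm_pos Z R ctr hk _ _).ne'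

theorem expect (t : Fin k × JZ Z → ℝ) {f : Fin k → (Fin d → ℝ) → ℝ}
    (hf : ∀ i, Integrable (fun ξ => f i (shift Z (par Z R t i) ξ + ctr i)) (gam d)) :
    Integrable (fun x => (k : ℝ)⁻¹ * ∑ i, qd Z (par Z R t i) (x - ctr i) * f i x) volume ∧
    ∫ x, (k : ℝ)⁻¹ * ∑ i, qd Z (par Z R t i) (x - ctr i) * f i x
      = (k : ℝ)⁻¹ * ∑ i, ∫ ξ, f i (shift Z (par Z R t i) ξ + ctr i) ∂(gam d) := by
  have h1 : ∀ i, Integrable (fun x => qd Z (par Z R t i) (x - ctr i) * f i x) volume :=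
    fun i => (integrable_qd Z _ _ _).2 (hf i)
  refine ⟨(integrable_finsetSum _ fun i _ => h1 i).const_mul _, ?_⟩
  rw [integral_const_mul, integral_finsetSum _ fun i _ => h1 i]
  simp only [integral_qd]

theorem mm_meas (t : Fin k × JZ Z → ℝ) : Measurable fun x => mm Z R ctr t x :=
  (continuous_mm Z R ctr continuous_const continuous_id).measurable

theorem integral_mm (t : Fin k × JZ Z → ℝ) (f : (Fin d → ℝ) → ℝ) (hk : 0 < k) :
    ∫ x, f x ∂(dens volume (mm Z R ctr) t) = ∫ x, mm Z R ctr t x * f x := by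
  rw [dens, integral_withDensity_eq_integral_toReal_smul
    (mm_meas Z R ctr t).ennreal_ofReal
      (Filter.Eventually.of_forall fun x => by simp)]
  refine integral_congr_ae (Filter.Eventually.of_forall fun x => ?_)
  simp only [smul_eq_mul, ENNReal.toReal_ofReal (mm_pos Z R ctr hk t x).le]

theorem integrable_mm (t : Fin k × JZ Z → ℝ) (f : (Fin d → ℝ) → ℝ) (hk : 0 < k) :
    Integrable f (dens volume (mm Z R ctr) t) ↔ Integrable (fun x => mm Z R ctr t x * f x) := by
  rw [dens, integrable_withDensity_iff_integrable_smul'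
    (mm_meas Z R ctr t).ennreal_ofReal
      (Filter.Eventually.of_forall fun x => by simp)]
  refine integrable_congr (Filter.Eventually.of_forall fun x => ?_)
  simp only [smul_eq_mul, ENNReal.toReal_ofReal (mm_pos Z R ctr hk t x).le]

theorem mm_mul (t : Fin k × JZ Z → ℝ) (f : (Fin d → ℝ) → ℝ) (x) : mm Z R ctr t x * f x
    = (k : ℝ)⁻¹ * ∑ i, qd Z (par Z R t i) (x - ctr i) * f x := by
  rw [mm, mul_assoc, Finset.sum_mul]

theorem mm_one (hk : 0 < k) (t : Fin k × JZ Z → ℝ) :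
    Integrable (mm Z R ctr t) volume ∧ ∫ x, mm Z R ctr t x = 1 := by
  have h := expect Z R ctr t (f := fun _ _ => 1) (fun i => integrable_const _)
  have h2 : (fun x => (k : ℝ)⁻¹ * ∑ i, qd Z (par Z R t i) (x - ctr i) * 1) = mm Z R ctr t := by
    funext x; simp only [mul_one, mm]
  rw [h2] at h
  refine ⟨h.1, ?_⟩
  rw [h.2]
  have : (k : ℝ) ≠ 0 := by positivity
  simp [this]

theorem mm_deriv (hk : 0 < k) (p) (t : Fin k × JZ Z → ℝ) (x : Fin d → ℝ) (u : ℝ) :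
    HasDerivAt (fun u => mm Z R ctr (Function.update t p u) x)
    (sc Z R ctr p (Function.update t p u) x * mm Z R ctr (Function.update t p u) x) u := by
  have h0 : ∀ u : ℝ, Function.update t p u = Function.update t p 0 + u • Pi.single p 1 := by
    intro u
    funext q
    by_cases h : q = p
    · subst h; simp
    · simp [h]
  rw [sc, div_mul_cancel₀ _ (mm_pos Z R ctr hk _ _).ne']
  unfold num
  simp only [mm]
  refine HasDerivAt.const_mul _ (HasDerivAt.fun_sum fun i _ => ?_)
  have h1 := qd_deriv Z (par Z R (Function.update t p 0) i) (par Z R (Pi.single p 1) i) (x - ctr i) u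
  have h2 : ∀ u : ℝ, par Z R (Function.update t p 0) i + u • par Z R (Pi.single p 1) i
      = par Z R (Function.update t p u) i := fun u => by
    rw [h0 u, par_add, par_smul]
  simp only [h2] at h1
  exact h1

/-- Linear form of the numerator. -/
theorem num_sum (t c : Fin k × JZ Z → ℝ) (x : Fin d → ℝ) :
    ∑ p, c p * num Z R ctr t (Pi.single p 1) x = num Z R ctr t c x := by
  have hc : c = ∑ p, c p • (Pi.single p 1 : Fin k × JZ Z → ℝ) := by
    funext q
    simp [Finset.sum_apply, Pi.single_apply]
  let Φ : (Fin k × JZ Z → ℝ) →ₗ[ℝ] ℝ :=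
    { toFun := fun v => num Z R ctr t v x
      map_add' := fun v w => by
        simp only [num, par_add, pair_add, mul_add, Finset.sum_add_distrib]
      map_smul' := fun u v => by
        simp only [num, par_smul, pair_smul, Finset.mul_sum, RingHom.id_apply, smul_eq_mul]
        exact Finset.sum_congr rfl fun a _ => by ring }
  change ∑ p, c p * Φ (Pi.single p 1) = Φ c
  conv_rhs => rw [hc, map_sum]
  simp only [map_smul, smul_eq_mul]

theorem num_l1 (hk : 0 < k) (t v : Fin k × JZ Z → ℝ) :
    ∫ x, |num Z R ctr t v x / mm Z R ctr t x| ∂(dens volume (mm Z R ctr) t)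
      ≤ (k : ℝ)⁻¹ * ∑ i, Real.sqrt (∑ j, par Z R v i j ^ 2) := by
  rw [integral_mm Z R ctr t _ hk]
  have h := expect Z R ctr t
    (f := fun i x => |pair Z (par Z R v i) (shift Z (-(par Z R t i)) (x - ctr i))|)
    (fun i => by
      simp only [add_sub_cancel_right, shift_neg_shift]
      exact (pair_nice Z _).int.abs)
  simp only [add_sub_cancel_right, shift_neg_shift] at h
  calc _ = ∫ x, |num Z R ctr t v x| := by
        refine integral_congr_ae (Filter.Eventually.of_forall fun x => ?_)
        have hp := mm_pos Z R ctr hk t x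
        simp only [abs_div, abs_of_pos hp]
        field_simp
    _ ≤ _ := by
        refine integral_mono_of_nonneg (Filter.Eventually.of_forall fun x => abs_nonneg _) h.1
          (Filter.Eventually.of_forall fun x => ?_)
        simp only [num, abs_mul, abs_inv, Nat.abs_cast]
        refine mul_le_mul_of_nonneg_left ((Finset.abs_sum_le_sum_abs _ _).trans
          (Finset.sum_le_sum fun i _ => ?_)) (by positivity)
        rw [abs_mul, abs_of_pos (qd_pos Z _ _)]
    _ = _ := h.2
    _ ≤ _ := by
        refine mul_le_mul_of_nonneg_left (Finset.sum_le_sum fun i _ => pair_l1 Z _) (by positivity)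

theorem num_l2 (hk : 0 < k) (t v : Fin k × JZ Z → ℝ) :
    MemLp (fun x => num Z R ctr t v x / mm Z R ctr t x) 2 (dens volume (mm Z R ctr) t) ∧
    ∫ x, (num Z R ctr t v x / mm Z R ctr t x) ^ 2 ∂(dens volume (mm Z R ctr) t)
      ≤ (k : ℝ)⁻¹ * ∑ i, ∑ j, par Z R v i j ^ 2 := by
  have h := expect Z R ctr t
    (f := fun i x => pair Z (par Z R v i) (shift Z (-(par Z R t i)) (x - ctr i)) ^ 2)
    (fun i => by
      simp only [add_sub_cancel_right, shift_neg_shift]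
      exact ((pair_nice Z _).pow 2).int)
  simp only [add_sub_cancel_right, shift_neg_shift, pair_m2] at h
  have hle : ∀ x, mm Z R ctr t x * (num Z R ctr t v x / mm Z R ctr t x) ^ 2 ≤
      (k : ℝ)⁻¹ * ∑ i, qd Z (par Z R t i) (x - ctr i) *
        pair Z (par Z R v i) (shift Z (-(par Z R t i)) (x - ctr i)) ^ 2 := fun x => by
    have hp := mm_pos Z R ctr hk t x
    have e : mm Z R ctr t x * (num Z R ctr t v x / mm Z R ctr t x) ^ 2
        = num Z R ctr t v x ^ 2 / mm Z R ctr t x := by field_simp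
    rw [e, div_le_iff₀ hp]
    have cs := Finset.sum_sq_le_sum_mul_sum_of_sq_le_mul Finset.univ
      (r := fun i => qd Z (par Z R t i) (x - ctr i) *
        pair Z (par Z R v i) (shift Z (-(par Z R t i)) (x - ctr i)))
      (f := fun i => qd Z (par Z R t i) (x - ctr i) *
        pair Z (par Z R v i) (shift Z (-(par Z R t i)) (x - ctr i)) ^ 2)
      (g := fun i => qd Z (par Z R t i) (x - ctr i))
      (fun i _ => mul_nonneg (qd_pos Z _ _).le (sq_nonneg _)) (fun i _ => (qd_pos Z _ _).le)
      (fun i _ => le_of_eq (by ring))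
    have := mul_le_mul_of_nonneg_left cs (sq_nonneg ((k : ℝ)⁻¹))
    rw [num, mm]
    nlinarith [this]
  have hi : Integrable (fun x => mm Z R ctr t x * (num Z R ctr t v x / mm Z R ctr t x) ^ 2) := by
    refine h.1.mono' ?_ (Filter.Eventually.of_forall fun x => ?_)
    · have h1 := continuous_mm Z R ctr (continuous_const (y := t)) continuous_id
      have h2 := continuous_num Z R ctr (continuous_const (y := t)) continuous_id v
      exact (h1.mul ((h2.div h1 fun x => (mm_pos Z R ctr hk t x).ne').pow 2)).aestronglyMeasurable
    · rw [Real.norm_of_nonneg (mul_nonneg (mm_pos Z R ctr hk t x).le (sq_nonneg _))]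
      exact hle x
  constructor
  · refine (memLp_two_iff_integrable_sq ?_).2 ((integrable_mm Z R ctr t _ hk).2 hi)
    have h1 := continuous_mm Z R ctr (continuous_const (y := t)) continuous_id
    have h2 := continuous_num Z R ctr (continuous_const (y := t)) continuous_id v
    exact (h2.div h1 fun x => (mm_pos Z R ctr hk t x).ne').aestronglyMeasurable
  · rw [integral_mm Z R ctr t _ hk]
    exact (integral_mono hi h.1 hle).trans_eq h.2

theorem sum_single (p : Fin k × JZ Z) :
    ∑ i, ∑ j, par Z R (Pi.single p 1) i j ^ 2 = R ^ 2 := by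
  rw [← Fintype.sum_prod_type' (f := fun i j => par Z R (Pi.single p 1) i j ^ 2)]
  rw [Fintype.sum_eq_single p]
  · simp [par]
  · intro q hq
    simp [par, hq]

theorem sum_single_sqrt (hR : 0 ≤ R) (p : Fin k × JZ Z) :
    ∑ i, Real.sqrt (∑ j, par Z R (Pi.single p 1) i j ^ 2) = R := by
  obtain ⟨i0, j0⟩ := p
  rw [Fintype.sum_eq_single i0, Fintype.sum_eq_single j0]
  · simp [par, Real.sqrt_sq hR]
  · intro j hj
    simp [par, hj]
  · intro i hi
    have : ∀ j, par Z R (Pi.single (i0, j0) 1) i j = 0 := fun j => by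
      simp [par, hi]
    simp [this]

theorem isFam (hk : 0 < k) (hR : 0 ≤ R) :
    IsFam volume (mm Z R ctr) (sc Z R ctr) (R ^ 2 / k) (R * Real.sqrt (Fintype.card (JZ Z)))
      (R * Fintype.card (JZ Z)) where
  m_meas := (continuous_mm Z R ctr continuous_fst continuous_snd).measurable
  s_meas p := (continuous_sc Z R ctr hk continuous_fst continuous_snd p).measurable
  m_pos := mm_pos Z R ctr hk
  m_int t := (mm_one Z R ctr hk t).1
  m_one t := (mm_one Z R ctr hk t).2
  deriv := mm_deriv Z R ctr hk
  s_cont p t x := continuous_sc Z R ctr hk (continuous_const.update p continuous_id)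
    continuous_const p
  s_memLp p t := (num_l2 Z R ctr hk t _).1
  s_zero p t := by
    rw [integral_mm Z R ctr t _ hk]
    have h := expect Z R ctr t
      (f := fun i x => pair Z (par Z R (Pi.single p 1) i) (shift Z (-(par Z R t i)) (x - ctr i)))
      (fun i => by
        simp only [add_sub_cancel_right, shift_neg_shift]
        exact (pair_nice Z _).int)
    simp only [add_sub_cancel_right, shift_neg_shift, pair_m1, Finset.sum_const_zero,
      mul_zero] at h
    rw [← h.2]
    refine integral_congr_ae (Filter.Eventually.of_forall fun x => ?_)
    have hp := mm_pos Z R ctr hk t x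
    simp only [sc]
    rw [mul_div_cancel₀ _ hp.ne']
    rfl
  s_var p t := by
    refine (num_l2 Z R ctr hk t _).2.trans_eq ?_
    rw [sum_single]
    ring
  s_l1 t c hc := by
    have h1 : ∀ x, ∑ p, c p * sc Z R ctr p t x = num Z R ctr t c x / mm Z R ctr t x := fun x => by
      rw [← num_sum, Finset.sum_div]
      exact Finset.sum_congr rfl fun p _ => by rw [sc, mul_div_assoc]
    simp only [h1]
    refine (num_l1 Z R ctr hk t c).trans ?_
    have h2 : ∀ i, Real.sqrt (∑ j, par Z R c i j ^ 2) ≤ R * Real.sqrt (Fintype.card (JZ Z)) := by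
      intro i
      have : ∑ j, par Z R c i j ^ 2 ≤ R ^ 2 * Fintype.card (JZ Z) := by
        calc _ ≤ ∑ _j : JZ Z, R ^ 2 := Finset.sum_le_sum fun j _ => by
              rw [par, mul_pow]
              have := (sq_le_one_iff_abs_le_one _).2 (hc (i, j))
              nlinarith [sq_nonneg R]
          _ = _ := by simp [mul_comm]
      calc _ ≤ Real.sqrt (R ^ 2 * Fintype.card (JZ Z)) := Real.sqrt_le_sqrt this
        _ = _ := by rw [Real.sqrt_mul (sq_nonneg R), Real.sqrt_sq hR]
    have hk' : (k : ℝ) ≠ 0 := by positivity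
    calc _ ≤ (k : ℝ)⁻¹ * ∑ _i : Fin k, R * Real.sqrt (Fintype.card (JZ Z)) :=
          mul_le_mul_of_nonneg_left (Finset.sum_le_sum fun i _ => h2 i) (by positivity)
      _ = _ := by
          rw [Finset.sum_const, Finset.card_univ, Fintype.card_fin, nsmul_eq_mul,
            inv_mul_cancel_left₀ hk']
  s_abs t := by
    have hk' : (k : ℝ) ≠ 0 := by positivity
    calc _ ≤ ∑ p : Fin k × JZ Z, (k : ℝ)⁻¹ * R := Finset.sum_le_sum fun p _ => by
          refine (num_l1 Z R ctr hk t (Pi.single p 1)).trans_eq ?_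
          rw [sum_single_sqrt Z R hR]
      _ = _ := by
          rw [Finset.sum_const, Finset.card_univ, Fintype.card_prod, Fintype.card_fin, nsmul_eq_mul]
          push_cast
          field_simp

theorem mixture_eq (hk : 0 < k) (t : Fin k × JZ Z → ℝ) :
    mixture d k (fun _ => (k : ℝ)⁻¹) (fun i => wvec Z (par Z R t i) + ctr i)
      (fun i => covm Z (par Z R t i)) = dens volume (mm Z R ctr) t := by
  unfold mixture dens
  simp only [gauss_eq]
  rw [Measure.sum_fintype]
  have h1 : ∀ i, Measurable fun x => ENNReal.ofReal (qd Z (par Z R t i) (x - ctr i)) := fun i =>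
    ((qd_meas Z _).comp (measurable_id.sub_const _)).ennreal_ofReal
  have h2 : (fun x => ENNReal.ofReal (mm Z R ctr t x)) = fun x =>
      ∑ i, (ENNReal.ofReal (k : ℝ)⁻¹ • fun x => ENNReal.ofReal (qd Z (par Z R t i) (x - ctr i))) x := by
    funext x
    rw [mm, ENNReal.ofReal_mul (by positivity), ENNReal.ofReal_sum_of_nonneg
      (fun i _ => (qd_pos Z _ _).le), Finset.mul_sum]
    rfl
  rw [h2]
  ext s hs
  rw [Measure.finsetSum_apply, withDensity_apply _ hs, lintegral_finsetSum _
    fun i _ => (h1 i).const_smul _]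
  refine Finset.sum_congr rfl fun i _ => ?_
  rw [Measure.smul_apply, withDensity_apply _ hs]
  simp only [Pi.smul_apply, smul_eq_mul]
  rw [lintegral_const_mul _ (h1 i)]

end fam

/-! ### Total variation controls the parameters -/

section tvpar
variable {d : ℕ} (Z : Fin d → Prop) [DecidablePred Z] {k : ℕ}

/-- Separated centers. -/
def cen (e : Fin d) (M : ℝ) (i : Fin k) : Fin d → ℝ := Pi.single e (M * (i : ℕ))

theorem exists_glue (e : Fin d) {M : ℝ} (hM : 0 < M) {hi : Fin k → (Fin d → ℝ) → ℝ}
    (hm : ∀ i, Measurable (hi i)) (h1 : ∀ i x, |hi i x| ≤ 1) :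
    ∃ h : (Fin d → ℝ) → ℝ, Measurable h ∧ (∀ x, |h x| ≤ 1) ∧
      ∀ i y, |h (y + cen e M i) - hi i y| ≤ 8 / M ^ 2 * y e ^ 2 := by
  set h : (Fin d → ℝ) → ℝ := fun x =>
    ∑ i : Fin k, if ⌊x e / M + 1 / 2⌋ = ((i : ℕ) : ℤ) then hi i (x - cen e M i) else 0 with hh
  have key : ∀ x (i : Fin k), ⌊x e / M + 1 / 2⌋ = ((i : ℕ) : ℤ) → h x = hi i (x - cen e M i) := by
    intro x i hx
    rw [hh]
    simp only [hx]
    rw [Fintype.sum_eq_single i]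
    · simp
    · intro i' hne
      rw [if_neg]
      intro h2
      exact hne (Fin.ext (by exact_mod_cast h2.symm))
  have hb : ∀ x, |h x| ≤ 1 := by
    intro x
    by_cases hx : ∃ i : Fin k, ⌊x e / M + 1 / 2⌋ = ((i : ℕ) : ℤ)
    · obtain ⟨i, hx⟩ := hx
      rw [key x i hx]
      exact h1 i _
    · push Not at hx
      rw [hh]
      simp only [hx, if_false, Finset.sum_const_zero, abs_zero, zero_le_one]
  refine ⟨h, ?_, hb, ?_⟩
  · refine Finset.measurable_sum _ fun i _ => ?_
    refine Measurable.ite ?_ ((hm i).comp (measurable_id.sub_const _)) measurable_const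
    have h0 : Measurable fun x : Fin d → ℝ => x e / M + 1 / 2 := by fun_prop
    have : Measurable fun x : Fin d → ℝ => ⌊x e / M + 1 / 2⌋ := Int.measurable_floor.comp h0
    exact this (MeasurableSet.singleton ((i : ℕ) : ℤ))
  · intro i y
    by_cases hy : |y e| < M / 2
    · rw [key _ i, add_sub_cancel_right, sub_self, abs_zero]
      · positivity
      · rw [abs_lt] at hy
        rw [Int.floor_eq_iff]
        have e1 : (y + cen e M i) e / M + 1 / 2 = y e / M + (i : ℕ) + 1 / 2 := by
          simp only [cen, Pi.add_apply, Pi.single_eq_same]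
          field_simp
        have h3 : -(1/2) < y e / M := by rw [lt_div_iff₀ hM]; linarith
        have h4 : y e / M < 1/2 := by rw [div_lt_iff₀ hM]; linarith
        rw [e1]
        push_cast
        constructor <;> linarith
    · push Not at hy
      have h2 : |h (y + cen e M i) - hi i y| ≤ 2 := by
        have := abs_sub (h (y + cen e M i)) (hi i y)
        linarith [hb (y + cen e M i), h1 i y]
      refine h2.trans ?_
      have h3 : (M / 2) ^ 2 ≤ y e ^ 2 := by
        rw [← sq_abs (y e)]
        exact pow_le_pow_left₀ (by positivity) hy 2
      rw [div_mul_eq_mul_div, le_div_iff₀ (by positivity)]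
      nlinarith

theorem shift_m2 (e : Fin d) (he : Z e) (θ : JZ Z → ℝ) (hθ : ∑ j, θ j ^ 2 ≤ 1) :
    Integrable (fun ξ => shift Z θ ξ e ^ 2) (gam d) ∧ ∫ ξ, shift Z θ ξ e ^ 2 ∂(gam d) ≤ 4 := by
  have hs : ∀ ξ, shift Z θ ξ e = ξ e + lin Z θ ξ ⟨e, he⟩ := fun ξ => shift_of_mem Z θ ξ ⟨e, he⟩
  simp only [hs]
  have hn1 : Nice fun ξ : Fin d → ℝ => ξ e := Nice.coord e
  have hn2 := lin_nice Z θ ⟨e, he⟩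
  have hI := ((hn1.add hn2).pow 2).int
  refine ⟨hI, ?_⟩
  have hb : ∑ b, θ (⟨e, he⟩, b) ^ 2 ≤ 1 := by
    refine le_trans ?_ hθ
    rw [Fintype.sum_prod_type]
    exact Finset.single_le_sum (f := fun a => ∑ b, θ (a, b) ^ 2)
      (fun a _ => Finset.sum_nonneg fun b _ => sq_nonneg _) (Finset.mem_univ _)
  have i1 : Integrable (fun ξ : Fin d → ℝ => 2 * ξ e ^ 2) (gam d) := ((hn1.pow 2).int).const_mul 2
  have i2 : Integrable (fun ξ : Fin d → ℝ => 2 * lin Z θ ξ ⟨e, he⟩ ^ 2) (gam d) :=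
    ((hn2.pow 2).int).const_mul 2
  have c2 : ∫ ξ : Fin d → ℝ, ξ e ^ 2 ∂(gam d) = 1 := by
    have hmp := measurePreserving_eval (fun _ : Fin d => gaussianReal 0 1) e
    have := integral_map (μ := Measure.pi fun _ : Fin d => gaussianReal 0 1)
      hmp.measurable.aemeasurable (f := fun x : ℝ => x ^ 2)
      (continuous_pow 2).aestronglyMeasurable
    rw [hmp.map_eq, gauss_m2] at this
    exact this.symm
  calc _ ≤ ∫ ξ, (2 * ξ e ^ 2 + 2 * lin Z θ ξ ⟨e, he⟩ ^ 2) ∂(gam d) := by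
        refine integral_mono hI (iadd i1 i2) fun ξ => ?_
        simp only
        nlinarith [sq_nonneg (ξ e - lin Z θ ξ ⟨e, he⟩)]
    _ = 2 * 1 + 2 * ∑ b, θ (⟨e, he⟩, b) ^ 2 := by
        rw [integral_add i1 i2, integral_const_mul, integral_const_mul, lin_m2, c2]
    _ ≤ 4 := by linarith

theorem sigma_sum (hk : 0 < k) (e : Fin d) (he : Z e) {M R : ℝ} (hM : 0 < M)
    (t t' : Fin k × JZ Z → ℝ)
    (ht : ∀ i, ∑ j, par Z R t i j ^ 2 ≤ 1) (ht' : ∀ i, ∑ j, par Z R t' i j ^ 2 ≤ 1)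
    (hs : ∀ i, Real.sqrt (∑ j, (par Z R t' i - par Z R t i) j ^ 2) ≤ 1 / 2) :
    ∑ i, Real.sqrt (∑ j, (par Z R t' i - par Z R t i) j ^ 2) ≤ 2 * B4 * k *
      (2 * TV (dens volume (mm Z R (cen e M)) t) (dens volume (mm Z R (cen e M)) t') + 64 / M ^ 2)
      := by
  set σ : Fin k → ℝ := fun i => Real.sqrt (∑ j, (par Z R t' i - par Z R t i) j ^ 2) with hσ
  set hi : Fin k → (Fin d → ℝ) → ℝ := fun i y =>
    - Real.sin ((B4 * σ i)⁻¹ * pair Z (par Z R t' i - par Z R t i) (shift Z (-(par Z R t i)) y))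
    with hhi
  have him : ∀ i, Measurable (hi i) := fun i =>
    (Real.measurable_sin.comp (((pair_meas Z _).comp (shift_meas Z _)).const_mul _)).neg
  have hi1 : ∀ i x, |hi i x| ≤ 1 := fun i x => by
    rw [hhi]; simp only [abs_neg]; exact Real.abs_sin_le_one _
  obtain ⟨h, hm, hb, hg⟩ := exists_glue e hM him hi1
  have main : ∀ s : Fin k × JZ Z → ℝ, (∀ i, ∑ j, par Z R s i j ^ 2 ≤ 1) →
      |∫ x, h x ∂(dens volume (mm Z R (cen e M)) s)
        - (k : ℝ)⁻¹ * ∑ i, ∫ ξ, hi i (shift Z (par Z R s i) ξ) ∂(gam d)| ≤ 32 / M ^ 2 := by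
    intro s hss
    have hI1 : ∀ i, Integrable (fun ξ => h (shift Z (par Z R s i) ξ + cen e M i)) (gam d) :=
      fun i => Integrable.of_bound
        (hm.comp ((shift_meas Z _).add_const _)).aestronglyMeasurable 1
        (Filter.Eventually.of_forall fun ξ => hb _)
    have hI2 : ∀ i, Integrable (fun ξ => hi i (shift Z (par Z R s i) ξ)) (gam d) :=
      fun i => Integrable.of_bound
        ((him i).comp (shift_meas Z _)).aestronglyMeasurable 1
        (Filter.Eventually.of_forall fun ξ => hi1 i _)
    rw [integral_mm Z R (cen e M) s _ hk]
    simp only [mm_mul]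
    rw [(expect Z R (cen e M) s (f := fun _ => h) hI1).2, ← mul_sub, ← Finset.sum_sub_distrib,
      abs_mul, abs_inv, Nat.abs_cast]
    have hk' : (0 : ℝ) < k := by exact_mod_cast hk
    rw [inv_mul_le_iff₀ hk']
    calc _ ≤ ∑ i : Fin k, 32 / M ^ 2 := by
          refine (Finset.abs_sum_le_sum_abs _ _).trans (Finset.sum_le_sum fun i _ => ?_)
          rw [← integral_sub (hI1 i) (hI2 i)]
          have h2 := shift_m2 Z e he (par Z R s i) (hss i)
          calc _ ≤ ∫ ξ, |h (shift Z (par Z R s i) ξ + cen e M i) -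
                hi i (shift Z (par Z R s i) ξ)| ∂(gam d) := abs_integral_le_integral_abs
            _ ≤ ∫ ξ, 8 / M ^ 2 * shift Z (par Z R s i) ξ e ^ 2 ∂(gam d) :=
                integral_mono ((hI1 i).sub (hI2 i)).abs (h2.1.const_mul _) fun ξ => hg i _
            _ = 8 / M ^ 2 * ∫ ξ, shift Z (par Z R s i) ξ e ^ 2 ∂(gam d) := integral_const_mul _ _
            _ ≤ 8 / M ^ 2 * 4 := mul_le_mul_of_nonneg_left h2.2 (by positivity)
            _ = _ := by ring
      _ = _ := by simp
  have A := main t ht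
  have B := main t' ht'
  have e1 : ∀ i, ∫ ξ, hi i (shift Z (par Z R t i) ξ) ∂(gam d) = 0 := fun i => by
    simp only [hhi, shift_neg_shift]
    rw [integral_neg, sine_zero, neg_zero]
  have e2 : ∀ i, ∫ ξ, hi i (shift Z (par Z R t' i) ξ) ∂(gam d) ≤ - (σ i / (2 * B4)) := fun i => by
    have hp : ∀ ξ, pair Z (par Z R t' i - par Z R t i)
        (shift Z (-(par Z R t i)) (shift Z (par Z R t' i) ξ))
        = pair Z (par Z R t' i - par Z R t i) ξ
          + ∑ a, lin Z (par Z R t' i - par Z R t i) ξ a ^ 2 := fun ξ => by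
      rw [shift_shift, neg_add_eq_sub]
      simp only [pair, lin_shift, shift_of_mem, ← Finset.sum_add_distrib]
      exact Finset.sum_congr rfl fun a _ => by ring
    simp only [hhi, hp]
    rw [integral_neg]
    exact neg_le_neg (sine_lower Z _ rfl (hs i))
  have hk' : (0 : ℝ) < k := by exact_mod_cast hk
  haveI : ∀ s, IsProbabilityMeasure (dens volume (mm Z R (cen (k := k) e M)) s) := fun s => by
    have h1 := mm_one Z R (cen (k := k) e M) hk s
    constructor
    rw [dens, withDensity_apply _ MeasurableSet.univ, Measure.restrict_univ,
      ← ofReal_integral_eq_lintegral_ofReal h1.1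
        (Filter.Eventually.of_forall fun x => (mm_pos Z R _ hk s x).le), h1.2]
    simp
  have T := integral_sub_le_two_TV (dens volume (mm Z R (cen e M)) t)
    (dens volume (mm Z R (cen e M)) t') hm hb
  simp only [e1, Finset.sum_const_zero, mul_zero, sub_zero] at A
  have e3 : (k : ℝ)⁻¹ * ∑ i, ∫ ξ, hi i (shift Z (par Z R t' i) ξ) ∂(gam d)
      ≤ (k : ℝ)⁻¹ * (-((∑ i, σ i) / (2 * B4))) := by
    refine mul_le_mul_of_nonneg_left ?_ (by positivity)
    rw [Finset.sum_div, ← Finset.sum_neg_distrib]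
    exact Finset.sum_le_sum fun i _ => e2 i
  have hA := (abs_le.1 A).1
  have hB := (abs_le.1 B).2
  have hB4 : (0 : ℝ) < B4 := by linarith [three_le_B4]
  have e4 : (k : ℝ)⁻¹ * ((∑ i, σ i) / (2 * B4)) ≤
      2 * TV (dens volume (mm Z R (cen e M)) t) (dens volume (mm Z R (cen e M)) t') + 64 / M ^ 2 := by
    have : (64 : ℝ) / M ^ 2 = 32 / M ^ 2 + 32 / M ^ 2 := by ring
    rw [this]
    linarith
  rw [inv_mul_le_iff₀ hk', div_le_iff₀ (by positivity)] at e4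
  linarith

theorem hpar_bound (hk : 0 < k) (e : Fin d) (he : Z e) {α R C1 : ℝ} (hα : 0 < α) (hα1 : α ≤ 1)
    (hC : 0 < C1) (hR : R * Real.sqrt (Fintype.card (JZ Z)) = C1 * α) (hC1 : C1 * α ≤ 1 / 4)
    (t t' : Fin k × JZ Z → ℝ) (ht : ∀ p, |t p| ≤ 1) (ht' : ∀ p, |t' p| ≤ 1)
    (hTV : TV (dens volume (mm Z R (cen e (8 / α))) t) (dens volume (mm Z R (cen e (8 / α))) t')
      ≤ 9 * α) :
    ∑ p, t p ^ 2 - k * Fintype.card (JZ Z) * (38 * B4) / C1 ≤ ∑ p, t p * t' p := by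
  set D : ℝ := (Fintype.card (JZ Z) : ℝ) with hD
  have hB4 : (0 : ℝ) < B4 := by linarith [three_le_B4]
  have hD0 : 0 ≤ D := by positivity
  have hsD : 0 < Real.sqrt D := by
    rcases (Real.sqrt_nonneg D).eq_or_lt with h | h
    · rw [← h, mul_zero] at hR
      have := mul_pos hC hα
      linarith
    · exact h
  have hRp : 0 < R := by
    have h0 : 0 < R * Real.sqrt D := by rw [hR]; positivity
    exact pos_of_mul_pos_left h0 hsD.le
  have hRD : R ^ 2 * D ≤ 1 / 16 := by
    have : R ^ 2 * D = (R * Real.sqrt D) ^ 2 := by rw [mul_pow, Real.sq_sqrt hD0]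
    rw [this, hR]
    have : 0 < C1 * α := by positivity
    nlinarith
  have hsum : ∀ (B : ℝ) (f : JZ Z → ℝ), (∀ j, |f j| ≤ B * R) → 0 ≤ B →
      ∑ j, f j ^ 2 ≤ B ^ 2 * (R ^ 2 * D) := fun B f hf hB => by
    calc _ ≤ ∑ _j : JZ Z, (B * R) ^ 2 := Finset.sum_le_sum fun j _ => by
          rw [← sq_abs]; exact pow_le_pow_left₀ (abs_nonneg _) (hf j) 2
      _ = _ := by rw [Finset.sum_const, Finset.card_univ, nsmul_eq_mul]; ring
  have hp1 : ∀ s : Fin k × JZ Z → ℝ, (∀ p, |s p| ≤ 1) → ∀ i j, |par Z R s i j| ≤ 1 * R :=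
    fun s hs i j => by
      rw [par, abs_mul, abs_of_pos hRp]
      nlinarith [hs (i, j)]
  have S := sigma_sum Z hk e he (M := 8 / α) (R := R) (by positivity) t t'
    (fun i => (hsum 1 _ (hp1 t ht i) zero_le_one).trans (by linarith))
    (fun i => (hsum 1 _ (hp1 t' ht' i) zero_le_one).trans (by linarith))
    (fun i => by
      rw [Real.sqrt_le_left (by norm_num)]
      refine (hsum 2 _ (fun j => ?_) zero_le_two).trans (by linarith)
      rw [Pi.sub_apply]
      have := abs_sub (par Z R t' i j) (par Z R t i j)
      linarith [hp1 t ht i j, hp1 t' ht' i j])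
  have hM : (64 : ℝ) / (8 / α) ^ 2 = α ^ 2 := by field_simp; norm_num
  rw [hM] at S
  have S2 : ∑ i, Real.sqrt (∑ j, (par Z R t' i - par Z R t i) j ^ 2) ≤ 38 * B4 * k * α := by
    refine S.trans ?_
    have : 2 * TV (dens volume (mm Z R (cen e (8 / α))) t)
      (dens volume (mm Z R (cen e (8 / α))) t') + α ^ 2 ≤ 19 * α := by nlinarith
    calc _ ≤ 2 * B4 * k * (19 * α) := mul_le_mul_of_nonneg_left this (by positivity)
      _ = _ := by ring
  have S3 : R * (∑ p, t p ^ 2 - ∑ p, t p * t' p)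
      ≤ Real.sqrt D * ∑ i, Real.sqrt (∑ j, (par Z R t' i - par Z R t i) j ^ 2) := by
    rw [← Finset.sum_sub_distrib, Fintype.sum_prod_type, Finset.mul_sum, Finset.mul_sum]
    refine Finset.sum_le_sum fun i _ => ?_
    have cs := Real.sum_mul_le_sqrt_mul_sqrt Finset.univ (fun j => - t (i, j))
      (fun j => (par Z R t' i - par Z R t i) j)
    have h1 : ∑ j, (- t (i, j)) * (par Z R t' i - par Z R t i) j
        = R * ∑ j, (t (i, j) ^ 2 - t (i, j) * t' (i, j)) := by
      rw [Finset.mul_sum]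
      refine Finset.sum_congr rfl fun j _ => ?_
      rw [Pi.sub_apply, par, par]; ring
    rw [h1] at cs
    refine cs.trans (mul_le_mul_of_nonneg_right (Real.sqrt_le_sqrt ?_) (Real.sqrt_nonneg _))
    calc _ ≤ ∑ _j : JZ Z, (1 : ℝ) := Finset.sum_le_sum fun j _ => by
          rw [neg_sq, sq_le_one_iff_abs_le_one]; exact ht (i, j)
      _ = _ := by simp [hD]
  have S4 : R * (∑ p, t p ^ 2 - ∑ p, t p * t' p) ≤ R * (k * D * (38 * B4) / C1) := by
    refine S3.trans ?_
    refine (mul_le_mul_of_nonneg_left S2 hsD.le).trans_eq ?_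
    rw [← mul_div_assoc, eq_div_iff hC.ne']
    have : D = Real.sqrt D * Real.sqrt D := (Real.mul_self_sqrt hD0).symm
    calc Real.sqrt D * (38 * B4 * k * α) * C1 = Real.sqrt D * (38 * B4 * k) * (C1 * α) := by ring
      _ = Real.sqrt D * (38 * B4 * k) * (R * Real.sqrt D) := by rw [hR]
      _ = R * (k * (Real.sqrt D * Real.sqrt D) * (38 * B4)) := by ring
      _ = _ := by rw [← this]
  have := le_of_mul_le_mul_left S4 hRp
  linarith

end tvpar

/-! ### Final assembly -/

/-- Coordinates carrying the responses. -/
def Zd (d : ℕ) (c : Fin d) : Prop := ¬ (c : ℕ) < d / 2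

instance Zd_dec (d : ℕ) : DecidablePred (Zd d) := fun c => by unfold Zd; infer_instance

theorem card_Zd (d : ℕ) : Fintype.card (JZ (Zd d)) = (d - d / 2) * (d / 2 + 1) := by
  have h1 : Fintype.card {b : Fin d // ¬ Zd d b} = d / 2 := by
    rw [← Fintype.card_fin_lt_of_le (Nat.div_le_self d 2)]
    exact Fintype.card_congr (Equiv.subtypeEquivRight fun b => by simp [Zd])
  have h2 : Fintype.card {b : Fin d // Zd d b} = d - d / 2 := by
    have := Fintype.card_subtype_compl (Zd d)
    have h3 := Fintype.card_subtype_le (Zd d)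
    rw [h1, Fintype.card_fin] at this
    rw [Fintype.card_fin] at h3
    omega
  rw [Fintype.card_prod, Fintype.card_option, h1, h2]

theorem card_Zd_le {d : ℕ} (hd : 1 ≤ d) : (Fintype.card (JZ (Zd d)) : ℝ) ≤ (d : ℝ) ^ 2 := by
  rw [card_Zd]
  have : (d - d / 2) * (d / 2 + 1) ≤ d * d := Nat.mul_le_mul (by omega) (by omega)
  rw [sq]
  exact_mod_cast this

theorem le_card_Zd (d : ℕ) : (d : ℝ) ^ 2 ≤ 4 * (Fintype.card (JZ (Zd d)) : ℝ) := by
  rw [card_Zd]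
  have : d * d ≤ (2 * (d - d / 2)) * (2 * (d / 2 + 1)) := Nat.mul_le_mul (by omega) (by omega)
  have h2 : (d : ℝ) * d ≤ (2 * ((d - d / 2 : ℕ) : ℝ)) * (2 * ((d / 2 : ℕ) + 1)) := by
    exact_mod_cast this
  push_cast
  rw [sq]
  nlinarith

theorem sinh_bound {ε : ℝ} (h0 : 0 ≤ ε) (h1 : ε ≤ 1) :
    (Real.exp ε - Real.exp (-ε)) / 2 ≤ 2 * ε := by
  have h2 := Real.add_one_le_exp (-ε)
  have h3 : Real.exp ε ≤ 1 + ε + ε ^ 2 := by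
    have := Real.abs_exp_sub_one_sub_id_le (x := ε) (by rw [abs_of_nonneg h0]; exact h1)
    linarith [(abs_le.1 this).2]
  nlinarith

/-- The universal radius constant. -/
def C1 : ℝ := 912 * B4

theorem C1_ge : 1 ≤ C1 := by unfold C1; linarith [three_le_B4]

theorem core {d k : ℕ} (hd : 1 ≤ d) (hk : 2 ≤ k) {α ε δ : ℝ} (hα : 0 < α) (hαc : C1 * α ≤ 1 / 4)
    (hε : 0 < ε) (hε1 : ε ≤ 1) (hδ : 0 < δ) (hδ1 : δ * d ≤ α * ε)
    (n : ℕ) (K : Kernel (Fin n → (Fin d → ℝ)) (Measure (Fin d → ℝ))) [IsMarkovKernel K]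
    (hdp : IsDP K ε δ)
    (hS : ∀ (w : Fin k → ℝ) (μs : Fin k → (Fin d → ℝ)) (Ss : Fin k → Matrix (Fin d) (Fin d) ℝ),
          IsMixtureParams w Ss →
          (2 / 3 : ℝ≥0∞) ≤
            ((Measure.pi fun _ : Fin n => mixture d k w μs Ss).bind fun x => K x)
              {Q : Measure (Fin d → ℝ) |
                IsProbabilityMeasure Q ∧ TV Q (mixture d k w μs Ss) ≤ α}) :
    (k : ℝ) * (d : ℝ) ^ 2 / α ^ 2 ≤ 1296 * C1 ^ 2 * n ∧
    (k : ℝ) * (d : ℝ) ^ 2 / (α * ε) ≤ 288 * C1 * n := by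
  have hC := C1_ge
  have hα1 : α ≤ 1 := by nlinarith
  have hk0 : 0 < k := by omega
  have hkr : (0 : ℝ) < k := by exact_mod_cast hk0
  have hdr : (1 : ℝ) ≤ d := by exact_mod_cast hd
  have hB4 : (0 : ℝ) < B4 := by linarith [three_le_B4]
  set D : ℝ := (Fintype.card (JZ (Zd d)) : ℝ) with hD
  have hDu : D ≤ (d : ℝ) ^ 2 := card_Zd_le hd
  have hDl : (d : ℝ) ^ 2 ≤ 4 * D := le_card_Zd d
  have hD0 : 0 < D := by nlinarith
  have hsD : 0 < Real.sqrt D := Real.sqrt_pos.2 hD0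
  have hsDd : Real.sqrt D ≤ d := by
    rw [Real.sqrt_le_left (by positivity)]; exact hDu
  set R : ℝ := C1 * α / Real.sqrt D with hR
  have hRs : R * Real.sqrt D = C1 * α := div_mul_cancel₀ _ hsD.ne'
  have hR0 : 0 ≤ R := by positivity
  let e : Fin d := ⟨d - 1, by omega⟩
  have he : Zd d e := by
    change ¬ (d - 1 < d / 2)
    omega
  have hF := isFam (Zd d) R (cen (k := k) e (8 / α)) hk0 hR0
  have low := hF.lower
    (fun x => continuous_mm (Zd d) R (cen (k := k) e (8 / α)) continuous_id continuous_const)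
    K hα hε.le hδ.le hdp (k * D * (38 * B4) / C1)
    (fun t t' ht ht' hTV => hpar_bound (Zd d) hk0 e he hα hα1 (by linarith) hRs hαc t t' ht ht' hTV)
    (fun t _ => by
      rw [← mixture_eq (Zd d) R (cen (k := k) e (8 / α)) hk0 t]
      refine hS _ _ _ ⟨fun i => by positivity, ?_, fun i => covm_posDef _ _⟩
      simp [hkr.ne'])
  have hcard : (Fintype.card (Fin k × JZ (Zd d)) : ℝ) = k * D := by
    rw [Fintype.card_prod, Fintype.card_fin, Nat.cast_mul]
  rw [hcard] at low
  have hL : (k : ℝ) * D * (38 * B4) / C1 = k * D / 24 := by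
    rw [C1]; field_simp; norm_num
  rw [hL] at low
  have hkD : 0 < (k : ℝ) * D := by positivity
  have hlhs : (k : ℝ) * D / 9 - 4 / 3 * (k * D / 24) = k * D * (1 / 18) := by ring
  rw [hlhs] at low
  obtain ⟨l1, l2⟩ := low
  have hR2 : R ^ 2 * D = (C1 * α) ^ 2 := by
    rw [← hRs, mul_pow, Real.sq_sqrt hD0.le]
  constructor
  · have h1 := le_of_mul_le_mul_left l1 hkD
    have h2 : (1 / 18 : ℝ) ^ 2 ≤ n * (R ^ 2 / k) := by
      have := pow_le_pow_left₀ (by norm_num) h1 2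
      rwa [Real.sq_sqrt (by positivity)] at this
    have h3 : (k : ℝ) / 324 ≤ n * R ^ 2 := by
      rw [← mul_div_assoc, le_div_iff₀ hkr] at h2
      linarith
    have h4 : (k : ℝ) * D / 324 ≤ n * (C1 * α) ^ 2 := by
      rw [← hR2]
      have := mul_le_mul_of_nonneg_right h3 hD0.le
      linarith
    rw [div_le_iff₀ (by positivity)]
    have h5 := mul_le_mul_of_nonneg_left hDl hkr.le
    rw [mul_pow] at h4
    linarith
  · have h1 : (Real.exp ε - Real.exp (-ε)) / 2 * (R * Real.sqrt D) + 2 * δ * (R * D)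
        ≤ 4 * ε * (C1 * α) := by
      have hRD : R * D = C1 * α * Real.sqrt D := by
        rw [← hRs, mul_assoc, Real.mul_self_sqrt hD0.le]
      rw [hRs, hRD]
      have h2 : δ * Real.sqrt D ≤ ε := by
        calc δ * Real.sqrt D ≤ δ * d := mul_le_mul_of_nonneg_left hsDd hδ.le
          _ ≤ α * ε := hδ1
          _ ≤ ε := by nlinarith
      have h3 := sinh_bound hε.le hε1
      have h4 : 0 < C1 * α := by positivity
      have h5 := mul_le_mul_of_nonneg_right h3 h4.le
      have h6 := mul_le_mul_of_nonneg_right h2 h4.le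
      linarith
    have h2 : (k : ℝ) * D * (1 / 18) ≤ n * (4 * ε * (C1 * α)) :=
      l2.trans (mul_le_mul_of_nonneg_left h1 (by positivity))
    rw [div_le_iff₀ (by positivity)]
    have h3 := mul_le_mul_of_nonneg_left hDl hkr.le
    linarith

/-- Theorem 1.3: sample complexity lower bound for privately learning mixtures of
`k` Gaussians in `ℝ^d`. -/
theorem private_GMM_learning_lower_bound :
    ∃ cstar : ℝ, cstar ∈ Set.Ioo (0 : ℝ) 1 ∧ ∃ C ≥ (1 : ℝ), ∃ c > (0 : ℝ),
      ∀ d k : ℕ, 1 ≤ d → 2 ≤ k →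
      ∀ α ε δ : ℝ, 0 < α → α ≤ cstar → 0 < ε → ε ≤ cstar →
        0 < δ → δ ≤ (α * ε / d) ^ C →
      ∀ (n : ℕ) (K : Kernel (Fin n → (Fin d → ℝ)) (Measure (Fin d → ℝ))),
        IsMarkovKernel K → IsDP K ε δ →
        (∀ (w : Fin k → ℝ) (μs : Fin k → (Fin d → ℝ)) (Ss : Fin k → Matrix (Fin d) (Fin d) ℝ),
          IsMixtureParams w Ss →
          (2 / 3 : ℝ≥0∞) ≤
            ((Measure.pi fun _ : Fin n => mixture d k w μs Ss).bind fun x => K x)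
              {Q : Measure (Fin d → ℝ) |
                IsProbabilityMeasure Q ∧ TV Q (mixture d k w μs Ss) ≤ α}) →
        (n : ℝ) ≥ c * ((k : ℝ) * (d : ℝ) ^ 2 / α ^ 2 + (k : ℝ) * (d : ℝ) ^ 2 / (α * ε) +
            (k : ℝ) * Real.log (1 / δ) / (α * ε)) /
          Real.log (2 + (k : ℝ) * d / (α * ε * δ)) ^ C := by
  have hC := C1_ge
  have hC0 : 0 < C1 := by linarith
  refine ⟨1 / (4 * C1), ⟨by positivity, by rw [div_lt_one (by positivity)]; linarith⟩, 1, le_rfl,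
    1 / (1296 * C1 ^ 2 + 576 * C1), by positivity, ?_⟩
  intro d k hd hk α ε δ hα hαc hε hεc hδ hδc n K hK hdp hS
  rw [Real.rpow_one] at hδc
  rw [Real.rpow_one]
  have hdr : (1 : ℝ) ≤ d := by exact_mod_cast hd
  have hkr : (2 : ℝ) ≤ k := by exact_mod_cast hk
  have hc1 : 1 / (4 * C1) ≤ 1 := by rw [div_le_one (by positivity)]; linarith
  have hα1 : α ≤ 1 := hαc.trans hc1
  have hε1 : ε ≤ 1 := hεc.trans hc1
  have hαC : C1 * α ≤ 1 / 4 := by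
    calc C1 * α ≤ C1 * (1 / (4 * C1)) := mul_le_mul_of_nonneg_left hαc hC0.le
      _ = 1 / 4 := by field_simp
  have hδd : δ * d ≤ α * ε := by rwa [le_div_iff₀ (by linarith)] at hδc
  obtain ⟨b1, b2⟩ := core hd hk hα hαC hε hε1 hδ hδd n K hdp hS
  have hαε : α * ε ≤ 1 := by nlinarith
  have hαε0 : 0 < α * ε := by positivity
  have hδ1 : δ ≤ 1 := by nlinarith
  have hbig : 1 / δ ≤ (k : ℝ) * d / (α * ε * δ) := by
    rw [div_le_div_iff₀ hδ (by positivity)]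
    have : α * ε ≤ k * d := by nlinarith
    nlinarith
  have hone : 1 ≤ 1 / δ := by rw [le_div_iff₀ hδ]; linarith
  set LL := Real.log (2 + (k : ℝ) * d / (α * ε * δ)) with hLL
  have hL1 : 1 ≤ LL := by
    rw [hLL, Real.le_log_iff_exp_le (by linarith)]
    linarith [Real.exp_one_lt_d9]
  have hL2 : Real.log (1 / δ) ≤ LL := Real.log_le_log (by positivity) (by linarith)
  have hn : (0 : ℝ) ≤ n := by positivity
  have hL0 : 0 < LL := by linarith
  rw [ge_iff_le, div_le_iff₀ hL0, one_div, inv_mul_le_iff₀ (by positivity)]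
  have t3 : (k : ℝ) * Real.log (1 / δ) / (α * ε) ≤ 288 * C1 * n * LL := by
    calc (k : ℝ) * Real.log (1 / δ) / (α * ε) ≤ (k : ℝ) * d ^ 2 * LL / (α * ε) := by
          refine div_le_div_of_nonneg_right ?_ hαε0.le
          have h1 : (k : ℝ) * Real.log (1 / δ) ≤ k * LL :=
            mul_le_mul_of_nonneg_left hL2 (by linarith)
          have h2 : (1 : ℝ) ≤ (d : ℝ) ^ 2 := one_le_pow₀ hdr
          have h3 : (k : ℝ) * LL ≤ k * LL * d ^ 2 := le_mul_of_one_le_right (by positivity) h2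
          linarith
      _ = (k : ℝ) * d ^ 2 / (α * ε) * LL := by ring
      _ ≤ _ := mul_le_mul_of_nonneg_right b2 hL0.le
  have t1 : (k : ℝ) * (d : ℝ) ^ 2 / α ^ 2 ≤ 1296 * C1 ^ 2 * n * LL :=
    b1.trans (le_mul_of_one_le_right (by positivity) hL1)
  have t2 : (k : ℝ) * (d : ℝ) ^ 2 / (α * ε) ≤ 288 * C1 * n * LL :=
    b2.trans (le_mul_of_one_le_right (by positivity) hL1)
  calc _ ≤ 1296 * C1 ^ 2 * n * LL + 288 * C1 * n * LL + 288 * C1 * n * LL := by linarith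
    _ = _ := by ring


end
end

section
/- There exist universal constants C₁ > 0 and c > 0 such that the following holds. Let n ≥ n' ≥ 20d and L ≥ C₁·n². Let X₁, …, X_n be i.i.d. samples from the standard Gaussian N(0, I_d) in ℝ^d. Then with probability at least 1 − n^{−c·n'}, both of the following hold: (1) ‖X_i‖₂ ≤ L for all i ∈ [n]; and (2) there do not exist a subset Y ⊆ {X₁, …, X_n} of size n', a real number r, and a unit vector v ∈ ℝ^d such that |⟨X_i, v⟩ − r| ≤ 1/L for all X_i ∈ Y. -/
open MeasureTheory ProbabilityTheory Matrix Real
open scoped ENNReal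

noncomputable section

/-- The Euclidean norm of a vector in `ℝ^d`. -/
def vnorm {d : ℕ} (v : Fin d → ℝ) : ℝ := Real.sqrt (∑ i, (v i) ^ 2)

lemma gauss_eq_s5 (d : ℕ) : gauss d 0 1 = Measure.pi (fun _ : Fin d => gaussianReal 0 1) := by
  symm
  apply Measure.pi_eq
  intro s hs
  have h1 : ∀ x : Fin d → ℝ, (Real.sqrt ((2 * Real.pi) ^ d * (1 : Matrix (Fin d) (Fin d) ℝ).det))⁻¹ *
      Real.exp (-(1/2) * ((x - 0) ⬝ᵥ ((1 : Matrix (Fin d) (Fin d) ℝ)⁻¹ *ᵥ (x - 0))))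
      = ∏ i, gaussianPDFReal 0 1 (x i) := by
    intro x
    simp only [gaussianPDFReal, Finset.prod_mul_distrib, ← Real.exp_sum]
    congr 1
    · rw [Finset.prod_const]
      simp
      have h2 : √((2 * π) ^ d) = (√π * √2) ^ d := by
        rw [← Real.sqrt_mul (by positivity), mul_comm π 2]
        rw [Real.sqrt_eq_iff_mul_self_eq (by positivity) (by positivity), ← mul_pow,
          Real.mul_self_sqrt (by positivity)]
      rw [h2, ← mul_inv, inv_pow]
    · congr 1
      simp [dotProduct, Finset.mul_sum]
      rw [← Finset.sum_neg_distrib]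
      refine Finset.sum_congr rfl fun i _ => ?_
      ring
  unfold gauss
  simp only [h1]
  rw [withDensity_apply _ (MeasurableSet.univ_pi hs), volume_pi, Measure.restrict_pi_pi,
    ← ofReal_integral_eq_lintegral_ofReal, integral_fintype_prod_eq_prod (fun _ => gaussianPDFReal 0 1),
    ENNReal.ofReal_prod_of_nonneg]
  · refine Finset.prod_congr rfl fun i _ => ?_
    rw [gaussianReal_apply_eq_integral _ (by simp)]
  · intro i _
    exact integral_nonneg fun x => gaussianPDFReal_nonneg _ _ _
  · exact Integrable.fintype_prod (f := fun _ => gaussianPDFReal 0 1) fun i => (integrable_gaussianPDFReal 0 1).integrableOn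
  · exact Filter.Eventually.of_forall fun x => Finset.prod_nonneg fun i _ => gaussianPDFReal_nonneg _ _ _

instance gauss_prob (d : ℕ) : IsProbabilityMeasure (gauss d 0 1) := by
  rw [gauss_eq_s5]; infer_instance

lemma gauss_map (d : ℕ) (v : Fin d → ℝ) :
    (gauss d 0 1).map (fun x => x ⬝ᵥ v) = gaussianReal 0 (∑ i, v i ^ 2).toNNReal := by
  have h := IsGaussian.map_eq_gaussianReal (μ := stdGaussian (EuclideanSpace ℝ (Fin d)))
    (innerSL ℝ (WithLp.toLp 2 v))
  rw [variance_dual_stdGaussian, integral_strongDual_stdGaussian, innerSL_apply_norm,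
    EuclideanSpace.real_norm_sq_eq, ← map_pi_eq_stdGaussian, Measure.map_map (by fun_prop) (by fun_prop),
    ← gauss_eq_s5] at h
  rw [← h]
  congr 1

lemma gauss_slab (d : ℕ) (v : Fin d → ℝ) (hv : 1 / 4 ≤ ∑ i, v i ^ 2) (r e : ℝ) (he : 0 ≤ e) :
    gauss d 0 1 {x | |x ⬝ᵥ v - r| ≤ e} ≤ ENNReal.ofReal (2 * e) := by
  have hs : {x : Fin d → ℝ | |x ⬝ᵥ v - r| ≤ e} = (fun x => x ⬝ᵥ v) ⁻¹' (Set.Icc (r - e) (r + e)) := by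
    ext x
    simp only [Set.mem_ofPred_eq, Set.mem_preimage, Set.mem_Icc, abs_le]
    constructor <;> rintro ⟨a, b⟩ <;> constructor <;> linarith
  have hm : Measurable (fun x : Fin d → ℝ => x ⬝ᵥ v) := by
    unfold dotProduct; fun_prop
  rw [hs, ← Measure.map_apply hm measurableSet_Icc, gauss_map, gaussianReal_apply]
  swap
  · simp; linarith
  calc _ ≤ ∫⁻ x in Set.Icc (r - e) (r + e), 1 := by
        apply lintegral_mono
        intro x
        simp only [gaussianPDF]
        rw [← ENNReal.ofReal_one]
        apply ENNReal.ofReal_le_ofReal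
        unfold gaussianPDFReal
        have hc : (1:ℝ) ≤ √(2 * π * ((∑ i, v i ^ 2).toNNReal : ℝ)) := by
          rw [Real.one_le_sqrt, Real.coe_toNNReal _ (by linarith)]
          nlinarith [Real.pi_gt_three]
        have h2 : Real.exp (-(x - 0) ^ 2 / (2 * ((∑ i, v i ^ 2).toNNReal : ℝ))) ≤ 1 := by
          rw [Real.exp_le_one_iff]
          apply div_nonpos_of_nonpos_of_nonneg
          · nlinarith [sq_nonneg (x - 0)]
          · positivity
        exact mul_le_one₀ (inv_le_one_of_one_le₀ hc) (Real.exp_pos _).le h2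
    _ = _ := by
        rw [lintegral_one, Measure.restrict_apply_univ, Real.volume_Icc]
        congr 1; ring

lemma gauss_tail1 (d : ℕ) (j : Fin d) (t : ℝ) (ht : 0 ≤ t) :
    gauss d 0 1 {x | t ≤ |x j|} ≤ ENNReal.ofReal (2 * Real.exp (-(t ^ 2 / 2))) := by
  have key : ∀ s : ℝ, s ^ 2 = 1 →
      gauss d 0 1 {x | t ≤ s * x j} ≤ ENNReal.ofReal (Real.exp (-(t ^ 2 / 2))) := by
    intro s hs
    have hm : (gauss d 0 1).map (fun x => s * x j) = gaussianReal 0 1 := by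
      have := gauss_map d (Pi.single j s)
      simp only [dotProduct_single] at this
      rw [show (fun x : Fin d → ℝ => s * x j) = fun x => x j * s by ext; ring, this]
      congr 1
      have : ∀ i, (Pi.single j s : Fin d → ℝ) i ^ 2 = if i = j then s ^ 2 else 0 := by
        intro i; by_cases h : i = j
        · subst h; simp
        · simp [h]
      simp [this, hs]
    have hint : Integrable (fun x => Real.exp (t * (s * x j))) (gauss d 0 1) := by
      have := integrable_exp_mul_gaussianReal (μ := 0) (v := 1) t
      rw [← hm, integrable_map_measure (by fun_prop) (Measurable.aemeasurable (by fun_prop))] at this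
      exact this
    have := measure_ge_le_exp_mul_mgf t ht hint
    rw [mgf_gaussianReal hm, ← Real.exp_add] at this
    rw [← ofReal_measureReal]
    apply ENNReal.ofReal_le_ofReal
    refine this.trans_eq ?_
    congr 1
    push_cast
    ring
  calc _ ≤ gauss d 0 1 ({x | t ≤ 1 * x j} ∪ {x | t ≤ (-1) * x j}) := by
        apply measure_mono
        intro x hx
        simp only [Set.mem_ofPred_eq, Set.mem_union] at *
        rcases le_abs.1 hx with h | h
        · left; linarith
        · right; linarith
    _ ≤ _ := (measure_union_le _ _).trans (add_le_add (key 1 (by norm_num)) (key (-1) (by norm_num)))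
    _ = _ := by
        rw [← ENNReal.ofReal_add (by positivity) (by positivity)]
        congr 1; ring

lemma gauss_tail (d n : ℕ) (hn : d ≤ n) (hn0 : 0 < n) (L : ℝ) (hL : 0 ≤ L) :
    gauss d 0 1 {x | L < vnorm x} ≤ ENNReal.ofReal (n * (2 * Real.exp (-((L / n) ^ 2 / 2)))) := by
  have hsub : {x : Fin d → ℝ | L < vnorm x} ⊆ ⋃ j : Fin d, {x | L / n ≤ |x j|} := by
    intro x hx
    by_contra hcon
    simp only [Set.mem_iUnion, Set.mem_ofPred_eq, not_exists, not_le] at hcon hx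
    have : vnorm x ≤ L := by
      unfold vnorm
      apply Real.sqrt_le_iff.2 ⟨hL, ?_⟩
      calc ∑ i, x i ^ 2 ≤ ∑ i : Fin d, (L / n) ^ 2 := by
            apply Finset.sum_le_sum
            intro i _
            rw [← sq_abs]
            have := hcon i
            gcongr
        _ = d * (L / n) ^ 2 := by simp
        _ ≤ (n : ℝ) ^ 2 * (L / n) ^ 2 := by
            gcongr
            norm_cast
            nlinarith
        _ = L ^ 2 := by field_simp
    linarith
  calc _ ≤ _ := measure_mono hsub
    _ ≤ ∑ j : Fin d, _ := measure_iUnion_fintype_le _ _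
    _ ≤ ∑ j : Fin d, ENNReal.ofReal (2 * Real.exp (-((L / n) ^ 2 / 2))) :=
        Finset.sum_le_sum fun j _ => gauss_tail1 d j _ (by positivity)
    _ = ENNReal.ofReal (d * (2 * Real.exp (-((L / n) ^ 2 / 2)))) := by
        rw [Finset.sum_const, ENNReal.ofReal_mul (by positivity)]
        simp
    _ ≤ _ := by
        apply ENNReal.ofReal_le_ofReal
        gcongr

lemma round_grid (M : ℕ) (hM : 0 < M) (t : ℝ) (ht : |t| ≤ 1) :
    ∃ k ∈ Finset.Icc (-(M : ℤ)) M, |t - (k : ℝ) / M| ≤ 1 / M := by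
  have hM' : (0 : ℝ) < M := by exact_mod_cast hM
  obtain ⟨h1, h2⟩ := abs_le.1 ht
  refine ⟨⌊t * M⌋, ?_, ?_⟩
  · rw [Finset.mem_Icc]
    constructor
    · rw [Int.le_floor]; push_cast; nlinarith
    · have : (⌊t * M⌋ : ℝ) ≤ M := (Int.floor_le _).trans (by nlinarith)
      exact_mod_cast this
  · have a := Int.floor_le (t * M)
    have b := Int.lt_floor_add_one (t * M)
    have e : t - (⌊t * M⌋ : ℝ) / M = (t * M - ⌊t * M⌋) / M := by field_simp
    rw [e, abs_div, abs_of_pos hM']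
    gcongr
    rw [abs_le]; constructor <;> linarith

lemma abs_le_vnorm {d : ℕ} (x : Fin d → ℝ) (j : Fin d) : |x j| ≤ vnorm x := by
  unfold vnorm
  apply Real.abs_le_sqrt
  exact Finset.single_le_sum (f := fun i => x i ^ 2) (fun i _ => sq_nonneg _) (Finset.mem_univ j)

lemma net_exists {d n : ℕ} (hn : 20 ≤ n) (hd : d ≤ n) (L : ℝ) (hL : 1 ≤ L) (M : ℕ)
    (hM : n * L ^ 2 ≤ M) (X : Fin n → Fin d → ℝ) (hX : ∀ i, vnorm (X i) ≤ L)
    (Y : Finset (Fin n)) (hY : Y.Nonempty) (r : ℝ) (v : Fin d → ℝ) (hv : vnorm v = 1)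
    (h : ∀ i ∈ Y, |(X i ⬝ᵥ v) - r| ≤ 1 / L) :
    ∃ k ∈ Fintype.piFinset (fun _ : Fin d => Finset.Icc (-(M : ℤ)) M),
      ∃ m ∈ Finset.Icc (-(M : ℤ)) M,
        1 / 4 ≤ ∑ i, ((k i : ℝ) / M) ^ 2 ∧
        ∀ i ∈ Y, |(X i ⬝ᵥ fun j => (k j : ℝ) / M) - 2 * L * ((m : ℝ) / M)| ≤ 3 / L := by
  have hn' : (20 : ℝ) ≤ n := by exact_mod_cast hn
  have hd' : (d : ℝ) ≤ n := by exact_mod_cast hd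
  have hL2 : 1 ≤ L ^ 2 := one_le_pow₀ hL
  have hMn : (n : ℝ) ≤ M := by nlinarith
  have hM0' : (0 : ℝ) < M := by linarith
  have hM0 : 0 < M := by exact_mod_cast hM0'
  have hL0 : 0 < L := by linarith
  have hv2 : ∑ i, v i ^ 2 = 1 := by
    unfold vnorm at hv
    rwa [Real.sqrt_eq_one] at hv
  have hLinv : 1 / L ≤ 1 := by rw [div_le_one hL0]; exact hL
  have hr : |r / (2 * L)| ≤ 1 := by
    obtain ⟨i, hi⟩ := hY
    have h1 := h i hi
    have h2 : |X i ⬝ᵥ v| ≤ L := by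
      apply abs_le_of_sq_le_sq _ hL0.le
      have := Finset.sum_mul_sq_le_sq_mul_sq Finset.univ (X i) v
      rw [hv2, mul_one] at this
      refine this.trans ?_
      have h3 := hX i
      unfold vnorm at h3
      exact (Real.sqrt_le_left hL0.le).1 h3
    rw [abs_div, abs_of_pos (by linarith : 0 < 2 * L), div_le_one (by linarith)]
    rw [abs_le] at *
    constructor <;> linarith [h1.1, h1.2, h2.1, h2.2]
  choose k hk hk2 using fun j => round_grid M hM0 (v j) (hv ▸ abs_le_vnorm v j)
  obtain ⟨m, hm, hm2⟩ := round_grid M hM0 _ hr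
  refine ⟨k, Fintype.mem_piFinset.2 hk, m, hm, ?_, ?_⟩
  · have h1 : ∀ j, v j ^ 2 / 2 - (1 / (M : ℝ)) ^ 2 ≤ ((k j : ℝ) / M) ^ 2 := by
      intro j
      have := sq_le_sq' (abs_le.1 (hk2 j)).1 (abs_le.1 (hk2 j)).2
      nlinarith [sq_nonneg (v j - 2 * ((k j : ℝ) / M))]
    have h2 := Finset.sum_le_sum fun j (_ : j ∈ Finset.univ) => h1 j
    rw [Finset.sum_sub_distrib, ← Finset.sum_div, hv2] at h2
    simp only [Finset.sum_const, Finset.card_univ, Fintype.card_fin, nsmul_eq_mul] at h2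
    have h3 : (d : ℝ) * (1 / M) ^ 2 ≤ 1 / 4 := by
      rw [div_pow, one_pow, mul_one_div, div_le_iff₀ (by positivity)]
      nlinarith
    linarith
  · intro i hi
    have h1 := h i hi
    have h2 : |(X i ⬝ᵥ v) - (X i ⬝ᵥ fun j => (k j : ℝ) / M)| ≤ 1 / L := by
      rw [← dotProduct_sub]
      unfold dotProduct
      calc _ ≤ ∑ j, |X i j * (v - fun j => (k j : ℝ) / M) j| := Finset.abs_sum_le_sum_abs _ _
        _ ≤ ∑ j : Fin d, L * (1 / M) := by
            apply Finset.sum_le_sum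
            intro j _
            rw [abs_mul]
            exact mul_le_mul ((abs_le_vnorm _ j).trans (hX i)) (hk2 j) (abs_nonneg _) hL0.le
        _ = d * (L * (1 / M)) := by simp
        _ ≤ 1 / L := by
            rw [mul_one_div, ← mul_div_assoc, div_le_div_iff₀ hM0' hL0]
            nlinarith
    have h3 : |r - 2 * L * ((m : ℝ) / M)| ≤ 1 / L := by
      have : r - 2 * L * ((m : ℝ) / M) = 2 * L * (r / (2 * L) - m / M) := by field_simp
      rw [this, abs_mul, abs_of_pos (by linarith : 0 < 2 * L)]
      calc _ ≤ 2 * L * (1 / M) := by gcongr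
        _ ≤ 1 / L := by
            rw [mul_one_div, div_le_div_iff₀ hM0' hL0]
            nlinarith
    have h4 : 3 / L = 1 / L + 1 / L + 1 / L := by ring
    rw [h4]
    rw [abs_le] at *
    constructor <;> linarith [h1.1, h1.2, h2.1, h2.2, h3.1, h3.2]

lemma num1 (n n' : ℕ) (hn : 20 ≤ n) (hn' : n' ≤ n) (L : ℝ) (hL : 10000 * (n : ℝ) ^ 2 ≤ L) :
    n * ((n : ℝ) * (2 * Real.exp (-((L / n) ^ 2 / 2)))) ≤
      (1 / 2) * (n : ℝ) ^ (-((2 / 5) * (n' : ℝ))) := by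
  have h20 : (20 : ℝ) ≤ n := by exact_mod_cast hn
  have hnn : (n' : ℝ) ≤ n := by exact_mod_cast hn'
  have h0 : (0 : ℝ) < n := by linarith
  have hlog : Real.log n ≤ n := (Real.log_le_sub_one_of_pos h0).trans (by linarith)
  have hlog0 : 0 ≤ Real.log n := Real.log_nonneg (by linarith)
  have hLn : 10000 * (n : ℝ) ≤ L / n := by
    rw [le_div_iff₀ h0]; linarith
  have h1 : 10 * (n : ℝ) ^ 2 ≤ (L / n) ^ 2 / 2 := by
    have := pow_le_pow_left₀ (by positivity) hLn 2
    nlinarith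
  have h2 : Real.exp (-(n : ℝ) ^ 2) ≤ (n : ℝ) ^ (-((2 / 5) * (n' : ℝ))) := by
    rw [Real.rpow_def_of_pos h0]
    apply Real.exp_le_exp.2
    have : Real.log n * n' ≤ n * n := mul_le_mul hlog hnn (by positivity) h0.le
    have h3 : 0 ≤ Real.log n * n' := by positivity
    nlinarith
  have h3 : 9 * (n : ℝ) ^ 2 + 1 ≤ Real.exp (9 * (n : ℝ) ^ 2) := Real.add_one_le_exp _
  have h4 : Real.exp (-((L / n) ^ 2 / 2)) ≤ Real.exp (-(10 * (n : ℝ) ^ 2)) :=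
    Real.exp_le_exp.2 (by linarith)
  have h5 : Real.exp (9 * (n : ℝ) ^ 2) * Real.exp (-(10 * (n : ℝ) ^ 2)) = Real.exp (-(n : ℝ) ^ 2) := by
    rw [← Real.exp_add]; congr 1; ring
  have h6 := Real.exp_pos (-(10 * (n : ℝ) ^ 2))
  calc _ ≤ n * ((n : ℝ) * (2 * Real.exp (-(10 * (n : ℝ) ^ 2)))) := by gcongr
    _ = (1 / 2) * ((4 * (n : ℝ) ^ 2) * Real.exp (-(10 * (n : ℝ) ^ 2))) := by ring
    _ ≤ (1 / 2) * (Real.exp (9 * (n : ℝ) ^ 2) * Real.exp (-(10 * (n : ℝ) ^ 2))) := by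
        gcongr; nlinarith
    _ ≤ _ := by rw [h5]; linarith

lemma num2 (d n n' M : ℕ) (hd : 1 ≤ d) (hn' : n' ≤ n) (hdn : 20 * d ≤ n') (L : ℝ)
    (hL : 10000 * (n : ℝ) ^ 2 ≤ L) (hM : (M : ℝ) ≤ n * L ^ 2 + 1) :
    (n.choose n' : ℝ) * (((2 * M + 1 : ℝ) ^ d * (2 * M + 1)) * (2 * (3 / L)) ^ n') ≤
      (1 / 2) * (n : ℝ) ^ (-((2 / 5) * (n' : ℝ))) := by
  have h20 : (20 : ℝ) ≤ n := by exact_mod_cast (by omega : 20 ≤ n)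
  have h0 : (0 : ℝ) < n := by linarith
  have hL3 : 3 * (n : ℝ) ≤ L := by nlinarith
  have hL1 : 1 ≤ L := by linarith
  have hL0 : 0 < L := by linarith
  have hL2 : 1 ≤ L ^ 2 := one_le_pow₀ hL1
  have h1 : (2 * M + 1 : ℝ) ≤ L ^ 3 := by
    have : 3 * (n : ℝ) * L ^ 2 ≤ L * L ^ 2 := by gcongr
    nlinarith
  have h2 : (2 * M + 1 : ℝ) ^ d * (2 * M + 1) ≤ (L ^ (3 / 10 : ℝ)) ^ n' := by
    rw [← pow_succ]
    calc _ ≤ (L ^ 3) ^ (d + 1) := by gcongr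
      _ = L ^ (3 * (d + 1)) := by rw [pow_mul]
      _ ≤ L ^ (6 * d) := pow_le_pow_right₀ hL1 (by omega)
      _ = L ^ ((6 * d : ℕ) : ℝ) := (Real.rpow_natCast _ _).symm
      _ ≤ L ^ ((3 / 10 : ℝ) * n') := by
          apply Real.rpow_le_rpow_of_exponent_le hL1
          have : (20 : ℝ) * d ≤ n' := by exact_mod_cast hdn
          push_cast; linarith
      _ = _ := by rw [Real.rpow_mul hL0.le, Real.rpow_natCast]
  have h3 : (n.choose n' : ℝ) ≤ (n : ℝ) ^ n' := by exact_mod_cast Nat.choose_le_pow n n'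
  have hbase : n * (L ^ (3 / 10 : ℝ) * (2 * (3 / L))) ≤ (1 / 2) * (n : ℝ) ^ (-(2 / 5) : ℝ) := by
    have e1 : L ^ (3 / 10 : ℝ) * (2 * (3 / L)) = 6 * L ^ (-(7 / 10) : ℝ) := by
      rw [show (-(7 / 10) : ℝ) = 3 / 10 - 1 by norm_num, Real.rpow_sub_one hL0.ne']
      ring
    have e2 : L ^ (-(7 / 10) : ℝ) ≤ (10000 * (n : ℝ) ^ 2) ^ (-(7 / 10) : ℝ) :=
      Real.rpow_le_rpow_of_nonpos (by positivity) hL (by norm_num)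
    have e3 : (10000 : ℝ) ^ (-(7 / 10) : ℝ) ≤ 1 / 100 := by
      calc (10000 : ℝ) ^ (-(7 / 10) : ℝ) ≤ (10000 : ℝ) ^ (-(1 / 2) : ℝ) :=
            Real.rpow_le_rpow_of_exponent_le (by norm_num) (by norm_num)
        _ = 1 / 100 := by
            rw [Real.rpow_neg (by norm_num), ← Real.sqrt_eq_rpow,
              show (10000 : ℝ) = 100 ^ 2 by norm_num, Real.sqrt_sq (by norm_num)]
            norm_num
    have e4 : ((n : ℝ) ^ 2) ^ (-(7 / 10) : ℝ) * n = (n : ℝ) ^ (-(2 / 5) : ℝ) := by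
      rw [← Real.rpow_natCast, ← Real.rpow_mul h0.le]
      nth_rewrite 2 [← Real.rpow_one (n : ℝ)]
      rw [← Real.rpow_add h0]
      norm_num
    rw [Real.mul_rpow (by norm_num) (by positivity)] at e2
    rw [e1]
    calc _ ≤ n * (6 * ((1 / 100) * ((n : ℝ) ^ 2) ^ (-(7 / 10) : ℝ))) := by
          gcongr
          exact e2.trans (by gcongr)
      _ = (6 / 100) * (n : ℝ) ^ (-(2 / 5) : ℝ) := by rw [← e4]; ring
      _ ≤ _ := mul_le_mul_of_nonneg_right (by norm_num) (by positivity)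
  calc _ ≤ (n : ℝ) ^ n' * ((L ^ (3 / 10 : ℝ)) ^ n' * (2 * (3 / L)) ^ n') := by gcongr
    _ = (n * (L ^ (3 / 10 : ℝ) * (2 * (3 / L)))) ^ n' := by rw [← mul_pow, ← mul_pow]
    _ ≤ ((1 / 2) * (n : ℝ) ^ (-(2 / 5) : ℝ)) ^ n' := by gcongr
    _ = (1 / 2) ^ n' * (n : ℝ) ^ (-((2 / 5) * (n' : ℝ))) := by
        rw [mul_pow, ← Real.rpow_natCast ((n : ℝ) ^ (-(2 / 5) : ℝ)), ← Real.rpow_mul h0.le]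
        congr 2; ring
    _ ≤ _ := by
        gcongr
        exact pow_le_of_le_one (by norm_num) (by norm_num) (by omega)

/-- Proposition: Gaussian regularity — no large subset of standard Gaussian samples is
nearly contained in an affine hyperplane slab. -/
theorem gaussian_regularity :
    ∃ C₁ > (0 : ℝ), ∃ c > (0 : ℝ), ∀ (d n n' : ℕ) (L : ℝ),
      n' ≤ n → 20 * d ≤ n' → C₁ * (n : ℝ) ^ 2 ≤ L →
      1 - ENNReal.ofReal ((n : ℝ) ^ (-(c * (n' : ℝ)))) ≤
        (Measure.pi fun _ : Fin n => gauss d 0 1)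
          {X : Fin n → (Fin d → ℝ) |
            (∀ i, vnorm (X i) ≤ L) ∧
            ¬ ∃ (Y : Finset (Fin n)) (r : ℝ) (v : Fin d → ℝ),
                Y.card = n' ∧ vnorm v = 1 ∧ ∀ i ∈ Y, |(X i ⬝ᵥ v) - r| ≤ 1 / L} := by
  refine ⟨10000, by norm_num, 2 / 5, by norm_num, ?_⟩
  intro d n n' L hn' hdn hL
  set P := Measure.pi fun _ : Fin n => gauss d 0 1 with hP
  set S := {X : Fin n → (Fin d → ℝ) |
            (∀ i, vnorm (X i) ≤ L) ∧
            ¬ ∃ (Y : Finset (Fin n)) (r : ℝ) (v : Fin d → ℝ),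
                Y.card = n' ∧ vnorm v = 1 ∧ ∀ i ∈ Y, |(X i ⬝ᵥ v) - r| ≤ 1 / L} with hS
  suffices hbad : P Sᶜ ≤ ENNReal.ofReal ((n : ℝ) ^ (-((2 / 5) * (n' : ℝ)))) by
    have h1 : 1 ≤ P S + P Sᶜ := by
      calc 1 = P Set.univ := by rw [measure_univ]
        _ = P (S ∪ Sᶜ) := by rw [Set.union_compl_self]
        _ ≤ _ := measure_union_le _ _
    rw [tsub_le_iff_right]
    exact h1.trans (by gcongr)
  rcases Nat.eq_zero_or_pos d with hd | hd
  · subst hd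
    have hL0 : 0 ≤ L := le_trans (by positivity) hL
    have : Sᶜ = ∅ := by
      rw [Set.compl_empty_iff, Set.eq_univ_iff_forall]
      intro X
      refine ⟨fun i => by simpa [vnorm] using hL0, ?_⟩
      rintro ⟨Y, r, v, -, hv, -⟩
      simp [vnorm] at hv
    rw [this]; simp
  have hn20 : 20 ≤ n := by omega
  have h20 : (20 : ℝ) ≤ n := by exact_mod_cast hn20
  have hL1 : 1 ≤ L := by nlinarith
  have hL0 : 0 < L := by linarith
  set M := ⌈n * L ^ 2⌉₊ with hMdef
  have hM1 : n * L ^ 2 ≤ M := Nat.le_ceil _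
  have hM2 : (M : ℝ) ≤ n * L ^ 2 + 1 := (Nat.ceil_lt_add_one (by positivity)).le
  let K : Finset (Fin d → ℤ) := Fintype.piFinset (fun _ : Fin d => Finset.Icc (-(M : ℤ)) M)
  let K' : Finset (Fin d → ℤ) := K.filter fun k => 1 / 4 ≤ ∑ i, ((k i : ℝ) / M) ^ 2
  let R : Finset ℤ := Finset.Icc (-(M : ℤ)) M
  let A : (Fin d → ℤ) → ℤ → Set (Fin d → ℝ) := fun k m =>
    {x | |(x ⬝ᵥ fun j => (k j : ℝ) / M) - 2 * L * ((m : ℝ) / M)| ≤ 3 / L}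
  let B1 : Set (Fin n → Fin d → ℝ) := ⋃ i : Fin n, (fun X => X i) ⁻¹' {x | L < vnorm x}
  let I := (Finset.powersetCard n' (Finset.univ : Finset (Fin n))) ×ˢ (K' ×ˢ R)
  let B2 : Set (Fin n → Fin d → ℝ) := ⋃ p ∈ I, (p.1 : Set (Fin n)).pi fun _ => A p.2.1 p.2.2
  have hsub : Sᶜ ⊆ B1 ∪ B2 := by
    intro X hX
    by_cases hb : ∀ i, vnorm (X i) ≤ L
    · right
      have hX2 : ∃ (Y : Finset (Fin n)) (r : ℝ) (v : Fin d → ℝ),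
                Y.card = n' ∧ vnorm v = 1 ∧ ∀ i ∈ Y, |(X i ⬝ᵥ v) - r| ≤ 1 / L := by
        by_contra hcon
        exact hX ⟨hb, hcon⟩
      obtain ⟨Y, r, v, hY, hv, h⟩ := hX2
      obtain ⟨k, hk, m, hm, hkm, hall⟩ := net_exists hn20 (by omega) L hL1 M hM1 X hb Y
        (Finset.card_pos.1 (by omega)) r v hv h
      refine Set.mem_iUnion₂.2 ⟨(Y, k, m), ?_, ?_⟩
      · simp only [I, K', Finset.mem_product, Finset.mem_powersetCard, Finset.mem_filter]
        exact ⟨⟨Finset.subset_univ _, hY⟩, ⟨hk, hkm⟩, hm⟩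
      · intro i hi
        exact hall i (by simpa using hi)
    · left
      push Not at hb
      obtain ⟨i, hi⟩ := hb
      exact Set.mem_iUnion.2 ⟨i, hi⟩
  have hB1 : P B1 ≤ ENNReal.ofReal ((1 / 2) * (n : ℝ) ^ (-((2 / 5) * (n' : ℝ)))) := by
    calc P B1 ≤ ∑ i : Fin n, P ((fun X => X i) ⁻¹' {x | L < vnorm x}) :=
          measure_iUnion_fintype_le _ _
      _ ≤ ∑ i : Fin n, ENNReal.ofReal (n * (2 * Real.exp (-((L / n) ^ 2 / 2)))) := by
          apply Finset.sum_le_sum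
          intro i _
          refine le_trans (le_of_eq ?_) (gauss_tail d n (by omega) (by omega) L hL0.le)
          have hms : MeasurableSet {x : Fin d → ℝ | L < vnorm x} := by
            apply measurableSet_lt measurable_const
            unfold vnorm; fun_prop
          exact (measurePreserving_eval (fun _ : Fin n => gauss d 0 1) i).measure_preimage
            hms.nullMeasurableSet
      _ = ENNReal.ofReal (n * ((n : ℝ) * (2 * Real.exp (-((L / n) ^ 2 / 2))))) := by
          rw [Finset.sum_const, ENNReal.ofReal_mul (p := (n : ℝ)) (q := (n : ℝ) * _) (by positivity)]
          simp
      _ ≤ _ := ENNReal.ofReal_le_ofReal (num1 n n' hn20 hn' L hL)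
  have hRc : R.card = 2 * M + 1 := by
    simp only [R, Int.card_Icc]; omega
  have hKc : K'.card ≤ (2 * M + 1) ^ d := by
    refine (Finset.card_filter_le _ _).trans (le_of_eq ?_)
    simp only [K, Fintype.card_piFinset]
    rw [show (Finset.Icc (-(M : ℤ)) M).card = 2 * M + 1 from hRc]
    simp
  have hB2 : P B2 ≤ ENNReal.ofReal ((1 / 2) * (n : ℝ) ^ (-((2 / 5) * (n' : ℝ)))) := by
    calc P B2 ≤ ∑ p ∈ I, P ((p.1 : Set (Fin n)).pi fun _ => A p.2.1 p.2.2) :=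
          measure_biUnion_finset_le _ _
      _ ≤ ∑ p ∈ I, ENNReal.ofReal ((2 * (3 / L)) ^ n') := by
          apply Finset.sum_le_sum
          rintro ⟨Y, k, m⟩ hp
          simp only [I, K', Finset.mem_product, Finset.mem_powersetCard, Finset.mem_filter] at hp
          obtain ⟨⟨-, hY⟩, ⟨hk, hkm⟩, hm⟩ := hp
          rw [hP, Measure.pi_pi_finset, Finset.prod_const, hY, ENNReal.ofReal_pow (by positivity)]
          gcongr
          exact gauss_slab d _ hkm _ _ (by positivity)
      _ = ENNReal.ofReal (I.card * (2 * (3 / L)) ^ n') := by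
          rw [Finset.sum_const, ENNReal.ofReal_mul (by positivity)]
          simp
      _ ≤ ENNReal.ofReal ((n.choose n' : ℝ) *
            (((2 * M + 1 : ℝ) ^ d * (2 * M + 1)) * (2 * (3 / L)) ^ n')) := by
          apply ENNReal.ofReal_le_ofReal
          rw [← mul_assoc]
          gcongr
          simp only [I, Finset.card_product, Finset.card_powersetCard, Finset.card_univ,
            Fintype.card_fin, hRc]
          push_cast
          gcongr
          exact_mod_cast hKc
      _ ≤ _ := ENNReal.ofReal_le_ofReal (num2 d n n' M hd hn' hdn L hL hM2)
  calc P Sᶜ ≤ P (B1 ∪ B2) := measure_mono hsub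
    _ ≤ P B1 + P B2 := measure_union_le _ _
    _ ≤ _ := add_le_add hB1 hB2
    _ = _ := by
        rw [← ENNReal.ofReal_add (by positivity) (by positivity)]
        congr 1; ring

end
end
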